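/- arXiv:math/0404368 — 2 statements merged into one kernel-verified Lean document; each statement's English description precedes it below -/
import Mathlib

section
/- Fix α ∈ (0,1). Let (ε_k)_{k≥1} be a sequence of positive real numbers with ε_k → 0; for each k let θ_k be a Borel probability measure on ℝ, absolutely continuous with respect to Lebesgue measure, whose support is contained in [−ε_k, ε_k] and has nonempty interior, and let μ_k be a stationary measure for the random system ((T_t)_t, θ_k). If μ_k converges to a measure μ_0 in the weak* topology, then either μ_0 = δ_0 or there exist c ∈ [0,1) and a T-invariant Borel probability measure ν on S¹, absolutely continuous with respect to m, such that μ_0 = c·δ_0 + (1−c)·ν. -/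
open MeasureTheory Set Filter Topology

noncomputable section

/-- The circle `S¹ = ℝ/ℤ`. -/
abbrev Circle1 : Type := AddCircle (1 : ℝ)

/-- Lift of the intermittent map `T = T_α`: it satisfies `F(x+1) = F(x) + 2`,
`F(x) = x + 2^α x^(1+α)` for `x ∈ [0,1/2)` and `F(x) = 1 + x - 2^α (1-x)^(1+α)`
for `x ∈ [1/2,1)`. -/
noncomputable def Tlift (α : ℝ) (x : ℝ) : ℝ :=
  2 * (⌊x⌋ : ℝ) +
    (if Int.fract x < 1 / 2
      then Int.fract x + 2 ^ α * Int.fract x ^ (1 + α)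
      else 1 + Int.fract x - 2 ^ α * (1 - Int.fract x) ^ (1 + α))

/-- The intermittent map `T = T_α` on the circle. -/
noncomputable def Tmap (α : ℝ) : Circle1 → Circle1 :=
  AddCircle.liftIco 1 0 (fun x => ((Tlift α x : ℝ) : Circle1))

/-- The additively perturbed maps `T_t = T + t (mod 1)`. -/
noncomputable def Tt (α t : ℝ) (x : Circle1) : Circle1 :=
  Tmap α x + (t : Circle1)

/-- The (closed) support of a measure on a topological space. -/
def mSupport {Y : Type*} [TopologicalSpace Y] [MeasurableSpace Y] (θ : Measure Y) : Set Y :=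
  {t | ∀ U ∈ 𝓝 t, θ U ≠ 0}

/-- `μ` is a stationary measure for the random system given by the family `g`
of maps of the circle and the noise distribution `θ`:
`∫∫ φ(g_t(x)) dθ(t) dμ(x) = ∫ φ dμ` for every continuous `φ`. -/
def IsStationaryC (g : ℝ → Circle1 → Circle1) (θ : Measure ℝ) (μ : Measure Circle1) : Prop :=
  ∀ φ : C(Circle1, ℝ), ∫ x, ∫ t, φ (g t x) ∂θ ∂μ = ∫ x, φ x ∂μ

namespace ZeroNoise

/-- The derivative of the lift `Tlift α`. -/
def dLift (α x : ℝ) : ℝ := 1 + (1 + α) * 2 ^ α * ‖(x : Circle1)‖ ^ α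

/-- The lift of the intermittent map as a primitive of its derivative. -/
def lift (α x : ℝ) : ℝ := ∫ t in (0 : ℝ)..x, dLift α t

lemma continuous_dLift {α : ℝ} (hα : 0 ≤ α) : Continuous (dLift α) := by
  have h : Continuous fun x : ℝ => ‖(x : Circle1)‖ :=
    continuous_norm.comp (AddCircle.continuous_mk' 1)
  unfold dLift
  exact continuous_const.add (continuous_const.mul (h.rpow_const fun _ => Or.inr hα))

lemma dLift_periodic (α : ℝ) : Function.Periodic (dLift α) 1 := by
  intro x
  simp [dLift]

lemma one_le_dLift {α : ℝ} (hα : 0 ≤ α) (x : ℝ) : 1 ≤ dLift α x := by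
  have : 0 ≤ (1 + α) * 2 ^ α * ‖(x : Circle1)‖ ^ α := by positivity
  unfold dLift
  linarith

lemma norm_coe_le_abs (x : ℝ) : ‖(x : Circle1)‖ ≤ |x| := by
  rw [UnitAddCircle.norm_eq]
  simpa using round_le x 0

lemma norm_coe_eq_self {x : ℝ} (h0 : 0 ≤ x) (h1 : x ≤ 1 / 2) : ‖(x : Circle1)‖ = x := by
  have := (AddCircle.norm_coe_eq_abs_iff (1 : ℝ) (x := x) one_ne_zero).2
    (by rw [abs_of_nonneg h0]; simpa using h1)
  rw [this, abs_of_nonneg h0]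

lemma norm_coe_eq_one_sub {x : ℝ} (h0 : 1 / 2 ≤ x) (h1 : x ≤ 1) :
    ‖(x : Circle1)‖ = 1 - x := by
  have h : ((1 - x : ℝ) : Circle1) = -(x : Circle1) := by
    rw [AddCircle.coe_sub, AddCircle.coe_period, zero_sub]
  rw [← norm_neg, ← h, norm_coe_eq_self (by linarith) (by linarith)]

lemma abs_rpow_sub_rpow_le {α a b : ℝ} (hα0 : 0 ≤ α) (hα1 : α ≤ 1) (ha : 0 ≤ a) (hb : 0 ≤ b) :
    |a ^ α - b ^ α| ≤ |a - b| ^ α := by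
  wlog hab : b ≤ a generalizing a b
  · rw [abs_sub_comm, abs_sub_comm a b]
    exact this hb ha (le_of_not_ge hab)
  have h1 := Real.rpow_add_le_add_rpow (sub_nonneg.2 hab) hb hα0 hα1
  rw [sub_add_cancel] at h1
  rw [abs_of_nonneg (sub_nonneg.2 (Real.rpow_le_rpow hb hab hα0)), abs_of_nonneg (sub_nonneg.2 hab)]
  linarith

lemma abs_dLift_sub_le {α : ℝ} (hα0 : 0 ≤ α) (hα1 : α ≤ 1) (x y : ℝ) :
    |dLift α x - dLift α y| ≤ (1 + α) * 2 ^ α * |x - y| ^ α := by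
  have h1 : dLift α x - dLift α y
      = (1 + α) * 2 ^ α * (‖(x : Circle1)‖ ^ α - ‖(y : Circle1)‖ ^ α) := by
    unfold dLift; ring
  have hc : 0 ≤ (1 + α) * 2 ^ α := by positivity
  rw [h1, abs_mul, abs_of_nonneg hc]
  refine mul_le_mul_of_nonneg_left ?_ hc
  refine (abs_rpow_sub_rpow_le hα0 hα1 (norm_nonneg _) (norm_nonneg _)).trans ?_
  refine Real.rpow_le_rpow (abs_nonneg _) ?_ hα0
  refine (abs_norm_sub_norm_le _ _).trans ?_
  rw [← AddCircle.coe_sub]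
  exact norm_coe_le_abs _

lemma intervalIntegrable_dLift {α : ℝ} (hα : 0 ≤ α) (a b : ℝ) :
    IntervalIntegrable (dLift α) volume a b :=
  (continuous_dLift hα).intervalIntegrable a b

lemma lift_eq_of_le_half {α : ℝ} (hα : 0 ≤ α) {x : ℝ} (h0 : 0 ≤ x) (h1 : x ≤ 1 / 2) :
    lift α x = x + 2 ^ α * x ^ (1 + α) := by
  have h : ∀ t ∈ uIcc 0 x, dLift α t = 1 + (1 + α) * 2 ^ α * t ^ α := by
    intro t ht
    rw [uIcc_of_le h0] at ht
    rw [dLift, norm_coe_eq_self ht.1 (ht.2.trans h1)]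
  rw [lift, intervalIntegral.integral_congr h, intervalIntegral.integral_add (by simp)
    ((intervalIntegral.intervalIntegrable_rpow' (by linarith)).const_mul _),
    intervalIntegral.integral_const_mul, integral_rpow (Or.inl (by linarith))]
  rw [Real.zero_rpow (by linarith), add_comm α 1]
  have : (1 + α) ≠ 0 := by linarith
  simp only [intervalIntegral.integral_const, smul_eq_mul]
  field_simp
  ring

lemma lift_eq_of_half_le {α : ℝ} (hα : 0 ≤ α) {x : ℝ} (h0 : 1 / 2 ≤ x) (h1 : x ≤ 1) :
    lift α x = 1 + x - 2 ^ α * (1 - x) ^ (1 + α) := by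
  have h : ∀ t ∈ uIcc (1 / 2) x, dLift α t = 1 + (1 + α) * 2 ^ α * (1 - t) ^ α := by
    intro t ht
    rw [uIcc_of_le h0] at ht
    rw [dLift, norm_coe_eq_one_sub ht.1 (ht.2.trans h1)]
  have hc : Continuous fun t : ℝ => (1 - t) ^ α :=
    (continuous_const.sub continuous_id).rpow_const fun _ => Or.inr hα
  have hhalf := lift_eq_of_le_half hα (x := 1 / 2) (by norm_num) le_rfl
  have hpow : (2 : ℝ) ^ α * (1 / 2) ^ (1 + α) = 1 / 2 := by
    rw [Real.rpow_add (by norm_num), Real.rpow_one, mul_left_comm,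
      ← Real.mul_rpow (by norm_num) (by norm_num)]
    norm_num
  have hsplit : lift α x = lift α (1 / 2) + ∫ t in (1 / 2 : ℝ)..x, dLift α t :=
    (intervalIntegral.integral_add_adjacent_intervals (intervalIntegrable_dLift hα _ _)
      (intervalIntegrable_dLift hα _ _)).symm
  rw [hsplit, hhalf, hpow, intervalIntegral.integral_congr h, intervalIntegral.integral_add (by simp)
    ((hc.intervalIntegrable _ _).const_mul _),
    intervalIntegral.integral_const_mul,
    intervalIntegral.integral_comp_sub_left (fun t => t ^ α) 1, integral_rpow (Or.inl (by linarith)),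
    add_comm α 1]
  have h3 : (1 + α) ≠ 0 := by linarith
  simp only [intervalIntegral.integral_const, smul_eq_mul]
  rw [show (1 : ℝ) - 1 / 2 = 1 / 2 by norm_num]
  field_simp
  linear_combination 2 * hpow

lemma lift_one {α : ℝ} (hα : 0 ≤ α) : lift α 1 = 2 := by
  rw [lift_eq_of_half_le hα (by norm_num) le_rfl, sub_self, Real.zero_rpow (by linarith)]
  norm_num

lemma lift_add_int {α : ℝ} (hα : 0 ≤ α) (x : ℝ) (n : ℤ) : lift α (x + n) = lift α x + 2 * n := by
  have h := (dLift_periodic α).intervalIntegral_add_zsmul_eq n x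
    (fun a b => intervalIntegrable_dLift hα a b)
  have h1 : (∫ t in x..x + 1, dLift α t) = 2 := by
    rw [(dLift_periodic α).intervalIntegral_add_eq x 0, zero_add]
    exact lift_one hα
  rw [h1] at h
  have hsplit : lift α (x + n) = lift α x + ∫ t in x..x + n, dLift α t :=
    (intervalIntegral.integral_add_adjacent_intervals (intervalIntegrable_dLift hα _ _)
      (intervalIntegrable_dLift hα _ _)).symm
  simp only [zsmul_eq_mul, mul_one] at h
  rw [hsplit, h]
  ring

lemma Tlift_eq_lift {α : ℝ} (hα : 0 ≤ α) (x : ℝ) : Tlift α x = lift α x := by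
  have h := lift_add_int hα (Int.fract x) ⌊x⌋
  rw [Int.fract_add_floor] at h
  rw [h, Tlift]
  split_ifs with hx
  · rw [lift_eq_of_le_half hα (Int.fract_nonneg x) hx.le]
    ring
  · rw [lift_eq_of_half_le hα (not_lt.1 hx) (Int.fract_lt_one x).le]
    ring

lemma lift_add_one {α : ℝ} (hα : 0 ≤ α) (x : ℝ) : lift α (x + 1) = lift α x + 2 := by
  simpa using lift_add_int hα x 1

lemma hasDerivAt_lift {α : ℝ} (hα : 0 ≤ α) (x : ℝ) : HasDerivAt (lift α) (dLift α x) x :=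
  (continuous_dLift hα).integral_hasStrictDerivAt 0 x |>.hasDerivAt

lemma continuous_lift {α : ℝ} (hα : 0 ≤ α) : Continuous (lift α) :=
  continuous_iff_continuousAt.2 fun x => (hasDerivAt_lift hα x).continuousAt

lemma lift_sub {α : ℝ} (hα : 0 ≤ α) (x z : ℝ) : lift α z - lift α x = ∫ t in x..z, dLift α t :=
  intervalIntegral.integral_interval_sub_left (intervalIntegrable_dLift hα _ _)
    (intervalIntegrable_dLift hα _ _)

lemma mul_sub_le_lift_sub {α m : ℝ} (hα : 0 ≤ α) {x z : ℝ} (hxz : x ≤ z)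
    (hm : ∀ t ∈ Icc x z, m ≤ dLift α t) : m * (z - x) ≤ lift α z - lift α x := by
  rw [lift_sub hα]
  have := intervalIntegral.integral_mono_on hxz (by simp : IntervalIntegrable (fun _ => m) volume x z)
    (intervalIntegrable_dLift hα x z) hm
  simpa [mul_comm] using this

lemma lift_strictMono {α : ℝ} (hα : 0 ≤ α) : StrictMono (lift α) := by
  intro x z hxz
  have := mul_sub_le_lift_sub hα hxz.le (fun t _ => one_le_dLift hα t)
  linarith

lemma lift_surjective {α : ℝ} (hα : 0 ≤ α) : Function.Surjective (lift α) := by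
  have h0 : lift α 0 = 0 := by simp [lift]
  refine (continuous_lift hα).surjective ?_ ?_
  · refine tendsto_atTop_mono' _ ?_ tendsto_id
    filter_upwards [eventually_ge_atTop 0] with x hx
    have := mul_sub_le_lift_sub hα hx (fun t _ => one_le_dLift hα t)
    simp only [id]
    linarith
  · refine tendsto_atBot_mono' _ ?_ tendsto_id
    filter_upwards [eventually_le_atBot 0] with x hx
    have := mul_sub_le_lift_sub hα hx (fun t _ => one_le_dLift hα t)
    simp only [id]
    linarith

/-- The slope of the lift between two points. -/
def slp (α x z : ℝ) : ℝ := (lift α z - lift α x) / (z - x)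

lemma slp_comm (α x z : ℝ) : slp α x z = slp α z x := by
  rw [slp, slp, ← neg_sub, ← neg_sub x z, neg_div_neg_eq]

lemma le_slp {α m : ℝ} (hα : 0 ≤ α) {x z : ℝ} (hxz : x ≠ z)
    (hm : ∀ t ∈ uIcc x z, m ≤ dLift α t) : m ≤ slp α x z := by
  wlog h : x < z generalizing x z
  · rw [slp_comm]
    exact this hxz.symm (by rwa [uIcc_comm]) (lt_of_le_of_ne (not_lt.1 h) hxz.symm)
  rw [slp, le_div_iff₀ (sub_pos.2 h)]
  rw [uIcc_of_le h.le] at hm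
  exact mul_sub_le_lift_sub hα h.le hm

lemma one_le_slp {α : ℝ} (hα : 0 ≤ α) {x z : ℝ} (hxz : x ≠ z) : 1 ≤ slp α x z :=
  le_slp hα hxz fun t _ => one_le_dLift hα t

lemma abs_dLift_sub_slp_le {α : ℝ} (hα0 : 0 ≤ α) (hα1 : α ≤ 1) {x z : ℝ} (hxz : x ≠ z) :
    |dLift α x - slp α x z| ≤ (1 + α) * 2 ^ α * |z - x| ^ α := by
  have hne : z - x ≠ 0 := sub_ne_zero.2 hxz.symm
  have hpos : 0 < |z - x| := abs_pos.2 hne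
  have h1 : dLift α x - slp α x z = (∫ t in x..z, (dLift α x - dLift α t)) / (z - x) := by
    rw [intervalIntegral.integral_sub (by simp) (intervalIntegrable_dLift hα0 x z), ← lift_sub hα0,
      slp]
    simp only [intervalIntegral.integral_const, smul_eq_mul]
    field_simp
  rw [h1, abs_div, div_le_iff₀ hpos, ← Real.norm_eq_abs (∫ t in x..z, _)]
  refine intervalIntegral.norm_integral_le_of_norm_le_const fun t ht => ?_
  refine (abs_dLift_sub_le hα0 hα1 x t).trans ?_
  refine mul_le_mul_of_nonneg_left (Real.rpow_le_rpow (abs_nonneg _) ?_ hα0) (by positivity)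
  rw [abs_sub_comm, abs_sub_comm z]
  have := abs_sub_left_of_mem_uIcc (uIoc_subset_uIcc ht)
  rw [abs_sub_comm x z]
  exact this

/-- The inverse of the lift. -/
def invLift {α : ℝ} (hα : 0 ≤ α) : ℝ ≃o ℝ :=
  (StrictMono.orderIsoOfSurjective (lift α) (lift_strictMono hα) (lift_surjective hα)).symm

lemma invLift_lift {α : ℝ} (hα : 0 ≤ α) (x : ℝ) : invLift hα (lift α x) = x :=
  (StrictMono.orderIsoOfSurjective (lift α) (lift_strictMono hα)
    (lift_surjective hα)).symm_apply_apply x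

lemma lift_invLift {α : ℝ} (hα : 0 ≤ α) (x : ℝ) : lift α (invLift hα x) = x :=
  (StrictMono.orderIsoOfSurjective (lift α) (lift_strictMono hα)
    (lift_surjective hα)).apply_symm_apply x

lemma continuous_invLift {α : ℝ} (hα : 0 ≤ α) : Continuous (invLift hα) :=
  (invLift hα).continuous

lemma invLift_add_two {α : ℝ} (hα : 0 ≤ α) (y : ℝ) : invLift hα (y + 2) = invLift hα y + 1 := by
  apply (lift_strictMono hα).injective
  rw [lift_invLift, lift_add_one hα, lift_invLift]

lemma Tmap_coe {α : ℝ} (hα : 0 ≤ α) (x : ℝ) : Tmap α (x : Circle1) = (lift α x : Circle1) := by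
  have hx : Int.fract x ∈ Ico (0 : ℝ) (0 + 1) := by
    rw [zero_add]
    exact ⟨Int.fract_nonneg x, Int.fract_lt_one x⟩
  have h1 : (x : Circle1) = (Int.fract x : ℝ) := by
    conv_lhs => rw [← Int.fract_add_floor x]
    rw [AddCircle.coe_add]
    simp
  have h2 := lift_add_int hα (Int.fract x) ⌊x⌋
  rw [Int.fract_add_floor] at h2
  rw [h1, Tmap, AddCircle.liftIco_coe_apply hx, Tlift_eq_lift hα, h2, AddCircle.coe_add]
  have : ((2 * (⌊x⌋ : ℝ) : ℝ) : Circle1) = 0 := by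
    rw [AddCircle.coe_eq_zero_iff]
    exact ⟨2 * ⌊x⌋, by simp⟩
  rw [this, add_zero]

lemma continuous_Tmap {α : ℝ} (hα : 0 ≤ α) : Continuous (Tmap α) := by
  refine (QuotientAddGroup.isQuotientMap_mk (N := AddSubgroup.zmultiples (1 : ℝ))).continuous_iff.2 ?_
  have : Tmap α ∘ ((↑) : ℝ → Circle1) = fun x => (lift α x : Circle1) :=
    funext fun x => Tmap_coe hα x
  exact this ▸ (AddCircle.continuous_mk' 1).comp (continuous_lift hα)

lemma Tmap_zero {α : ℝ} (hα : 0 ≤ α) : Tmap α 0 = 0 := by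
  have := Tmap_coe hα 0
  simpa [lift] using this

/-- The truncated fractional kernel `|τ|^(-1-s)` on `|τ| < 1`. -/
def kern (s τ : ℝ) : ℝ := if |τ| < 1 then |τ| ^ (-1 - s) else 0

lemma kern_nonneg (s τ : ℝ) : 0 ≤ kern s τ := by
  unfold kern
  split_ifs <;> positivity

lemma measurable_kern (s : ℝ) : Measurable (kern s) := by
  unfold kern
  refine Measurable.ite (measurableSet_lt measurable_id.abs measurable_const) ?_ measurable_const
  exact measurable_id.abs.pow_const _

/-- The local oscillation of `w` at `y`, measured by the fractional kernel. -/
def osc (s : ℝ) (w : ℝ → ℝ) (y : ℝ) : ENNReal :=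
  ∫⁻ z, ‖w z - w y‖ₑ * ENNReal.ofReal (kern s (z - y))

/-- The fractional Sobolev energy of a `1`-periodic function. -/
def energy (s : ℝ) (w : ℝ → ℝ) : ENNReal := ∫⁻ y in Ioc (0 : ℝ) 1, osc s w y

lemma measurable_osc_integrand (s : ℝ) {w : ℝ → ℝ} (hw : Continuous w) :
    Measurable fun p : ℝ × ℝ => ‖w p.2 - w p.1‖ₑ * ENNReal.ofReal (kern s (p.2 - p.1)) := by
  have h1 : Measurable fun p : ℝ × ℝ => w p.2 - w p.1 :=
    ((hw.comp continuous_snd).sub (hw.comp continuous_fst)).measurable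
  exact h1.enorm.mul
    ((measurable_kern s).comp (measurable_snd.sub measurable_fst)).ennreal_ofReal

lemma measurable_osc (s : ℝ) {w : ℝ → ℝ} (hw : Continuous w) : Measurable (osc s w) :=
  (measurable_osc_integrand s hw).lintegral_prod_right'

lemma osc_periodic (s : ℝ) {w : ℝ → ℝ} (hw : Function.Periodic w 1) :
    Function.Periodic (osc s w) 1 := by
  intro y
  unfold osc
  rw [← lintegral_add_right_eq_self _ (1 : ℝ)]
  simp only [hw y, hw _, add_sub_add_right_eq_sub]

lemma osc_comp_sub (s : ℝ) (w : ℝ → ℝ) (y t : ℝ) :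
    osc s (fun x => w (x - t)) y = osc s w (y - t) := by
  unfold osc
  conv_rhs => rw [← lintegral_sub_right_eq_self _ t]
  simp only [sub_sub_sub_cancel_right]

lemma lintegral_periodic {J : ℝ → ENNReal} (hJ : Function.Periodic J 1) (a b : ℝ) :
    ∫⁻ x in Ioc a (a + 1), J x = ∫⁻ x in Ioc b (b + 1), J x := by
  have : VAddInvariantMeasure (AddSubgroup.zmultiples (1 : ℝ)) ℝ volume :=
    ⟨fun c s _ => measure_preimage_add _ _ _⟩
  exact IsAddFundamentalDomain.setLIntegral_eq (G := AddSubgroup.zmultiples (1 : ℝ))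
    (isAddFundamentalDomain_Ioc one_pos a volume) (isAddFundamentalDomain_Ioc one_pos b volume) J
    hJ.map_vadd_zmultiples

lemma setLIntegral_comp_add (J : ℝ → ENNReal) (a b c : ℝ) :
    ∫⁻ x in Ioc a b, J (x + c) = ∫⁻ x in Ioc (a + c) (b + c), J x := by
  have h := (measurePreserving_add_right (volume : Measure ℝ) c).setLIntegral_comp_preimage_emb
    (measurableEmbedding_addRight c) J (Ioc (a + c) (b + c))
  simpa using h

lemma lintegral_periodic_comp_add {J : ℝ → ENNReal} (hJ : Function.Periodic J 1) (c : ℝ) :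
    ∫⁻ x in Ioc (0 : ℝ) 1, J (x + c) = ∫⁻ x in Ioc (0 : ℝ) 1, J x := by
  rw [setLIntegral_comp_add, add_comm 1 c, zero_add, lintegral_periodic hJ c 0, zero_add]

lemma exists_bound_of_periodic {w : ℝ → ℝ} (hc : Continuous w) (hp : Function.Periodic w 1) :
    ∃ C : ℝ, ∀ x, ‖w x‖ ≤ C := by
  obtain ⟨C, hC⟩ := isCompact_Icc.exists_bound_of_continuousOn (s := Icc (0 : ℝ) 1) hc.continuousOn
  refine ⟨C, fun x => ?_⟩
  obtain ⟨y, hy, hxy⟩ := hp.exists_mem_Ico₀ one_pos x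
  rw [hxy]
  exact hC y ⟨hy.1, hy.2.le⟩

/-- Averaging over translations distributed according to `θ`. -/
def noisy (θ : Measure ℝ) (w : ℝ → ℝ) (y : ℝ) : ℝ := ∫ t, w (y - t) ∂θ

lemma continuous_noisy (θ : Measure ℝ) [IsProbabilityMeasure θ] {w : ℝ → ℝ} (hc : Continuous w)
    (hp : Function.Periodic w 1) : Continuous (noisy θ w) := by
  obtain ⟨C, hC⟩ := exists_bound_of_periodic hc hp
  refine continuous_of_dominated (bound := fun _ => C) ?_ ?_ (integrable_const C) ?_
  · exact fun x => (hc.comp (continuous_const.sub continuous_id)).aestronglyMeasurable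
  · exact fun x => Eventually.of_forall fun t => hC _
  · exact Eventually.of_forall fun t => hc.comp (continuous_id.sub continuous_const)

lemma noisy_periodic (θ : Measure ℝ) {w : ℝ → ℝ} (hp : Function.Periodic w 1) :
    Function.Periodic (noisy θ w) 1 := by
  intro y
  unfold noisy
  refine integral_congr_ae (Eventually.of_forall fun t => ?_)
  change w (y + 1 - t) = w (y - t)
  rw [add_sub_right_comm, hp]

lemma integrable_comp_sub (θ : Measure ℝ) [IsProbabilityMeasure θ] {w : ℝ → ℝ} (hc : Continuous w)
    (hp : Function.Periodic w 1) (y : ℝ) : Integrable (fun t => w (y - t)) θ := by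
  obtain ⟨C, hC⟩ := exists_bound_of_periodic hc hp
  exact Integrable.of_bound (hc.comp (continuous_const.sub continuous_id)).aestronglyMeasurable C
    (Eventually.of_forall fun t => hC _)

lemma energy_noisy_le (s : ℝ) (θ : Measure ℝ) [IsProbabilityMeasure θ] {w : ℝ → ℝ}
    (hc : Continuous w) (hp : Function.Periodic w 1) : energy s (noisy θ w) ≤ energy s w := by
  have hosc : ∀ y, osc s (noisy θ w) y ≤ ∫⁻ t, osc s w (y - t) ∂θ := by
    intro y
    have h1 : ∀ z, ‖noisy θ w z - noisy θ w y‖ₑ * ENNReal.ofReal (kern s (z - y))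
        ≤ ∫⁻ t, ‖w (z - t) - w (y - t)‖ₑ * ENNReal.ofReal (kern s (z - y)) ∂θ := by
      intro z
      rw [lintegral_mul_const' _ _ ENNReal.ofReal_ne_top]
      gcongr
      unfold noisy
      rw [← integral_sub (integrable_comp_sub θ hc hp z) (integrable_comp_sub θ hc hp y)]
      exact enorm_integral_le_lintegral_enorm _
    have hm : Measurable fun p : ℝ × ℝ =>
        ‖w (p.1 - p.2) - w (y - p.2)‖ₑ * ENNReal.ofReal (kern s (p.1 - y)) := by
      have h2 : Measurable fun p : ℝ × ℝ => w (p.1 - p.2) - w (y - p.2) :=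
        Continuous.measurable (by fun_prop)
      exact h2.enorm.mul
        ((measurable_kern s).comp (measurable_fst.sub measurable_const)).ennreal_ofReal
    calc osc s (noisy θ w) y
        ≤ ∫⁻ z, ∫⁻ t, ‖w (z - t) - w (y - t)‖ₑ * ENNReal.ofReal (kern s (z - y)) ∂θ :=
          lintegral_mono h1
      _ = ∫⁻ t, (∫⁻ z, ‖w (z - t) - w (y - t)‖ₑ * ENNReal.ofReal (kern s (z - y))) ∂θ :=
          lintegral_lintegral_swap hm.aemeasurable
      _ = ∫⁻ t, osc s w (y - t) ∂θ :=
          lintegral_congr (μ := θ) fun t => osc_comp_sub s w y t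
  have hmo := measurable_osc s hc
  calc energy s (noisy θ w) ≤ ∫⁻ y in Ioc (0 : ℝ) 1, ∫⁻ t, osc s w (y - t) ∂θ :=
        lintegral_mono hosc
    _ = ∫⁻ t, (∫⁻ y in Ioc (0 : ℝ) 1, osc s w (y - t)) ∂θ :=
        lintegral_lintegral_swap (f := fun y t => osc s w (y - t))
          (hmo.comp (measurable_fst.sub measurable_snd)).aemeasurable
    _ = ∫⁻ _, energy s w ∂θ := by
        refine lintegral_congr (μ := θ) fun t => ?_
        simp only [sub_eq_add_neg]
        rw [lintegral_periodic_comp_add (osc_periodic s hp) (-t)]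
        rfl
    _ = energy s w := by simp

/-- The transfer operator of the lift, before summing over the two branches. -/
def branch {α : ℝ} (hα : 0 ≤ α) (u : ℝ → ℝ) (y : ℝ) : ℝ :=
  u (invLift hα y) / dLift α (invLift hα y)

/-- The transfer operator of the intermittent map acting on `1`-periodic densities. -/
def transfer {α : ℝ} (hα : 0 ≤ α) (u : ℝ → ℝ) (y : ℝ) : ℝ := branch hα u y + branch hα u (y + 1)

/-- Continuous nonnegative `1`-periodic functions. -/
structure PerDens (u : ℝ → ℝ) : Prop where
  cont : Continuous u
  per : Function.Periodic u 1
  nonneg : ∀ x, 0 ≤ u x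

lemma continuous_branch {α : ℝ} (hα : 0 ≤ α) {u : ℝ → ℝ} (hu : Continuous u) :
    Continuous (branch hα u) :=
  (hu.comp (continuous_invLift hα)).div ((continuous_dLift hα).comp (continuous_invLift hα))
    fun y => (zero_lt_one.trans_le (one_le_dLift hα _)).ne'

lemma branch_periodic {α : ℝ} (hα : 0 ≤ α) {u : ℝ → ℝ} (hu : Function.Periodic u 1) :
    Function.Periodic (branch hα u) 2 := by
  intro _
  unfold branch
  rw [invLift_add_two, hu, dLift_periodic]

lemma branch_nonneg {α : ℝ} (hα : 0 ≤ α) {u : ℝ → ℝ} (hu : ∀ x, 0 ≤ u x) (y : ℝ) :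
    0 ≤ branch hα u y :=
  div_nonneg (hu _) (zero_le_one.trans (one_le_dLift hα _))

lemma PerDens.transfer {α : ℝ} (hα : 0 ≤ α) {u : ℝ → ℝ} (hu : PerDens u) :
    PerDens (transfer hα u) where
  cont := (continuous_branch hα hu.cont).add
    ((continuous_branch hα hu.cont).comp (continuous_id.add continuous_const))
  per _ := by
    unfold ZeroNoise.transfer
    rw [add_assoc _ 1 1, one_add_one_eq_two, branch_periodic hα hu.per, add_comm]
  nonneg y := add_nonneg (branch_nonneg hα hu.nonneg _) (branch_nonneg hα hu.nonneg _)

lemma PerDens.noisy {u : ℝ → ℝ} (hu : PerDens u) (θ : Measure ℝ) [IsProbabilityMeasure θ] :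
    PerDens (noisy θ u) where
  cont := continuous_noisy θ hu.cont hu.per
  per := noisy_periodic θ hu.per
  nonneg _ := integral_nonneg fun _ => hu.nonneg _

/-- The transfer operator of the random system. -/
def randTransfer {α : ℝ} (hα : 0 ≤ α) (θ : Measure ℝ) (u : ℝ → ℝ) : ℝ → ℝ :=
  noisy θ (transfer hα u)

lemma PerDens.randTransfer {α : ℝ} (hα : 0 ≤ α) (θ : Measure ℝ) [IsProbabilityMeasure θ]
    {u : ℝ → ℝ} (hu : PerDens u) : PerDens (randTransfer hα θ u) :=
  (hu.transfer hα).noisy θ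

lemma integral_comp_lift_mul {α : ℝ} (hα : 0 ≤ α) {ψ u : ℝ → ℝ} (hψ : Continuous ψ)
    (hψp : Function.Periodic ψ 1) (hu : Continuous u) :
    ∫ x in (0 : ℝ)..1, ψ (lift α x) * u x = ∫ y in (0 : ℝ)..1, ψ y * transfer hα u y := by
  have hb := continuous_branch hα hu
  have hψb : Continuous fun y => ψ y * branch hα u y := hψ.mul hb
  have h1 : ∫ x in (0 : ℝ)..1, ψ (lift α x) * u x = ∫ y in (0 : ℝ)..2, ψ y * branch hα u y := by
    have h := intervalIntegral.integral_comp_mul_deriv (a := 0) (b := 1)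
      (fun x _ => hasDerivAt_lift hα x) (continuous_dLift hα).continuousOn hψb
    rw [lift_one hα, show lift α 0 = 0 by simp [lift]] at h
    rw [← h]
    refine intervalIntegral.integral_congr fun x _ => ?_
    have hD : dLift α x ≠ 0 := (zero_lt_one.trans_le (one_le_dLift hα x)).ne'
    simp only [Function.comp, branch, invLift_lift]
    field_simp
  have h2 : ∫ y in (0 : ℝ)..1, ψ y * branch hα u (y + 1) = ∫ y in (1 : ℝ)..2, ψ y * branch hα u y := by
    have h := intervalIntegral.integral_comp_add_right (a := 0) (b := 1)
      (fun y => ψ y * branch hα u y) 1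
    rw [zero_add, one_add_one_eq_two] at h
    rw [← h]
    refine intervalIntegral.integral_congr fun x _ => ?_
    simp only [hψp x]
  rw [h1, ← intervalIntegral.integral_add_adjacent_intervals (hψb.intervalIntegrable 0 1)
    (hψb.intervalIntegrable 1 2), ← h2, ← intervalIntegral.integral_add
    (hψb.intervalIntegrable 0 1)
    (Continuous.intervalIntegrable (by fun_prop) 0 1)]
  refine intervalIntegral.integral_congr fun x _ => ?_
  simp only [transfer]
  ring

lemma integral_noise_mul (θ : Measure ℝ) [IsProbabilityMeasure θ] {ψ w : ℝ → ℝ}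
    (hψ : Continuous ψ) (hψp : Function.Periodic ψ 1) (hw : Continuous w)
    (hwp : Function.Periodic w 1) :
    ∫ y in (0 : ℝ)..1, (∫ t, ψ (y + t) ∂θ) * w y = ∫ y in (0 : ℝ)..1, ψ y * noisy θ w y := by
  obtain ⟨A, hA⟩ := exists_bound_of_periodic hψ hψp
  obtain ⟨B, hB⟩ := exists_bound_of_periodic hw hwp
  have hInt : ∀ f : ℝ × ℝ → ℝ, Continuous f → (∀ p, ‖f p‖ ≤ A * B) →
      Integrable f ((volume.restrict (Ioc (0 : ℝ) 1)).prod θ) := fun f hf hb =>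
    Integrable.of_bound hf.aestronglyMeasurable (A * B) (Eventually.of_forall hb)
  have hbd : ∀ a b, ‖ψ a * w b‖ ≤ A * B := fun a b => by
    rw [norm_mul]
    exact mul_le_mul (hA _) (hB _) (norm_nonneg _) ((norm_nonneg _).trans (hA a))
  rw [intervalIntegral.integral_of_le zero_le_one, intervalIntegral.integral_of_le zero_le_one]
  simp only [noisy, ← integral_mul_const, ← integral_const_mul]
  rw [integral_integral_swap (f := fun y t => ψ (y + t) * w y)
      (hInt _ (by simp only [Function.uncurry_def]; fun_prop) fun p => hbd _ _),
    integral_integral_swap (f := fun y t => ψ y * w (y - t))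
      (hInt _ (by simp only [Function.uncurry_def]; fun_prop) fun p => hbd _ _)]
  refine integral_congr_ae (Eventually.of_forall fun t => ?_)
  simp only [← intervalIntegral.integral_of_le (zero_le_one' ℝ)]
  have h := intervalIntegral.integral_comp_add_right (a := 0) (b := 1)
      (fun y => ψ y * w (y - t)) t
  simp only [add_sub_cancel_right] at h
  have hper : Function.Periodic (fun y => ψ y * w (y - t)) 1 := fun y => by
    simp only [hψp y]
    rw [add_sub_right_comm, hwp]
  rw [h, add_comm 1 t, zero_add, hper.intervalIntegral_add_eq t 0, zero_add]

lemma integral_randTransfer {α : ℝ} (hα : 0 ≤ α) (θ : Measure ℝ) [IsProbabilityMeasure θ]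
    (φ : C(Circle1, ℝ)) {u : ℝ → ℝ} (hu : PerDens u) :
    ∫ x in (0 : ℝ)..1, (∫ t, φ (Tt α t (x : Circle1)) ∂θ) * u x
      = ∫ y in (0 : ℝ)..1, φ (y : Circle1) * randTransfer hα θ u y := by
  have hφ : Continuous fun x : ℝ => φ (x : Circle1) := φ.continuous.comp (AddCircle.continuous_mk' 1)
  have hφp : Function.Periodic (fun x : ℝ => φ (x : Circle1)) 1 := fun x => by simp
  have hn : Continuous fun y : ℝ => ∫ t, φ ((y + t : ℝ) : Circle1) ∂θ := by
    refine continuous_of_dominated (bound := fun _ => ‖φ‖) ?_ ?_ (integrable_const _) ?_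
    · exact fun x => (hφ.comp (continuous_const.add continuous_id)).aestronglyMeasurable
    · exact fun x => Eventually.of_forall fun t => φ.norm_coe_le_norm _
    · exact Eventually.of_forall fun t => hφ.comp (continuous_id.add continuous_const)
  have hnp : Function.Periodic (fun y : ℝ => ∫ t, φ ((y + t : ℝ) : Circle1) ∂θ) 1 := fun y => by
    simp
  have hT := hu.transfer hα
  rw [randTransfer, ← integral_noise_mul θ hφ hφp hT.cont hT.per,
    ← integral_comp_lift_mul hα hn hnp hu.cont]
  simp only [Tt, Tmap_coe hα, AddCircle.coe_add]

/-- The Hölder error kernel of the transfer operator. -/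
def errKern (α s τ : ℝ) : ℝ := (1 + α) * 2 ^ α * |τ| ^ α * kern s τ

lemma errKern_nonneg {α : ℝ} (hα : 0 ≤ α) (s τ : ℝ) : 0 ≤ errKern α s τ := by
  have := kern_nonneg s τ
  unfold errKern
  positivity

lemma measurable_errKern (α s : ℝ) : Measurable (errKern α s) :=
  ((measurable_id.abs.pow_const α).const_mul _).mul (measurable_kern s)

lemma lift_sub_eq_slp_mul (α : ℝ) {x z : ℝ} (hxz : x ≠ z) :
    lift α z - lift α x = slp α x z * (z - x) := by
  rw [slp, div_mul_cancel₀ _ (sub_ne_zero.2 hxz.symm)]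

lemma kern_lift_le {α : ℝ} (hα : 0 ≤ α) (s : ℝ) {x z : ℝ} (hxz : x ≠ z) :
    kern s (lift α z - lift α x) ≤ slp α x z ^ (-1 - s) * kern s (z - x) := by
  have hS := one_le_slp hα hxz
  have hS0 : 0 ≤ slp α x z := zero_le_one.trans hS
  have habs : |lift α z - lift α x| = slp α x z * |z - x| := by
    rw [lift_sub_eq_slp_mul α hxz, abs_mul, abs_of_nonneg hS0]
  by_cases h : |lift α z - lift α x| < 1
  · have h' : |z - x| < 1 := by
      refine lt_of_le_of_lt ?_ h
      rw [habs]
      exact le_mul_of_one_le_left (abs_nonneg _) hS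
    rw [kern, kern, if_pos h, if_pos h', habs, Real.mul_rpow hS0 (abs_nonneg _)]
  · rw [kern, if_neg h]
    exact mul_nonneg (Real.rpow_nonneg hS0 _) (kern_nonneg _ _)

lemma transfer_pointwise {α s : ℝ} (hα0 : 0 ≤ α) (hα1 : α ≤ 1) (hs : 0 ≤ s) (u : ℝ → ℝ) (x z : ℝ) :
    dLift α x * (dLift α z * (|u z / dLift α z - u x / dLift α x| * kern s (lift α z - lift α x)))
      + (1 - slp α x z ^ (-s)) * (|u z - u x| * kern s (z - x))
    ≤ |u z - u x| * kern s (z - x) + errKern α s (z - x) * (|u z| + |u x|) := by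
  rcases eq_or_ne x z with rfl | hxz
  · have := errKern_nonneg hα0 s (x - x)
    simp only [sub_self, abs_zero, zero_mul, mul_zero, zero_add]
    simp only [sub_self] at this
    positivity
  have hS := one_le_slp hα0 hxz
  have hS0 : 0 < slp α x z := zero_lt_one.trans_le hS
  have hDx := zero_lt_one.trans_le (one_le_dLift hα0 x)
  have hDz := zero_lt_one.trans_le (one_le_dLift hα0 z)
  have hex := abs_dLift_sub_slp_le hα0 hα1 hxz
  have hez := abs_dLift_sub_slp_le hα0 hα1 hxz.symm
  rw [slp_comm, abs_sub_comm x z] at hez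
  have hk := kern_lift_le hα0 s hxz
  have hk0 := kern_nonneg s (z - x)
  have hk0' := kern_nonneg s (lift α z - lift α x)
  rw [errKern]
  set e := (1 + α) * 2 ^ α * |z - x| ^ α
  set S := slp α x z
  set k := kern s (z - x)
  have he0 : 0 ≤ e := (abs_nonneg _).trans hex
  have h1 : dLift α x * dLift α z * |u z / dLift α z - u x / dLift α x|
      = |dLift α x * u z - dLift α z * u x| := by
    have hp := abs_of_pos (mul_pos hDx hDz)
    nth_rewrite 1 [← hp]
    rw [← abs_mul]
    congr 1
    field_simp
  have h2 : |dLift α x * u z - dLift α z * u x| ≤ S * |u z - u x| + e * (|u z| + |u x|) := by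
    have : dLift α x * u z - dLift α z * u x
        = S * (u z - u x) + ((dLift α x - S) * u z - (dLift α z - S) * u x) := by ring
    rw [this]
    refine (abs_add_le _ _).trans ?_
    rw [abs_mul, abs_of_pos hS0]
    refine add_le_add le_rfl ((abs_sub _ _).trans ?_)
    rw [abs_mul, abs_mul, mul_add]
    gcongr
  have hSs : S * S ^ (-1 - s) = S ^ (-s) := by
    nth_rewrite 1 [← Real.rpow_one S]
    rw [← Real.rpow_add hS0]
    congr 1
    ring
  have hS1 : S ^ (-1 - s) ≤ 1 := Real.rpow_le_one_of_one_le_of_nonpos hS (by linarith)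
  have hSp : 0 ≤ S ^ (-1 - s) := Real.rpow_nonneg hS0.le _
  calc dLift α x * (dLift α z * (|u z / dLift α z - u x / dLift α x|
        * kern s (lift α z - lift α x))) + (1 - S ^ (-s)) * (|u z - u x| * k)
      = |dLift α x * u z - dLift α z * u x| * kern s (lift α z - lift α x)
        + (1 - S ^ (-s)) * (|u z - u x| * k) := by rw [← h1]; ring
    _ ≤ (S * |u z - u x| + e * (|u z| + |u x|)) * (S ^ (-1 - s) * k)
        + (1 - S ^ (-s)) * (|u z - u x| * k) := by
          gcongr
    _ = |u z - u x| * k + S ^ (-1 - s) * (e * k * (|u z| + |u x|)) := by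
          rw [← hSs]; ring
    _ ≤ |u z - u x| * k + 1 * (e * k * (|u z| + |u x|)) := by
          gcongr
    _ = _ := by ring

/-- The amount of energy lost under the transfer operator. -/
def defect (α s : ℝ) (u : ℝ → ℝ) : ENNReal :=
  ∫⁻ x in Ioc (0 : ℝ) 1, ∫⁻ z, ENNReal.ofReal (1 - slp α x z ^ (-s)) *
    (‖u z - u x‖ₑ * ENNReal.ofReal (kern s (z - x)))

lemma one_sub_slp_nonneg {α s : ℝ} (hα : 0 ≤ α) (hs : 0 < s) (x z : ℝ) :
    0 ≤ 1 - slp α x z ^ (-s) := by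
  rcases eq_or_ne x z with rfl | hxz
  · simp [slp, Real.zero_rpow (neg_ne_zero.2 hs.ne')]
  · exact sub_nonneg.2 (Real.rpow_le_one_of_one_le_of_nonpos (one_le_slp hα hxz) (by linarith))

lemma transfer_pointwise_ennreal {α s : ℝ} (hα0 : 0 ≤ α) (hα1 : α ≤ 1) (hs : 0 < s)
    (u : ℝ → ℝ) (x z : ℝ) :
    ENNReal.ofReal |dLift α x| * (ENNReal.ofReal |dLift α z| *
        (‖branch hα0 u (lift α z) - branch hα0 u (lift α x)‖ₑ
          * ENNReal.ofReal (kern s (lift α z - lift α x))))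
      + ENNReal.ofReal (1 - slp α x z ^ (-s)) * (‖u z - u x‖ₑ * ENNReal.ofReal (kern s (z - x)))
    ≤ ‖u z - u x‖ₑ * ENNReal.ofReal (kern s (z - x))
      + ENNReal.ofReal (errKern α s (z - x)) * (‖u z‖ₑ + ‖u x‖ₑ) := by
  have hDx := zero_le_one.trans (one_le_dLift hα0 x)
  have hDz := zero_le_one.trans (one_le_dLift hα0 z)
  have hl := one_sub_slp_nonneg hα0 hs x z
  have hk := kern_nonneg s (z - x)
  have hk' := kern_nonneg s (lift α z - lift α x)
  have he := errKern_nonneg hα0 s (z - x)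
  have h := ENNReal.ofReal_le_ofReal (transfer_pointwise hα0 hα1 hs.le u x z)
  simp only [branch, invLift_lift, Real.enorm_eq_ofReal_abs]
  rw [abs_of_nonneg hDx, abs_of_nonneg hDz]
  rwa [ENNReal.ofReal_add (by positivity) (by positivity), ENNReal.ofReal_mul hDx,
    ENNReal.ofReal_mul hDz, ENNReal.ofReal_mul (abs_nonneg _), ENNReal.ofReal_mul hl,
    ENNReal.ofReal_mul (abs_nonneg _), ENNReal.ofReal_add (by positivity) (by positivity),
    ENNReal.ofReal_mul (abs_nonneg _), ENNReal.ofReal_mul he,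
    ENNReal.ofReal_add (abs_nonneg _) (abs_nonneg _)] at h

lemma lift_image_Ioc {α : ℝ} (hα : 0 ≤ α) : lift α '' Ioc 0 1 = Ioc 0 2 := by
  have hm := lift_strictMono hα
  have h0 : lift α 0 = 0 := by simp [lift]
  ext y
  constructor
  · rintro ⟨x, hx, rfl⟩
    refine ⟨h0.symm.trans_lt (hm hx.1), ?_⟩
    rw [← lift_one hα]
    exact hm.monotone hx.2
  · intro hy
    obtain ⟨x, rfl⟩ := lift_surjective hα y
    refine ⟨x, ⟨hm.lt_iff_lt.1 (h0.trans_lt hy.1), hm.le_iff_le.1 ?_⟩, rfl⟩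
    rw [lift_one hα]
    exact hy.2

lemma osc_comp_lift {α : ℝ} (hα : 0 ≤ α) (s : ℝ) (w : ℝ → ℝ) (x : ℝ) :
    osc s w (lift α x) = ∫⁻ z, ENNReal.ofReal |dLift α z| *
      (‖w (lift α z) - w (lift α x)‖ₑ * ENNReal.ofReal (kern s (lift α z - lift α x))) := by
  have h := lintegral_image_eq_lintegral_abs_deriv_mul (s := univ) MeasurableSet.univ
    (fun x _ => (hasDerivAt_lift hα x).hasDerivWithinAt) (lift_strictMono hα).injective.injOn
    (fun z => ‖w z - w (lift α x)‖ₑ * ENNReal.ofReal (kern s (z - lift α x)))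
  rw [image_univ, (lift_surjective hα).range_eq] at h
  simpa [osc] using h

lemma measurable_osc_integrand_right (s : ℝ) {w : ℝ → ℝ} (hw : Continuous w) (y : ℝ) :
    Measurable fun z => ‖w z - w y‖ₑ * ENNReal.ofReal (kern s (z - y)) :=
  (hw.sub continuous_const).measurable.enorm.mul
    ((measurable_kern s).comp (measurable_id.sub_const y)).ennreal_ofReal

lemma osc_transfer_le {α : ℝ} (hα : 0 ≤ α) (s : ℝ) {u : ℝ → ℝ} (hu : Continuous u) (y : ℝ) :
    osc s (transfer hα u) y ≤ osc s (branch hα u) y + osc s (branch hα u) (y + 1) := by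
  have h := osc_comp_sub s (branch hα u) y (-1)
  rw [sub_neg_eq_add] at h
  rw [← h]
  have hm : Measurable fun z => ‖branch hα u z - branch hα u y‖ₑ * ENNReal.ofReal (kern s (z - y)) :=
    measurable_osc_integrand_right s (continuous_branch hα hu) y
  unfold osc
  rw [← lintegral_add_left hm]
  refine lintegral_mono fun z => ?_
  simp only [sub_neg_eq_add]
  rw [← add_mul]
  gcongr
  refine le_trans (le_of_eq ?_) (enorm_add_le _ _)
  congr 1
  simp only [transfer]
  ring

lemma energy_transfer_le_lintegral {α : ℝ} (hα : 0 ≤ α) (s : ℝ) {u : ℝ → ℝ} (hu : Continuous u) :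
    energy s (transfer hα u) ≤ ∫⁻ x in Ioc (0 : ℝ) 1, ∫⁻ z,
      ENNReal.ofReal |dLift α x| * (ENNReal.ofReal |dLift α z| *
        (‖branch hα u (lift α z) - branch hα u (lift α x)‖ₑ
          * ENNReal.ofReal (kern s (lift α z - lift α x)))) := by
  have hm := measurable_osc s (continuous_branch hα hu)
  calc energy s (transfer hα u)
      ≤ ∫⁻ y in Ioc (0 : ℝ) 1, (osc s (branch hα u) y + osc s (branch hα u) (y + 1)) :=
        lintegral_mono fun y => osc_transfer_le hα s hu y
    _ = ∫⁻ y in lift α '' Ioc 0 1, osc s (branch hα u) y := by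
        rw [lintegral_add_left hm, setLIntegral_comp_add, zero_add, one_add_one_eq_two,
          lift_image_Ioc hα, ← Ioc_union_Ioc_eq_Ioc (zero_le_one' ℝ) one_le_two,
          lintegral_union measurableSet_Ioc (Ioc_disjoint_Ioc_of_le le_rfl)]
    _ = _ := by
        rw [lintegral_image_eq_lintegral_abs_deriv_mul measurableSet_Ioc
          (fun x _ => (hasDerivAt_lift hα x).hasDerivWithinAt)
          (lift_strictMono hα).injective.injOn]
        refine lintegral_congr fun x => ?_
        rw [osc_comp_lift hα, lintegral_const_mul' _ _ ENNReal.ofReal_ne_top]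

lemma lintegral_errKern_eq {α s : ℝ} {u : ℝ → ℝ} (hu : Continuous u)
    (hp : Function.Periodic u 1) :
    ∫⁻ x in Ioc (0 : ℝ) 1, ∫⁻ z, ENNReal.ofReal (errKern α s (z - x)) * (‖u z‖ₑ + ‖u x‖ₑ)
      = 2 * (∫⁻ τ, ENNReal.ofReal (errKern α s τ)) * ∫⁻ x in Ioc (0 : ℝ) 1, ‖u x‖ₑ := by
  have hk := (measurable_errKern α s).ennreal_ofReal
  have hue : Measurable fun x => ‖u x‖ₑ := hu.measurable.enorm
  have h1 : ∀ x, ∫⁻ z, ENNReal.ofReal (errKern α s (z - x)) * (‖u z‖ₑ + ‖u x‖ₑ)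
      = ∫⁻ τ, ENNReal.ofReal (errKern α s τ) * (‖u (x + τ)‖ₑ + ‖u x‖ₑ) := by
    intro x
    rw [← lintegral_add_right_eq_self _ x]
    simp only [add_sub_cancel_right, add_comm x]
  simp only [h1]
  rw [lintegral_lintegral_swap (f := fun x τ =>
    ENNReal.ofReal (errKern α s τ) * (‖u (x + τ)‖ₑ + ‖u x‖ₑ))]
  · have h2 : ∀ τ, ∫⁻ x in Ioc (0 : ℝ) 1,
        ENNReal.ofReal (errKern α s τ) * (‖u (x + τ)‖ₑ + ‖u x‖ₑ)
        = ENNReal.ofReal (errKern α s τ) * (2 * ∫⁻ x in Ioc (0 : ℝ) 1, ‖u x‖ₑ) := by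
      intro τ
      rw [lintegral_const_mul' _ _ ENNReal.ofReal_ne_top, lintegral_add_right _ hue,
        lintegral_periodic_comp_add (J := fun x => ‖u x‖ₑ) (fun x => by simp only [hp x]), two_mul]
    simp only [h2]
    rw [lintegral_mul_const _ hk]
    ring
  · refine Measurable.aemeasurable ?_
    refine (hk.comp measurable_snd).mul ?_
    exact (hue.comp (measurable_fst.add measurable_snd)).add (hue.comp measurable_fst)

lemma measurable_slp {α : ℝ} (hα : 0 ≤ α) : Measurable fun p : ℝ × ℝ => slp α p.1 p.2 := by
  have hF := (continuous_lift hα).measurable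
  exact ((hF.comp measurable_snd).sub (hF.comp measurable_fst)).div
    (measurable_snd.sub measurable_fst)

lemma measurable_defect_integrand {α : ℝ} (hα : 0 ≤ α) (s : ℝ) {u : ℝ → ℝ} (hu : Continuous u) :
    Measurable fun p : ℝ × ℝ => ENNReal.ofReal (1 - slp α p.1 p.2 ^ (-s)) *
      (‖u p.2 - u p.1‖ₑ * ENNReal.ofReal (kern s (p.2 - p.1))) :=
  (measurable_const.sub ((measurable_slp hα).pow_const _)).ennreal_ofReal.mul
    (measurable_osc_integrand s hu)

lemma measurable_defect_integrand_right {α : ℝ} (hα : 0 ≤ α) (s : ℝ) {u : ℝ → ℝ}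
    (hu : Continuous u) (x : ℝ) :
    Measurable fun z => ENNReal.ofReal (1 - slp α x z ^ (-s)) *
      (‖u z - u x‖ₑ * ENNReal.ofReal (kern s (z - x))) :=
  (measurable_const.sub
    (((((continuous_lift hα).measurable.sub_const _).div (measurable_id.sub_const x))).pow_const
      _)).ennreal_ofReal.mul (measurable_osc_integrand_right s hu x)

lemma energy_transfer_add_defect_le {α s : ℝ} (hα0 : 0 ≤ α) (hα1 : α ≤ 1) (hs : 0 < s)
    {u : ℝ → ℝ} (hu : Continuous u) (hp : Function.Periodic u 1) :
    energy s (transfer hα0 u) + defect α s u ≤ energy s u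
      + 2 * (∫⁻ τ, ENNReal.ofReal (errKern α s τ)) * ∫⁻ x in Ioc (0 : ℝ) 1, ‖u x‖ₑ := by
  have hmd := measurable_defect_integrand hα0 s hu
  have he : energy s u = ∫⁻ y in Ioc (0 : ℝ) 1, osc s u y := rfl
  rw [← lintegral_errKern_eq hu hp, defect, he, ← lintegral_add_left (measurable_osc s hu)]
  refine (add_le_add (energy_transfer_le_lintegral hα0 s hu) le_rfl).trans ?_
  rw [← lintegral_add_right _ hmd.lintegral_prod_right']
  refine lintegral_mono fun x => ?_
  have hmd' : Measurable fun z => ENNReal.ofReal (1 - slp α x z ^ (-s)) *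
      (‖u z - u x‖ₑ * ENNReal.ofReal (kern s (z - x))) :=
    measurable_defect_integrand_right hα0 s hu x
  have hmo' : Measurable fun z => ‖u z - u x‖ₑ * ENNReal.ofReal (kern s (z - x)) :=
    measurable_osc_integrand_right s hu x
  simp only [osc]
  rw [← lintegral_add_right _ hmd', ← lintegral_add_left hmo']
  exact lintegral_mono fun z => transfer_pointwise_ennreal hα0 hα1 hs u x z

lemma lintegral_rpow_mul_kern_lt_top {a s : ℝ} (has : s < a) (C : ℝ) :
    ∫⁻ τ, ENNReal.ofReal (C * |τ| ^ a * kern s τ) < ⊤ := by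
  set G : ℝ → ENNReal := (Ioo 0 1).indicator fun τ => ENNReal.ofReal (C * τ ^ (a - 1 - s))
  have hG : ∫⁻ τ, G τ < ⊤ := by
    rw [lintegral_indicator measurableSet_Ioo]
    have hi : IntegrableOn (fun τ : ℝ => C * τ ^ (a - 1 - s)) (Ioo 0 1) :=
      ((intervalIntegral.integrableOn_Ioo_rpow_iff one_pos).2 (by linarith)).const_mul C
    exact hi.lintegral_lt_top
  have hGm : Measurable G :=
    ((measurable_id.pow_const _).const_mul C).ennreal_ofReal.indicator measurableSet_Ioo
  have hGi : ∀ τ ∈ Ioo (0 : ℝ) 1, G τ = ENNReal.ofReal (C * τ ^ (a - 1 - s)) :=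
    fun τ hτ => indicator_of_mem hτ _
  have hle : ∀ τ : ℝ, τ ≠ 0 → ENNReal.ofReal (C * |τ| ^ a * kern s τ) ≤ G τ + G (-τ) := by
    intro τ hτ
    by_cases h1 : |τ| < 1
    · have hpow : C * |τ| ^ a * kern s τ = C * |τ| ^ (a - 1 - s) := by
        rw [kern, if_pos h1, mul_assoc, ← Real.rpow_add (abs_pos.2 hτ)]
        ring_nf
      rw [hpow]
      rcases lt_or_gt_of_ne hτ with h | h
      · rw [abs_of_neg h] at h1 ⊢
        exact le_add_left (hGi (-τ) ⟨neg_pos.2 h, h1⟩).ge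
      · rw [abs_of_pos h] at h1 ⊢
        exact le_add_right (hGi τ ⟨h, h1⟩).ge
    · simp [kern, h1]
  calc ∫⁻ τ, ENNReal.ofReal (C * |τ| ^ a * kern s τ) ≤ ∫⁻ τ, (G τ + G (-τ)) := by
        refine lintegral_mono_ae ?_
        filter_upwards [Measure.ae_ne volume (0 : ℝ)] with τ hτ using hle τ hτ
    _ = (∫⁻ τ, G τ) + ∫⁻ τ, G τ := by
        rw [lintegral_add_left hGm, lintegral_neg_eq_self]
    _ < ⊤ := ENNReal.add_lt_top.2 ⟨hG, hG⟩

lemma lintegral_errKern_lt_top {α s : ℝ} (hs : s < α) :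
    ∫⁻ τ, ENNReal.ofReal (errKern α s τ) < ⊤ :=
  lintegral_rpow_mul_kern_lt_top hs _

lemma energy_lt_top_of_lipschitz {s : ℝ} (hs : s < 1) {h : ℝ → ℝ} {M : ℝ}
    (hM : ∀ x z, |h z - h x| ≤ M * |z - x|) : energy s h < ⊤ := by
  set A := ∫⁻ τ, ENNReal.ofReal (M * |τ| ^ (1 : ℝ) * kern s τ)
  have hA : A < ⊤ := lintegral_rpow_mul_kern_lt_top hs M
  have hosc : ∀ x, osc s h x ≤ A := by
    intro x
    calc osc s h x ≤ ∫⁻ z, ENNReal.ofReal (M * |z - x| ^ (1 : ℝ) * kern s (z - x)) := by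
          refine lintegral_mono fun z => ?_
          rw [Real.enorm_eq_ofReal_abs, ← ENNReal.ofReal_mul (abs_nonneg _), Real.rpow_one]
          exact ENNReal.ofReal_le_ofReal (mul_le_mul_of_nonneg_right (hM x z) (kern_nonneg _ _))
      _ = A := lintegral_sub_right_eq_self
          (fun τ => ENNReal.ofReal (M * |τ| ^ (1 : ℝ) * kern s τ)) x
  calc energy s h ≤ ∫⁻ _ in Ioc (0 : ℝ) 1, A := lintegral_mono hosc
    _ < ⊤ := by simpa using hA

lemma PerDens.lintegral_eq {u : ℝ → ℝ} (hu : PerDens u) :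
    ∫⁻ x in Ioc (0 : ℝ) 1, ‖u x‖ₑ = ENNReal.ofReal (∫ x in (0 : ℝ)..1, u x) := by
  rw [intervalIntegral.integral_of_le zero_le_one,
    ofReal_integral_eq_lintegral_ofReal (hu.cont.integrableOn_Ioc)
      (Eventually.of_forall fun x => hu.nonneg x)]
  exact lintegral_congr fun x => by rw [Real.enorm_eq_ofReal (hu.nonneg x)]

lemma integral_one_randTransfer {α : ℝ} (hα : 0 ≤ α) (θ : Measure ℝ) [IsProbabilityMeasure θ]
    {u : ℝ → ℝ} (hu : PerDens u) :
    ∫ y in (0 : ℝ)..1, randTransfer hα θ u y = ∫ x in (0 : ℝ)..1, u x := by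
  simpa using (integral_randTransfer hα θ 1 hu).symm

lemma PerDens.iterate {α : ℝ} (hα : 0 ≤ α) (θ : Measure ℝ) [IsProbabilityMeasure θ]
    {u : ℝ → ℝ} (hu : PerDens u) (n : ℕ) : PerDens ((ZeroNoise.randTransfer hα θ)^[n] u) := by
  induction n with
  | zero => exact hu
  | succ n ih =>
    rw [Function.iterate_succ_apply']
    exact ih.randTransfer hα θ

lemma integral_iterate {α : ℝ} (hα : 0 ≤ α) (θ : Measure ℝ) [IsProbabilityMeasure θ]
    {u : ℝ → ℝ} (hu : PerDens u) (n : ℕ) :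
    ∫ y in (0 : ℝ)..1, (randTransfer hα θ)^[n] u y = ∫ x in (0 : ℝ)..1, u x := by
  induction n with
  | zero => rfl
  | succ n ih =>
    rw [Function.iterate_succ_apply', integral_one_randTransfer hα θ (hu.iterate hα θ n), ih]

lemma sum_defect_iterate_le {α s : ℝ} (hα0 : 0 ≤ α) (hα1 : α ≤ 1) (hs : 0 < s) (θ : Measure ℝ)
    [IsProbabilityMeasure θ] {u : ℝ → ℝ} (hu : PerDens u) (N : ℕ) :
    energy s ((randTransfer hα0 θ)^[N] u)
        + ∑ n ∈ Finset.range N, defect α s ((randTransfer hα0 θ)^[n] u)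
      ≤ energy s u + N * (2 * (∫⁻ τ, ENNReal.ofReal (errKern α s τ))
        * ENNReal.ofReal (∫ x in (0 : ℝ)..1, u x)) := by
  induction N with
  | zero => simp
  | succ N ih =>
    have hv := hu.iterate hα0 θ N
    have h := energy_transfer_add_defect_le hα0 hα1 hs hv.cont hv.per
    rw [hv.lintegral_eq, integral_iterate hα0 θ hu N] at h
    set K := 2 * (∫⁻ τ, ENNReal.ofReal (errKern α s τ)) * ENNReal.ofReal (∫ x in (0 : ℝ)..1, u x)
    set v := (randTransfer hα0 θ)^[N] u
    set D := ∑ n ∈ Finset.range N, defect α s ((randTransfer hα0 θ)^[n] u)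
    have hn : energy s (randTransfer hα0 θ v) ≤ energy s (transfer hα0 v) :=
      energy_noisy_le s θ (hv.transfer hα0).cont (hv.transfer hα0).per
    rw [Function.iterate_succ_apply', Finset.sum_range_succ]
    calc energy s (randTransfer hα0 θ v) + (D + defect α s v)
        ≤ energy s (transfer hα0 v) + (D + defect α s v) := by gcongr
      _ = (energy s (transfer hα0 v) + defect α s v) + D := by ring
      _ ≤ (energy s v + K) + D := by gcongr
      _ = (energy s v + D) + K := by ring
      _ ≤ (energy s u + N * K) + K := by gcongr
      _ = _ := by push_cast; ring

lemma exists_iterate_defect_le {α s : ℝ} (hα0 : 0 ≤ α) (hα1 : α ≤ 1) (hs : 0 < s) (hsα : s < α)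
    (θ : Measure ℝ) [IsProbabilityMeasure θ] {u : ℝ → ℝ} (hu : PerDens u)
    (hE : energy s u < ⊤) :
    ∃ n, defect α s ((randTransfer hα0 θ)^[n] u) ≤ 2 * (∫⁻ τ, ENNReal.ofReal (errKern α s τ))
      * ENNReal.ofReal (∫ x in (0 : ℝ)..1, u x) + 1 := by
  have hK : 2 * (∫⁻ τ, ENNReal.ofReal (errKern α s τ))
      * ENNReal.ofReal (∫ x in (0 : ℝ)..1, u x) ≠ ⊤ :=
    ENNReal.mul_ne_top (ENNReal.mul_ne_top ENNReal.ofNat_ne_top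
      (lintegral_errKern_lt_top hsα).ne) ENNReal.ofReal_ne_top
  by_contra! hcon
  obtain ⟨N, hN⟩ := ENNReal.exists_nat_gt hE.ne
  have h := (le_add_left le_rfl).trans (sum_defect_iterate_le hα0 hα1 hs θ hu N)
  set K := 2 * (∫⁻ τ, ENNReal.ofReal (errKern α s τ)) * ENNReal.ofReal (∫ x in (0 : ℝ)..1, u x)
  have h2 : (N : ENNReal) * K + N ≤ ∑ n ∈ Finset.range N, defect α s ((randTransfer hα0 θ)^[n] u) := by
    calc (N : ENNReal) * K + N = ∑ n ∈ Finset.range N, (K + 1) := by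
          simp
      _ ≤ _ := Finset.sum_le_sum fun n _ => (hcon n).le
  have h3 := h2.trans h
  rw [add_comm, ENNReal.add_le_add_iff_right (ENNReal.mul_ne_top (ENNReal.natCast_ne_top N) hK)] at h3
  exact absurd hN (not_lt.2 h3)

lemma volume_preimage_coe_eq_zero {A : Set Circle1} (hA : volume A = 0) :
    volume ((fun t : ℝ => (t : Circle1)) ⁻¹' A) = 0 := by
  rw [← inter_univ (_ ⁻¹' A), ← iUnion_Ioc_add_intCast (0 : ℝ), inter_iUnion,
    measure_iUnion_null_iff]
  intro n
  rw [← Measure.restrict_apply' measurableSet_Ioc]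
  exact (AddCircle.measurePreserving_mk 1 (0 + (n : ℝ))).quasiMeasurePreserving.preimage_null hA

lemma volume_preimage_add_coe_eq_zero {A : Set Circle1} (hA : volume A = 0) (c : Circle1) :
    volume ((fun t : ℝ => c + (t : Circle1)) ⁻¹' A) = 0 := by
  obtain ⟨y, rfl⟩ := QuotientAddGroup.mk_surjective c
  have h := measure_preimage_add volume y ((fun t : ℝ => (t : Circle1)) ⁻¹' A)
  rw [volume_preimage_coe_eq_zero hA] at h
  exact h

lemma continuous_Tt_uncurry {α : ℝ} (hα : 0 ≤ α) : Continuous fun p : Circle1 × ℝ => Tt α p.2 p.1 :=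
  ((continuous_Tmap hα).comp continuous_fst).add ((AddCircle.continuous_mk' 1).comp continuous_snd)

lemma absolutelyContinuous_of_isStationaryC {α : ℝ} (hα : 0 ≤ α) {θ : Measure ℝ}
    [IsProbabilityMeasure θ] (hθ : θ ≪ volume) {μ : Measure Circle1} [IsProbabilityMeasure μ]
    (hμ : IsStationaryC (Tt α) θ μ) : μ ≪ volume := by
  have hc := continuous_Tt_uncurry hα
  have hmap : (μ.prod θ).map (fun p => Tt α p.2 p.1) = μ := by
    have : IsProbabilityMeasure ((μ.prod θ).map (fun p => Tt α p.2 p.1)) :=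
      Measure.isProbabilityMeasure_map hc.aemeasurable
    refine ext_of_forall_integral_eq_of_IsFiniteMeasure fun f => ?_
    rw [integral_map hc.aemeasurable f.continuous.aestronglyMeasurable, integral_prod]
    · exact hμ f.toContinuousMap
    · exact Integrable.of_bound (f.continuous.comp hc).aestronglyMeasurable ‖f‖
        (Eventually.of_forall fun p => f.norm_coe_le_norm _)
  refine Measure.AbsolutelyContinuous.mk fun A hAm hA => ?_
  rw [← hmap, Measure.map_apply hc.measurable hAm, Measure.prod_apply (hc.measurable hAm)]
  have h0 : ∀ x, θ (Prod.mk x ⁻¹' ((fun p : Circle1 × ℝ => Tt α p.2 p.1) ⁻¹' A)) = 0 :=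
    fun x => hθ (volume_preimage_add_coe_eq_zero hA (Tmap α x))
  simp [h0]

/-- The average of `H` over the interval `[x, x + ρ]`. -/
def mollify (ρ : ℝ) (H : ℝ → ℝ) (x : ℝ) : ℝ := ρ⁻¹ * ∫ t in x..x + ρ, H t

lemma mollify_lipschitz {ρ C : ℝ} (hρ : 0 < ρ) {H : ℝ → ℝ} (hc : Continuous H)
    (hC : ∀ x, ‖H x‖ ≤ C) (x z : ℝ) :
    |mollify ρ H z - mollify ρ H x| ≤ ρ⁻¹ * (C + C) * |z - x| := by
  have hi : ∀ a b, IntervalIntegrable H volume a b := fun a b => hc.intervalIntegrable a b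
  have h1 : (∫ t in z..z + ρ, H t) - ∫ t in x..x + ρ, H t
      = (∫ t in x + ρ..z + ρ, H t) - ∫ t in x..z, H t := by
    have e1 := intervalIntegral.integral_add_adjacent_intervals (hi x z) (hi z (z + ρ))
    have e2 := intervalIntegral.integral_add_adjacent_intervals (hi x (x + ρ)) (hi (x + ρ) (z + ρ))
    linarith
  have h2 : ∀ a b, |∫ t in a..b, H t| ≤ C * |b - a| := fun a b =>
    intervalIntegral.norm_integral_le_of_norm_le_const fun t _ => hC t
  have h3 := h2 (x + ρ) (z + ρ)
  rw [add_sub_add_right_eq_sub] at h3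
  rw [mollify, mollify, ← mul_sub, abs_mul, abs_of_pos (inv_pos.2 hρ), mul_assoc, h1]
  refine mul_le_mul_of_nonneg_left ?_ (inv_pos.2 hρ).le
  refine (abs_sub _ _).trans ?_
  rw [add_mul]
  exact add_le_add h3 (h2 x z)

lemma mollify_sub_le {ρ η : ℝ} (hρ : 0 < ρ) {H : ℝ → ℝ} (hc : Continuous H) {x : ℝ}
    (hη : ∀ t, |t - x| ≤ ρ → |H t - H x| ≤ η) : |mollify ρ H x - H x| ≤ η := by
  have h1 : mollify ρ H x - H x = ρ⁻¹ * ∫ t in x..x + ρ, (H t - H x) := by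
    rw [intervalIntegral.integral_sub (hc.intervalIntegrable _ _) intervalIntegrable_const,
      intervalIntegral.integral_const, mollify, add_sub_cancel_left, smul_eq_mul]
    field_simp
  have h2 : |∫ t in x..x + ρ, (H t - H x)| ≤ η * |x + ρ - x| := by
    refine intervalIntegral.norm_integral_le_of_norm_le_const (f := fun t => H t - H x)
      fun t ht => hη t ?_
    rw [uIoc_of_le (by linarith)] at ht
    rw [abs_le]
    constructor <;> linarith [ht.1, ht.2]
  rw [add_sub_cancel_left, abs_of_pos hρ] at h2
  rw [h1, abs_mul, abs_of_pos (inv_pos.2 hρ), inv_mul_le_iff₀ hρ, mul_comm ρ]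
  exact h2

lemma perDens_mollify {ρ : ℝ} (hρ : 0 < ρ) {H : ℝ → ℝ} (hH : PerDens H) :
    PerDens (mollify ρ H) where
  cont := by
    obtain ⟨C, hC⟩ := exists_bound_of_periodic hH.cont hH.per
    have h := mollify_lipschitz hρ hH.cont hC
    refine (LipschitzWith.of_dist_le_mul (K := (ρ⁻¹ * (C + C)).toNNReal) fun x z => ?_).continuous
    rw [dist_comm, dist_comm x, Real.dist_eq, Real.dist_eq]
    exact (h x z).trans (mul_le_mul_of_nonneg_right (Real.le_coe_toNNReal _) (abs_nonneg _))
  per x := by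
    have h := intervalIntegral.integral_comp_add_right (a := x) (b := x + ρ) H 1
    simp only [hH.per _] at h
    rw [mollify, mollify, h, add_right_comm]
  nonneg x := mul_nonneg (inv_pos.2 hρ).le
    (intervalIntegral.integral_nonneg (by linarith) fun t _ => hH.nonneg t)

lemma exists_lipschitz_density {μ : Measure Circle1} [IsProbabilityMeasure μ] (hμ : μ ≪ volume)
    {η : ℝ} (hη : 0 < η) :
    ∃ h : ℝ → ℝ, PerDens h ∧ (∃ M, ∀ x z, |h z - h x| ≤ M * |z - x|) ∧
      ∀ φ : C(Circle1, ℝ), (∀ x, |φ x| ≤ 1) →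
        |∫ x, φ x ∂μ - ∫ x in (0 : ℝ)..1, φ (x : Circle1) * h x| ≤ η := by
  have hη2 : 0 < η / 2 := half_pos hη
  set f : Circle1 → ℝ := fun x => (μ.rnDeriv volume x).toReal
  have hf : Integrable f volume := Measure.integrable_toReal_rnDeriv
  have hf0 : ∀ x, 0 ≤ f x := fun x => ENNReal.toReal_nonneg
  obtain ⟨g, hg, hgi⟩ := hf.exists_boundedContinuous_integral_sub_le hη2
  set G : Circle1 → ℝ := fun x => max (g x) 0
  have hGc : Continuous G := g.continuous.max continuous_const
  have hGi : Integrable G volume := hGc.integrable_of_hasCompactSupport (HasCompactSupport.of_compactSpace G)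
  set H : ℝ → ℝ := fun x => G (x : Circle1)
  have hH : PerDens H := ⟨hGc.comp (AddCircle.continuous_mk' 1), fun x => by simp [H],
    fun x => le_max_right _ _⟩
  obtain ⟨ρ, hρ, hu⟩ : ∃ ρ > 0, ∀ x t : ℝ, |t - x| ≤ ρ → |H t - H x| ≤ η / 2 := by
    obtain ⟨r, hr, hu⟩ := Metric.uniformContinuous_iff.1
      (CompactSpace.uniformContinuous_of_continuous hGc) (η / 2) hη2
    refine ⟨r / 2, half_pos hr, fun x t hxt => ?_⟩
    refine (hu (a := (t : Circle1)) (b := (x : Circle1)) ?_).le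
    rw [dist_eq_norm, ← AddCircle.coe_sub]
    exact (norm_coe_le_abs _).trans_lt (hxt.trans_lt (half_lt_self hr))
  obtain ⟨C, hC⟩ := exists_bound_of_periodic hH.cont hH.per
  refine ⟨mollify ρ H, perDens_mollify hρ hH, ⟨_, mollify_lipschitz hρ hH.cont hC⟩, fun φ hφ => ?_⟩
  have hφc : Continuous fun x : ℝ => φ (x : Circle1) := φ.continuous.comp (AddCircle.continuous_mk' 1)
  have e1 : ∫ x, φ x ∂μ = ∫ x, f x * φ x := (integral_rnDeriv_smul hμ).symm
  have e2 : ∫ x in (0 : ℝ)..1, φ (x : Circle1) * H x = ∫ x, G x * φ x := by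
    have := AddCircle.intervalIntegral_preimage 1 0 fun x => G x * φ x
    rw [zero_add] at this
    rw [← this]
    exact intervalIntegral.integral_congr fun x _ => mul_comm _ _
  have hfφ : Integrable (fun x => f x * φ x) volume :=
    hf.mul_bdd (c := 1) φ.continuous.aestronglyMeasurable (Eventually.of_forall hφ)
  have hGφ : Integrable (fun x => G x * φ x) volume :=
    hGi.mul_bdd (c := 1) φ.continuous.aestronglyMeasurable (Eventually.of_forall hφ)
  have b1 : |(∫ x, f x * φ x) - ∫ x, G x * φ x| ≤ η / 2 := by
    rw [← integral_sub hfφ hGφ]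
    refine abs_integral_le_integral_abs.trans ((integral_mono ?_ ?_ fun x => ?_).trans hg)
    · exact (hfφ.sub hGφ).norm
    · exact (hf.sub hgi).norm
    · change |f x * φ x - G x * φ x| ≤ |f x - g x|
      rw [← sub_mul, abs_mul]
      refine (mul_le_of_le_one_right (abs_nonneg _) (hφ x)).trans ?_
      have h := abs_max_sub_max_le_abs (f x) (g x) 0
      rwa [max_eq_left (hf0 x)] at h
  have b2 : |(∫ x in (0 : ℝ)..1, φ (x : Circle1) * H x)
      - ∫ x in (0 : ℝ)..1, φ (x : Circle1) * mollify ρ H x| ≤ η / 2 := by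
    have i1 : Continuous fun x : ℝ => φ (x : Circle1) * H x := hφc.mul hH.cont
    have i2 : Continuous fun x : ℝ => φ (x : Circle1) * mollify ρ H x :=
      hφc.mul (perDens_mollify hρ hH).cont
    rw [← intervalIntegral.integral_sub (i1.intervalIntegrable _ _) (i2.intervalIntegrable _ _)]
    have := intervalIntegral.norm_integral_le_of_norm_le_const (a := (0 : ℝ)) (b := 1)
      (f := fun x => φ (x : Circle1) * H x - φ (x : Circle1) * mollify ρ H x) (C := η / 2)
      fun x _ => ?_
    · simpa using this
    · rw [← mul_sub, norm_mul, Real.norm_eq_abs, Real.norm_eq_abs, abs_sub_comm]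
      exact (mul_le_of_le_one_left (abs_nonneg _) (hφ _)).trans (mollify_sub_le hρ hH.cont (hu x))
  rw [e1]
  rw [e2] at b2
  refine (abs_sub_le _ (∫ x, G x * φ x) _).trans ?_
  linarith

/-- The dual of the random transfer operator acting on continuous observables. -/
def dualOp {α : ℝ} (hα : 0 ≤ α) (θ : Measure ℝ) [IsProbabilityMeasure θ] (φ : C(Circle1, ℝ)) :
    C(Circle1, ℝ) where
  toFun x := ∫ t, φ (Tt α t x) ∂θ
  continuous_toFun := by
    have h1 : ∀ x, Continuous fun t => φ (Tt α t x) := fun x =>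
      φ.continuous.comp (continuous_const.add (AddCircle.continuous_mk' 1))
    have h2 : ∀ t, Continuous fun x => φ (Tt α t x) := fun t =>
      φ.continuous.comp ((continuous_Tmap hα).add continuous_const)
    refine continuous_of_dominated (bound := fun _ => ‖φ‖) ?_ ?_ (integrable_const _) ?_
    · exact fun x => (h1 x).aestronglyMeasurable
    · exact fun x => Eventually.of_forall fun t => φ.norm_coe_le_norm _
    · exact Eventually.of_forall h2

lemma abs_dualOp_le {α : ℝ} (hα : 0 ≤ α) (θ : Measure ℝ) [IsProbabilityMeasure θ]
    {φ : C(Circle1, ℝ)} (hφ : ∀ x, |φ x| ≤ 1) (x : Circle1) : |dualOp hα θ φ x| ≤ 1 := by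
  have h := norm_integral_le_of_norm_le_const (μ := θ) (f := fun t => φ (Tt α t x)) (C := 1)
    (Eventually.of_forall fun t => hφ _)
  simpa [dualOp] using h

lemma exists_dual_iterate {α : ℝ} (hα : 0 ≤ α) {θ : Measure ℝ} [IsProbabilityMeasure θ]
    {μ : Measure Circle1} (hμ : IsStationaryC (Tt α) θ μ) {h : ℝ → ℝ} (hh : PerDens h) (n : ℕ)
    (φ : C(Circle1, ℝ)) (hφ : ∀ x, |φ x| ≤ 1) :
    ∃ ψ : C(Circle1, ℝ), (∀ x, |ψ x| ≤ 1) ∧ ∫ x, ψ x ∂μ = ∫ x, φ x ∂μ ∧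
      ∫ x in (0 : ℝ)..1, φ (x : Circle1) * (randTransfer hα θ)^[n] h x
        = ∫ x in (0 : ℝ)..1, ψ (x : Circle1) * h x := by
  induction n generalizing φ with
  | zero => exact ⟨φ, hφ, rfl, rfl⟩
  | succ n ih =>
    obtain ⟨ψ, h1, h2, h3⟩ := ih (dualOp hα θ φ) (abs_dualOp_le hα θ hφ)
    refine ⟨ψ, h1, h2.trans (hμ φ), ?_⟩
    rw [← h3, Function.iterate_succ_apply']
    exact (integral_randTransfer hα θ φ (hh.iterate hα θ n)).symm

/-- Lower bound for the relative energy loss away from the neutral fixed point. -/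
def gap (α s δ : ℝ) : ℝ := 1 - (1 + (1 + α) * 2 ^ α * (δ / 2) ^ α) ^ (-s)

lemma gap_pos {α s δ : ℝ} (hα : 0 ≤ α) (hs : 0 < s) (hδ : 0 < δ) : 0 < gap α s δ := by
  refine sub_pos.2 (Real.rpow_lt_one_of_one_lt_of_neg ?_ (neg_neg_of_pos hs))
  have : 0 < (1 + α) * 2 ^ α * (δ / 2) ^ α := by positivity
  linarith

lemma gap_le {α s δ x z : ℝ} (hα : 0 ≤ α) (hs : 0 < s) (hδ : 0 < δ) (hx : δ ≤ ‖(x : Circle1)‖)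
    (hxz : x ≠ z) (hz : |z - x| ≤ δ / 2) : gap α s δ ≤ 1 - slp α x z ^ (-s) := by
  have hm : 1 + (1 + α) * 2 ^ α * (δ / 2) ^ α ≤ slp α x z := by
    refine le_slp hα hxz fun t ht => ?_
    have h1 : |t - x| ≤ |z - x| := abs_sub_left_of_mem_uIcc ht
    have h2 : ‖(x : Circle1)‖ ≤ ‖(t : Circle1)‖ + |t - x| := by
      have h3 := norm_sub_norm_le (x : Circle1) (t : Circle1)
      rw [← AddCircle.coe_sub] at h3
      have h4 := norm_coe_le_abs (x - t)
      rw [abs_sub_comm] at h4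
      linarith
    have h5 : δ / 2 ≤ ‖(t : Circle1)‖ := by linarith
    unfold dLift
    gcongr
  refine sub_le_sub_left (Real.rpow_le_rpow_of_nonpos ?_ hm (by linarith)) _
  have : 0 < (1 + α) * 2 ^ α * (δ / 2) ^ α := by positivity
  linarith

lemma rpow_le_kern {s ρ τ : ℝ} (hs : 0 < s) (hρ : ρ ≤ 1) (hτ0 : τ ≠ 0) (hτ : |τ| < ρ) :
    ρ ^ (-1 - s) ≤ kern s τ := by
  rw [kern, if_pos (hτ.trans_le hρ)]
  exact Real.rpow_le_rpow_of_nonpos (abs_pos.2 hτ0) hτ.le (by linarith)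

lemma enorm_sub_le_defect {α s δ ρ x z : ℝ} (hα : 0 ≤ α) (hs : 0 < s) (hδ : 0 < δ) (hρ0 : 0 < ρ)
    (hρ1 : ρ ≤ 1) (hρ : ρ ≤ δ / 2) (hx : δ ≤ ‖(x : Circle1)‖) (hz : |z - x| < ρ) (u : ℝ → ℝ) :
    ‖u z - u x‖ₑ ≤ ENNReal.ofReal (ρ ^ (1 + s) / gap α s δ) *
      (ENNReal.ofReal (1 - slp α x z ^ (-s)) * (‖u z - u x‖ₑ * ENNReal.ofReal (kern s (z - x)))) := by
  rcases eq_or_ne x z with rfl | hxz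
  · simp
  have hg := gap_pos hα hs hδ
  have h1 := gap_le hα hs hδ hx hxz (hz.le.trans hρ)
  have h2 := rpow_le_kern hs hρ1 (sub_ne_zero.2 hxz.symm) hz
  have h3 : 1 ≤ ρ ^ (1 + s) / gap α s δ * ((1 - slp α x z ^ (-s)) * kern s (z - x)) := by
    have h4 : ρ ^ (1 + s) * ρ ^ (-1 - s) = 1 := by
      rw [← Real.rpow_add hρ0]
      ring_nf
      exact Real.rpow_zero _
    calc (1 : ℝ) = ρ ^ (1 + s) / gap α s δ * (gap α s δ * ρ ^ (-1 - s)) := by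
          rw [div_mul_eq_mul_div, mul_left_comm, h4]
          field_simp
      _ ≤ _ := by
          have := hg.le.trans h1
          gcongr
  have hk := kern_nonneg s (z - x)
  calc ‖u z - u x‖ₑ = ENNReal.ofReal 1 * ‖u z - u x‖ₑ := by simp
    _ ≤ ENNReal.ofReal (ρ ^ (1 + s) / gap α s δ * ((1 - slp α x z ^ (-s)) * kern s (z - x)))
        * ‖u z - u x‖ₑ := by gcongr
    _ = _ := by
        rw [ENNReal.ofReal_mul (by positivity), ENNReal.ofReal_mul (hg.le.trans h1)]
        ring

lemma two_mul_le_defect {α s δ ρ x : ℝ} (hα : 0 ≤ α) (hs : 0 < s) (hδ : 0 < δ) (hρ0 : 0 < ρ)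
    (hρ1 : ρ ≤ 1 / 2) (hρ : ρ ≤ δ / 2) (hx : δ ≤ ‖(x : Circle1)‖) {u : ℝ → ℝ}
    (hu : PerDens u) :
    ENNReal.ofReal (2 * ρ) * ENNReal.ofReal (u x) ≤ ENNReal.ofReal (ρ ^ (1 + s) / gap α s δ) *
      (∫⁻ z, ENNReal.ofReal (1 - slp α x z ^ (-s)) *
        (‖u z - u x‖ₑ * ENNReal.ofReal (kern s (z - x))))
      + ∫⁻ z in Ioc (0 : ℝ) 1, ‖u z‖ₑ := by
  have hvol : volume (Ioo (x - ρ) (x + ρ)) = ENNReal.ofReal (2 * ρ) := by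
    rw [Real.volume_Ioo]
    ring_nf
  have hum : Measurable fun z => ‖u z‖ₑ := hu.cont.measurable.enorm
  have hper : ∫⁻ z in Ioc (x - ρ) (x - ρ + 1), ‖u z‖ₑ = ∫⁻ z in Ioc (0 : ℝ) 1, ‖u z‖ₑ := by
    have := lintegral_periodic (J := fun z => ‖u z‖ₑ) (fun z => by simp only [hu.per z]) (x - ρ) 0
    rwa [zero_add] at this
  calc ENNReal.ofReal (2 * ρ) * ENNReal.ofReal (u x)
      = ∫⁻ _ in Ioo (x - ρ) (x + ρ), ENNReal.ofReal (u x) := by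
        rw [setLIntegral_const, hvol, mul_comm]
    _ ≤ ∫⁻ z in Ioo (x - ρ) (x + ρ), (‖u z - u x‖ₑ + ‖u z‖ₑ) := by
        refine lintegral_mono fun z => ?_
        rw [← Real.enorm_eq_ofReal (hu.nonneg x)]
        have h := enorm_sub_le (a := u z) (b := u z - u x)
        rw [sub_sub_cancel] at h
        simpa [add_comm] using h
    _ = (∫⁻ z in Ioo (x - ρ) (x + ρ), ‖u z - u x‖ₑ) + ∫⁻ z in Ioo (x - ρ) (x + ρ), ‖u z‖ₑ :=
        lintegral_add_right _ hum
    _ ≤ _ := by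
        refine add_le_add ?_ ?_
        · rw [← lintegral_const_mul' _ _ ENNReal.ofReal_ne_top]
          refine le_trans ?_ (setLIntegral_le_lintegral (Ioo (x - ρ) (x + ρ)) _)
          refine setLIntegral_mono' measurableSet_Ioo fun z hz => ?_
          refine enorm_sub_le_defect hα hs hδ hρ0 (by linarith) hρ hx ?_ u
          rw [abs_lt]
          constructor <;> linarith [hz.1, hz.2]
        · rw [← hper]
          exact lintegral_mono_set fun z hz => ⟨hz.1, by linarith [hz.2]⟩

/-- Densities of bounded defect are uniformly integrable away from the neutral fixed point. -/
lemma integral_mul_le_of_defect_le {α s δ ρ C : ℝ} (hα : 0 ≤ α) (hs : 0 < s) (hδ : 0 < δ)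
    (hρ0 : 0 < ρ) (hρ1 : ρ ≤ 1 / 2) (hρ : ρ ≤ δ / 2) {u : ℝ → ℝ} (hu : PerDens u) (hC : 0 ≤ C)
    (hd : defect α s u ≤ ENNReal.ofReal C) (φ : C(Circle1, ℝ)) (hφ0 : ∀ x, 0 ≤ φ x)
    (hφ1 : ∀ x, φ x ≤ 1) (hφδ : ∀ x, ‖x‖ < δ → φ x = 0) :
    2 * ρ * ∫ x in (0 : ℝ)..1, φ (x : Circle1) * u x
      ≤ ρ ^ (1 + s) / gap α s δ * C
        + (∫ x in (0 : ℝ)..1, u x) * ∫ x in (0 : ℝ)..1, φ (x : Circle1) := by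
  have hφc : Continuous fun x : ℝ => φ (x : Circle1) := φ.continuous.comp (AddCircle.continuous_mk' 1)
  have hφu : Continuous fun x : ℝ => φ (x : Circle1) * u x := hφc.mul hu.cont
  have hg := gap_pos hα hs hδ
  have hI : ∀ {f : ℝ → ℝ}, Continuous f → (∀ x, 0 ≤ f x) →
      ENNReal.ofReal (∫ x in (0 : ℝ)..1, f x) = ∫⁻ x in Ioc (0 : ℝ) 1, ENNReal.ofReal (f x) := by
    intro f hf hf0
    rw [intervalIntegral.integral_of_le zero_le_one,
      ofReal_integral_eq_lintegral_ofReal hf.integrableOn_Ioc (Eventually.of_forall hf0)]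
  have hnonneg : ∀ {f : ℝ → ℝ}, (∀ x, 0 ≤ f x) → 0 ≤ ∫ x in (0 : ℝ)..1, f x := fun hf =>
    intervalIntegral.integral_nonneg zero_le_one fun x _ => hf x
  have h0 := hnonneg fun x => mul_nonneg (hφ0 (x : Circle1)) (hu.nonneg x)
  have h1 := hnonneg fun x => hφ0 (x : Circle1)
  have h2 := hnonneg hu.nonneg
  rw [← ENNReal.ofReal_le_ofReal_iff (by positivity),
    ENNReal.ofReal_mul (p := 2 * ρ) (by positivity),
    ENNReal.ofReal_add (by positivity) (by positivity),
    ENNReal.ofReal_mul (p := ρ ^ (1 + s) / gap α s δ) (by positivity), ENNReal.ofReal_mul h2, ← hu.lintegral_eq, hI hφu fun x => mul_nonneg (hφ0 _) (hu.nonneg x),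
    hI hφc fun x => hφ0 _, ← lintegral_const_mul' _ _ ENNReal.ofReal_ne_top]
  set M := ∫⁻ x in Ioc (0 : ℝ) 1, ‖u x‖ₑ with hM
  have hMt : M ≠ ⊤ := by
    rw [hM, hu.lintegral_eq]
    exact ENNReal.ofReal_ne_top
  set K := ENNReal.ofReal (ρ ^ (1 + s) / gap α s δ)
  calc _ ≤ ∫⁻ x in Ioc (0 : ℝ) 1, (K * (∫⁻ z, ENNReal.ofReal (1 - slp α x z ^ (-s)) *
        (‖u z - u x‖ₑ * ENNReal.ofReal (kern s (z - x)))) + M * ENNReal.ofReal (φ (x : Circle1))) := by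
        refine lintegral_mono fun x => ?_
        by_cases hx : ‖(x : Circle1)‖ < δ
        · simp [hφδ _ hx]
        have h := two_mul_le_defect hα hs hδ hρ0 hρ1 hρ (not_lt.1 hx) hu
        have hφ1' : ENNReal.ofReal (φ (x : Circle1)) ≤ 1 := ENNReal.ofReal_le_one.2 (hφ1 _)
        rw [ENNReal.ofReal_mul (hφ0 _), mul_left_comm]
        refine (mul_le_mul_right h _).trans ?_
        rw [mul_add, mul_comm _ M]
        exact add_le_add (mul_le_of_le_one_left zero_le hφ1') le_rfl
    _ = K * defect α s u + M * ∫⁻ x in Ioc (0 : ℝ) 1, ENNReal.ofReal (φ (x : Circle1)) := by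
        rw [lintegral_add_right _ (hφc.measurable.ennreal_ofReal.const_mul M),
          lintegral_const_mul' _ _ ENNReal.ofReal_ne_top, lintegral_const_mul' _ _ hMt]
        rfl
    _ ≤ _ := by gcongr

/-- A uniform bound on the defect of suitable approximate stationary densities. -/
def defectBound (α s : ℝ) : ℝ := 4 * (∫⁻ τ, ENNReal.ofReal (errKern α s τ)).toReal + 1

lemma defectBound_nonneg (α s : ℝ) : 0 ≤ defectBound α s := by
  unfold defectBound
  positivity

lemma integral_le_of_isStationaryC {α s δ ρ : ℝ} (hα0 : 0 ≤ α) (hα1 : α ≤ 1) (hs : 0 < s)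
    (hsα : s < α) (hδ : 0 < δ) (hρ0 : 0 < ρ) (hρ1 : ρ ≤ 1 / 2) (hρ : ρ ≤ δ / 2) {θ : Measure ℝ}
    [IsProbabilityMeasure θ] (hθ : θ ≪ volume) {μ : Measure Circle1} [IsProbabilityMeasure μ]
    (hμ : IsStationaryC (Tt α) θ μ) (φ : C(Circle1, ℝ)) (hφ0 : ∀ x, 0 ≤ φ x)
    (hφ1 : ∀ x, φ x ≤ 1) (hφδ : ∀ x, ‖x‖ < δ → φ x = 0) :
    2 * ρ * ∫ x, φ x ∂μ
      ≤ ρ ^ (1 + s) / gap α s δ * defectBound α s + ∫ x in (0 : ℝ)..1, φ (x : Circle1) := by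
  have hφc : Continuous fun x : ℝ => φ (x : Circle1) := φ.continuous.comp (AddCircle.continuous_mk' 1)
  set I := ∫ x in (0 : ℝ)..1, φ (x : Circle1)
  have hI0 : 0 ≤ I := intervalIntegral.integral_nonneg zero_le_one fun x _ => hφ0 _
  have hI1 : I ≤ 1 := by
    have h : I ≤ ∫ _ in (0 : ℝ)..1, (1 : ℝ) :=
      intervalIntegral.integral_mono_on zero_le_one (hφc.intervalIntegrable 0 1)
        intervalIntegrable_const fun x _ => hφ1 (x : Circle1)
    simpa using h
  refine le_of_forall_pos_le_add fun e he => ?_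
  set η := min 1 (e / 2)
  have hη : 0 < η := lt_min one_pos (half_pos he)
  have hη1 : η ≤ 1 := min_le_left _ _
  have hηe : η ≤ e / 2 := min_le_right _ _
  obtain ⟨h, hh, ⟨M, hM⟩, happ⟩ :=
    exists_lipschitz_density (absolutelyContinuous_of_isStationaryC hα0 hθ hμ) hη
  have hmass : ∫ x in (0 : ℝ)..1, h x ≤ 1 + η := by
    have h1 := happ 1 fun x => by simp
    have h2 := (abs_le.1 h1).1
    simp only [ContinuousMap.one_apply, one_mul, integral_const, probReal_univ, smul_eq_mul] at h2
    linarith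
  obtain ⟨n, hn⟩ := exists_iterate_defect_le hα0 hα1 hs hsα θ hh
    (energy_lt_top_of_lipschitz (hsα.trans_le hα1) hM)
  have hd : defect α s ((randTransfer hα0 θ)^[n] h) ≤ ENNReal.ofReal (defectBound α s) := by
    refine hn.trans ?_
    rw [defectBound, ENNReal.ofReal_add (by positivity) zero_le_one, ENNReal.ofReal_one,
      ENNReal.ofReal_mul (by norm_num), ENNReal.ofReal_toReal (lintegral_errKern_lt_top hsα).ne]
    have h2 : ENNReal.ofReal (∫ x in (0 : ℝ)..1, h x) ≤ 2 := by
      rw [← ENNReal.ofReal_ofNat 2]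
      exact ENNReal.ofReal_le_ofReal (by linarith)
    have h4 : ENNReal.ofReal 4 = 2 * 2 := by
      rw [ENNReal.ofReal_ofNat]
      norm_num
    rw [h4, mul_right_comm 2 2]
    gcongr
  have hb := integral_mul_le_of_defect_le hα0 hs hδ hρ0 hρ1 hρ (hh.iterate hα0 θ n)
    (defectBound_nonneg α s) hd φ hφ0 hφ1 hφδ
  rw [integral_iterate hα0 θ hh n] at hb
  obtain ⟨ψ, hψ1, hψμ, hψh⟩ := exists_dual_iterate hα0 hμ hh n φ fun x =>
    abs_le.2 ⟨by linarith [hφ0 x], hφ1 x⟩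
  have h1 := (abs_le.1 (happ ψ hψ1)).2
  rw [hψμ, ← hψh] at h1
  have h2 : (∫ x in (0 : ℝ)..1, h x) * I ≤ (1 + η) * I := mul_le_mul_of_nonneg_right hmass hI0
  have h3 : 2 * ρ * ∫ x, φ x ∂μ ≤ 2 * ρ * ((∫ x in (0 : ℝ)..1,
      φ (x : Circle1) * (randTransfer hα0 θ)^[n] h x) + η) :=
    mul_le_mul_of_nonneg_left (by linarith) (by positivity)
  nlinarith

lemma measure_isCompact_eq_zero {s δ G : ℝ} (hs : 0 < s) (hδ : 0 < δ) {μ : Measure Circle1}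
    [IsProbabilityMeasure μ]
    (hμ : ∀ φ : C(Circle1, ℝ), (∀ x, 0 ≤ φ x) → (∀ x, φ x ≤ 1) → (∀ x, ‖x‖ < δ → φ x = 0) →
      ∀ ρ, 0 < ρ → ρ ≤ 1 / 2 → ρ ≤ δ / 2 →
        2 * ρ * ∫ x, φ x ∂μ ≤ ρ ^ (1 + s) * G + ∫ x, φ x)
    {K : Set Circle1} (hK : IsClosed K) (hK0 : volume K = 0) (hKδ : ∀ x ∈ K, 2 * δ ≤ ‖x‖) :
    μ K = 0 := by
  have hpos : ∀ n : ℕ, 0 < δ / (n + 1) := fun n => by positivity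
  have hlim : Tendsto (fun n : ℕ => δ / ((n : ℝ) + 1)) atTop (𝓝 0) :=
    tendsto_const_div_atTop_nhds_zero_nat δ |>.comp (tendsto_add_atTop_nat 1) |>.congr
      fun n => by simp
  set φ : ℕ → C(Circle1, ℝ) := fun n =>
    ⟨fun x => (thickenedIndicator (hpos n) K x : ℝ),
      NNReal.continuous_coe.comp (thickenedIndicator (hpos n) K).continuous⟩
  have hconv : ∀ ν : Measure Circle1, IsFiniteMeasure ν →
      Tendsto (fun n => ∫ x, φ n x ∂ν) atTop (𝓝 (ν K).toReal) := by
    intro ν _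
    have h := tendsto_lintegral_thickenedIndicator_of_isClosed ν hK hpos hlim
    refine ((ENNReal.tendsto_toReal (measure_ne_top ν K)).comp h).congr fun n => ?_
    exact BoundedContinuousFunction.toReal_lintegral_coe_eq_integral _ _
  have hφ0 : ∀ n x, 0 ≤ φ n x := fun n x => NNReal.coe_nonneg _
  have hφ1 : ∀ n x, φ n x ≤ 1 := fun n x =>
    NNReal.coe_le_one.2 (thickenedIndicator_le_one (hpos n) K x)
  have hφδ : ∀ n x, ‖x‖ < δ → φ n x = 0 := by
    intro n x hx
    have : x ∉ Metric.thickening (δ / (n + 1)) K := by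
      rw [Metric.mem_thickening_iff]
      rintro ⟨z, hz, hxz⟩
      have h1 : δ / ((n : ℝ) + 1) ≤ δ := div_le_self hδ.le (by simp)
      have h2 := norm_sub_norm_le z x
      rw [← dist_eq_norm, dist_comm] at h2
      linarith [hKδ z hz]
    have h := thickenedIndicator_zero (hpos n) K this
    change ((thickenedIndicator (hpos n) K x : NNReal) : ℝ) = 0
    rw [h, NNReal.coe_zero]
  have hb : ∀ ρ, 0 < ρ → ρ ≤ 1 / 2 → ρ ≤ δ / 2 → (μ K).toReal ≤ ρ ^ s * (G / 2) := by
    intro ρ h0 h1 h2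
    have h := le_of_tendsto_of_tendsto' ((hconv μ inferInstance).const_mul (2 * ρ))
      ((hconv volume inferInstance).const_add (ρ ^ (1 + s) * G))
      fun n => hμ (φ n) (hφ0 n) (hφ1 n) (hφδ n) ρ h0 h1 h2
    rw [hK0, ENNReal.toReal_zero, add_zero, Real.rpow_add h0, Real.rpow_one] at h
    refine le_of_mul_le_mul_left ?_ (show 0 < 2 * ρ by positivity)
    linarith
  have hz : (μ K).toReal ≤ 0 := by
    have ht : Tendsto (fun ρ : ℝ => ρ ^ s * (G / 2)) (𝓝[>] 0) (𝓝 (0 ^ s * (G / 2))) :=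
      ((Real.continuousAt_rpow_const 0 s (Or.inr hs.le)).tendsto.mono_left
        nhdsWithin_le_nhds).mul_const _
    rw [Real.zero_rpow hs.ne', zero_mul] at ht
    refine ge_of_tendsto ht ?_
    have hm : 0 < min (1 / 2) (δ / 2) := lt_min (by norm_num) (half_pos hδ)
    filter_upwards [Ioo_mem_nhdsGT hm] with ρ hρ
    exact hb ρ hρ.1 (hρ.2.le.trans (min_le_left _ _)) (hρ.2.le.trans (min_le_right _ _))
  have := (ENNReal.toReal_eq_zero_iff _).1 (le_antisymm hz ENNReal.toReal_nonneg)
  exact this.resolve_right (measure_ne_top μ K)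

lemma restrict_compl_zero_absolutelyContinuous {s : ℝ} (hs : 0 < s) {μ : Measure Circle1}
    [IsProbabilityMeasure μ] {G : ℝ → ℝ}
    (hμ : ∀ δ, 0 < δ → ∀ φ : C(Circle1, ℝ), (∀ x, 0 ≤ φ x) → (∀ x, φ x ≤ 1) →
      (∀ x, ‖x‖ < δ → φ x = 0) → ∀ ρ, 0 < ρ → ρ ≤ 1 / 2 → ρ ≤ δ / 2 →
        2 * ρ * ∫ x, φ x ∂μ ≤ ρ ^ (1 + s) * G δ + ∫ x, φ x) :
    μ.restrict {0}ᶜ ≪ volume := by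
  refine Measure.AbsolutelyContinuous.mk fun A hA hA0 => ?_
  rw [Measure.restrict_apply hA]
  by_contra hne
  obtain ⟨K, hKA, hK, hKpos⟩ := (hA.inter (measurableSet_singleton (0 : Circle1)).compl).exists_lt_isCompact
    (pos_iff_ne_zero.2 hne)
  refine hKpos.ne' ?_
  have h0 : (0 : Circle1) ∈ Kᶜ := fun h => (hKA h).2 rfl
  obtain ⟨r, hr, hball⟩ := Metric.isOpen_iff.1 hK.isClosed.isOpen_compl 0 h0
  refine measure_isCompact_eq_zero hs (half_pos hr) (hμ (r / 2) (half_pos hr)) hK.isClosed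
    (measure_mono_null (hKA.trans inter_subset_left) hA0) fun x hx => ?_
  by_contra! hlt
  refine hball ?_ hx
  rw [mem_ball_zero_iff]
  linarith

lemma integral_circle_eq (φ : C(Circle1, ℝ)) :
    ∫ x in (0 : ℝ)..1, φ (x : Circle1) = ∫ x, φ x := by
  have := AddCircle.intervalIntegral_preimage 1 0 φ
  rwa [zero_add] at this

lemma ae_abs_le_of_mSupport_subset {θ : Measure ℝ} {ε : ℝ} (h : mSupport θ ⊆ Icc (-ε) ε) :
    ∀ᵐ t ∂θ, |t| ≤ ε := by
  refine measure_null_of_locally_null _ fun t ht => ?_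
  have ht' : t ∉ mSupport θ := fun hm => ht (abs_le.2 (h hm))
  simp only [mSupport, mem_ofPred_eq, not_forall, not_not] at ht'
  obtain ⟨U, hU, hU0⟩ := ht'
  exact ⟨U, mem_nhdsWithin_of_mem_nhds hU, hU0⟩

lemma abs_integral_comp_Tmap_sub_le {α ε e : ℝ} (hα : 0 ≤ α) {θ : Measure ℝ}
    [IsProbabilityMeasure θ] (hθ : mSupport θ ⊆ Icc (-ε) ε) {μ : Measure Circle1}
    [IsProbabilityMeasure μ] (hμ : IsStationaryC (Tt α) θ μ) {φ : C(Circle1, ℝ)}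
    (hφ : ∀ (x : Circle1) (t : ℝ), |t| ≤ ε → |φ (x + (t : Circle1)) - φ x| ≤ e) :
    |∫ x, φ (Tmap α x) ∂μ - ∫ x, φ x ∂μ| ≤ e := by
  have hb : ∀ ψ : C(Circle1, ℝ), Integrable ψ μ := fun ψ =>
    ψ.continuous.integrable_of_hasCompactSupport (HasCompactSupport.of_compactSpace ψ)
  have h1 : ∀ x, |φ (Tmap α x) - dualOp hα θ φ x| ≤ e := by
    intro x
    have hc : Continuous fun t => φ (Tt α t x) :=
      φ.continuous.comp (continuous_const.add (AddCircle.continuous_mk' 1))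
    have hi : Integrable (fun t => φ (Tt α t x)) θ :=
      Integrable.of_bound hc.aestronglyMeasurable ‖φ‖
        (Eventually.of_forall fun t => φ.norm_coe_le_norm _)
    have h2 : φ (Tmap α x) - dualOp hα θ φ x = ∫ t, (φ (Tmap α x) - φ (Tt α t x)) ∂θ := by
      rw [integral_sub (integrable_const _) hi]
      simp [dualOp]
    have h3 := norm_integral_le_of_norm_le_const (μ := θ)
      (f := fun t => φ (Tmap α x) - φ (Tt α t x)) (C := e) (by
        filter_upwards [ae_abs_le_of_mSupport_subset hθ] with t ht
        rw [Real.norm_eq_abs, abs_sub_comm]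
        exact hφ _ t ht)
    rw [h2]
    simpa using h3
  have h4 : ∫ x, φ x ∂μ = ∫ x, dualOp hα θ φ x ∂μ := (hμ φ).symm
  have h6 : Integrable (fun x => φ (Tmap α x)) μ := hb (φ.comp ⟨Tmap α, continuous_Tmap hα⟩)
  rw [h4, ← integral_sub h6 (hb (dualOp hα θ φ))]
  have h5 := norm_integral_le_of_norm_le_const (μ := μ)
    (f := fun x => φ (Tmap α x) - dualOp hα θ φ x) (C := e) (Eventually.of_forall h1)
  simpa using h5

lemma map_Tmap_eq_of_tendsto {α : ℝ} (hα : 0 ≤ α) {ε : ℕ → ℝ} (hεlim : Tendsto ε atTop (𝓝 0))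
    {θ : ℕ → Measure ℝ} (hθprob : ∀ k, IsProbabilityMeasure (θ k))
    (hθsupp : ∀ k, mSupport (θ k) ⊆ Icc (-(ε k)) (ε k))
    {μ : ℕ → Measure Circle1} (hμprob : ∀ k, IsProbabilityMeasure (μ k))
    (hstat : ∀ k, IsStationaryC (Tt α) (θ k) (μ k))
    {μ0 : Measure Circle1} [IsProbabilityMeasure μ0]
    (hconv : ∀ φ : C(Circle1, ℝ),
      Tendsto (fun k => ∫ x, φ x ∂(μ k)) atTop (𝓝 (∫ x, φ x ∂μ0))) :
    μ0.map (Tmap α) = μ0 := by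
  have hT := continuous_Tmap hα
  have : IsProbabilityMeasure (μ0.map (Tmap α)) := Measure.isProbabilityMeasure_map hT.aemeasurable
  refine ext_of_forall_integral_eq_of_IsFiniteMeasure fun f => ?_
  rw [integral_map hT.aemeasurable f.continuous.aestronglyMeasurable]
  set φ : C(Circle1, ℝ) := f.toContinuousMap
  have h1 := (hconv (φ.comp ⟨Tmap α, hT⟩)).sub (hconv φ)
  have h2 : Tendsto (fun k => ∫ x, φ (Tmap α x) ∂(μ k) - ∫ x, φ x ∂(μ k)) atTop (𝓝 0) := by
    rw [Metric.tendsto_atTop']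
    intro e he
    obtain ⟨r, hr, hu⟩ := Metric.uniformContinuous_iff.1
      (CompactSpace.uniformContinuous_of_continuous φ.continuous) (e / 2) (half_pos he)
    obtain ⟨N, hN⟩ := eventually_atTop.1 (hεlim.eventually (gt_mem_nhds hr))
    refine ⟨N, fun k hk => ?_⟩
    rw [dist_zero_right]
    refine lt_of_le_of_lt ?_ (half_lt_self he)
    refine abs_integral_comp_Tmap_sub_le hα (hθsupp k) (hstat k) fun x t ht => ?_
    refine (hu (a := x + (t : Circle1)) (b := x) ?_).le
    rw [dist_eq_norm, add_sub_cancel_left]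
    exact ((norm_coe_le_abs t).trans ht).trans_lt (hN k hk.le)
  exact sub_eq_zero.1 (tendsto_nhds_unique h1 h2)

lemma invariant_restrict_compl_of_fixed {α : ℝ} (hα : 0 ≤ α) {μ : Measure Circle1}
    [IsProbabilityMeasure μ] (hμ : μ.map (Tmap α) = μ) :
    (μ.restrict {0}ᶜ).map (Tmap α) = μ.restrict {0}ᶜ := by
  have hT := (continuous_Tmap hα).measurable
  have h0 : μ.restrict {0} + μ.restrict {0}ᶜ = μ :=
    Measure.restrict_add_restrict_compl (measurableSet_singleton _)
  have h1 : (μ.restrict {0}).map (Tmap α) = μ.restrict {0} := by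
    rw [Measure.restrict_singleton, Measure.map_smul, Measure.map_dirac' hT, Tmap_zero hα]
  have h2 : μ.restrict {0} + (μ.restrict {0}ᶜ).map (Tmap α) = μ.restrict {0} + μ.restrict {0}ᶜ := by
    nth_rewrite 1 [← h1]
    rw [← Measure.map_add _ _ hT, h0, hμ]
  ext A hA
  have h3 := congrArg (fun ν : Measure Circle1 => ν A) h2
  simp only [Measure.add_apply] at h3
  exact (ENNReal.add_right_inj (measure_ne_top _ _)).1 h3

lemma dirac_or_convex_combination {α : ℝ} (hα : 0 ≤ α) {μ : Measure Circle1}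
    [IsProbabilityMeasure μ] (hμ : μ.map (Tmap α) = μ) (hac : μ.restrict {0}ᶜ ≪ volume) :
    μ = Measure.dirac (0 : Circle1) ∨
      ∃ c : NNReal, c < 1 ∧ ∃ ν : Measure Circle1, IsProbabilityMeasure ν ∧
        Measure.map (Tmap α) ν = ν ∧ ν ≪ volume ∧
        μ = c • Measure.dirac (0 : Circle1) + (1 - c) • ν := by
  have h0 : μ {0} • Measure.dirac 0 + μ.restrict {0}ᶜ = μ := by
    rw [← Measure.restrict_singleton]
    exact Measure.restrict_add_restrict_compl (measurableSet_singleton _)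
  have hsum : μ {0} + μ {0}ᶜ = 1 := prob_add_prob_compl (measurableSet_singleton _)
  set c : NNReal := (μ {0}).toNNReal
  have hc : (c : ENNReal) = μ {0} := ENNReal.coe_toNNReal (measure_ne_top _ _)
  have hc' : ((1 - c : NNReal) : ENNReal) = μ {0}ᶜ := by
    rw [ENNReal.coe_sub, ENNReal.coe_one, hc, ← hsum,
      ENNReal.add_sub_cancel_left (measure_ne_top _ _)]
  have hc1 : c ≤ 1 := by
    rw [← ENNReal.coe_le_coe, hc]
    exact prob_le_one
  rcases hc1.eq_or_lt with h1 | h1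
  · left
    have hz : μ {0}ᶜ = 0 := by
      rw [← hc', h1]
      simp
    rw [Measure.restrict_zero_set hz, add_zero, ← hc, h1, ENNReal.coe_one, one_smul] at h0
    exact h0.symm
  · right
    have hd : 1 - c ≠ 0 := (tsub_pos_of_lt h1).ne'
    refine ⟨c, h1, (1 - c)⁻¹ • μ.restrict {0}ᶜ, ⟨?_⟩, ?_, ?_, ?_⟩
    · rw [Measure.smul_apply, Measure.restrict_apply_univ, ← hc', ENNReal.smul_def, smul_eq_mul,
        ← ENNReal.coe_mul, inv_mul_cancel₀ hd, ENNReal.coe_one]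
    · rw [Measure.map_smul, invariant_restrict_compl_of_fixed hα hμ]
    · exact hac.smul_left _
    · rw [smul_smul, mul_inv_cancel₀ hd, one_smul]
      nth_rewrite 1 [← h0]
      rw [← hc, ENNReal.smul_def]

end ZeroNoise

/-- any weak* limit of stationary measures of the additive random
perturbations of the intermittent map with `α ∈ (0,1)` is a convex combination
of `δ₀` and an absolutely continuous `T`-invariant probability measure. -/
theorem zero_noise_limit_convex_combination
    (α : ℝ) (hα0 : 0 < α) (hα1 : α < 1)
    (ε : ℕ → ℝ) (hεpos : ∀ k, 0 < ε k) (hεlim : Tendsto ε atTop (𝓝 0))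
    (θ : ℕ → Measure ℝ) (hθprob : ∀ k, IsProbabilityMeasure (θ k))
    (hθac : ∀ k, θ k ≪ volume)
    (hθsupp : ∀ k, mSupport (θ k) ⊆ Icc (-(ε k)) (ε k))
    (hθint : ∀ k, (interior (mSupport (θ k))).Nonempty)
    (μ : ℕ → Measure Circle1) (hμprob : ∀ k, IsProbabilityMeasure (μ k))
    (hstat : ∀ k, IsStationaryC (Tt α) (θ k) (μ k))
    (μ0 : Measure Circle1) (hμ0 : IsProbabilityMeasure μ0)
    (hconv : ∀ φ : C(Circle1, ℝ),
      Tendsto (fun k => ∫ x, φ x ∂(μ k)) atTop (𝓝 (∫ x, φ x ∂μ0))) :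
    μ0 = Measure.dirac (0 : Circle1) ∨
      ∃ c : NNReal, c < 1 ∧ ∃ ν : Measure Circle1, IsProbabilityMeasure ν ∧
        Measure.map (Tmap α) ν = ν ∧ ν ≪ volume ∧
        μ0 = c • Measure.dirac (0 : Circle1) + (1 - c) • ν := by
  have hs : 0 < α / 2 := half_pos hα0
  refine ZeroNoise.dirac_or_convex_combination hα0.le
    (ZeroNoise.map_Tmap_eq_of_tendsto hα0.le hεlim hθprob hθsupp hμprob hstat hconv)
    (ZeroNoise.restrict_compl_zero_absolutelyContinuous hs
      (G := fun δ => ZeroNoise.defectBound α (α / 2) / ZeroNoise.gap α (α / 2) δ) ?_)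
  intro δ hδ φ h0 h1 hφδ ρ hρ0 hρ1 hρ
  refine le_of_tendsto' ((hconv φ).const_mul (2 * ρ)) fun k => ?_
  have := hθprob k
  have := hμprob k
  have h := ZeroNoise.integral_le_of_isStationaryC hα0.le hα1.le hs (half_lt_self hα0) hδ
    hρ0 hρ1 hρ (hθac k) (hstat k) φ h0 h1 hφδ
  rwa [ZeroNoise.integral_circle_eq, div_mul_eq_mul_div, mul_div_assoc] at h
end
end

section
/- Fix α ≥ 1. Let (ε_k)_{k≥1} be a sequence of positive real numbers with ε_k → 0; for each k let θ_k be a Borel probability measure on ℝ, absolutely continuous with respect to Lebesgue measure, whose support is contained in [−ε_k, ε_k] and has nonempty interior, and let μ_k be a stationary measure for the random system ((T_t)_t, θ_k). Then μ_k converges to δ_0 in the weak* topology. -/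
open MeasureTheory Set Filter Topology

noncomputable section

open scoped ENNReal

/-- Truncation of a real number to `[1/(n+1), n+1]`. -/
def posClamp (n : ℕ) (x : ℝ) : ℝ := max ((n : ℝ) + 1)⁻¹ (min x (n + 1))

lemma inv_le_posClamp (n : ℕ) (x : ℝ) : ((n : ℝ) + 1)⁻¹ ≤ posClamp n x := le_max_left _ _

lemma posClamp_pos (n : ℕ) (x : ℝ) : 0 < posClamp n x :=
  lt_of_lt_of_le (by positivity) (inv_le_posClamp n x)

lemma posClamp_le (n : ℕ) (x : ℝ) : posClamp n x ≤ n + 1 := by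
  refine max_le ?_ (min_le_right _ _)
  have : (0 : ℝ) ≤ n := n.cast_nonneg
  exact (inv_le_one_of_one_le₀ (by linarith)).trans (by linarith)

lemma measurable_posClamp (n : ℕ) : Measurable (posClamp n) := by
  unfold posClamp; fun_prop

lemma tendsto_posClamp {x : ℝ} (hx : 0 < x) :
    Tendsto (fun n => posClamp n x) atTop (𝓝 x) := by
  refine tendsto_const_nhds.congr' ?_
  obtain ⟨N, hN⟩ := exists_nat_ge x
  obtain ⟨M, hM⟩ := exists_nat_ge x⁻¹
  filter_upwards [eventually_ge_atTop (max N M)] with n hn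
  have h1 : (N : ℝ) ≤ n := by exact_mod_cast (le_max_left _ _).trans hn
  have h2 : (M : ℝ) ≤ n := by exact_mod_cast (le_max_right _ _).trans hn
  have h3 : ((n : ℝ) + 1)⁻¹ ≤ x := by
    rw [inv_le_comm₀ (by positivity) hx]; linarith
  rw [posClamp, min_eq_left (by linarith), max_eq_right h3]

lemma posClamp_div_le (n : ℕ) {x y : ℝ} (hx : 0 < x) (hy : 0 < y) :
    posClamp n x / posClamp n y ≤ x / y + 1 := by
  rcases le_total x y with h | h
  · have : posClamp n x / posClamp n y ≤ 1 := by
      rw [div_le_one (posClamp_pos n y)]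
      exact max_le_max le_rfl (min_le_min h le_rfl)
    linarith [div_pos hx hy]
  · have : posClamp n x / posClamp n y ≤ x / y := by
      rw [div_le_div_iff₀ (posClamp_pos n y) hy]
      unfold posClamp
      set c : ℝ := ((n : ℝ) + 1)⁻¹ with hc
      set C : ℝ := (n : ℝ) + 1 with hC
      have c0 : 0 < c := by positivity
      have cC : c ≤ C := by
        have := (inv_le_posClamp n x).trans (posClamp_le n x)
        simpa [hc, hC] using this
      rcases max_cases c (min x C) with ⟨h1, h1'⟩ | ⟨h1, h1'⟩ <;>
      rcases max_cases c (min y C) with ⟨h2, h2'⟩ | ⟨h2, h2'⟩ <;>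
      rcases min_cases x C with ⟨h3, h3'⟩ | ⟨h3, h3'⟩ <;>
      rcases min_cases y C with ⟨h4, h4'⟩ | ⟨h4, h4'⟩ <;>
      rw [h1, h2] <;> simp only [h3, h4] at * <;> nlinarith
    linarith

/-- If `X` and `Y` are positive random variables with the same law, then `𝔼[X / Y] ≥ 1`. -/
lemma one_le_lintegral_div_of_map_eq {Ω : Type*} [MeasurableSpace Ω] (P : Measure Ω)
    [IsProbabilityMeasure P] {X Y : Ω → ℝ} (hX : Measurable X) (hY : Measurable Y)
    (hX0 : ∀ᵐ ω ∂P, 0 < X ω) (hY0 : ∀ᵐ ω ∂P, 0 < Y ω)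
    (hmap : P.map X = P.map Y) :
    1 ≤ ∫⁻ ω, ENNReal.ofReal (X ω / Y ω) ∂P := by
  by_cases hfin : ∫⁻ ω, ENNReal.ofReal (X ω / Y ω) ∂P = ∞
  · rw [hfin]; exact le_top
  have hid : ProbabilityTheory.IdentDistrib X Y P P :=
    ⟨hX.aemeasurable, hY.aemeasurable, hmap⟩
  have key : ∀ n : ℕ, 1 ≤ ∫⁻ ω, ENNReal.ofReal (posClamp n (X ω) / posClamp n (Y ω)) ∂P := by
    intro n
    have hlog : Measurable (fun x => Real.log (posClamp n x)) :=
      Real.measurable_log.comp (measurable_posClamp n)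
    have hlogb : ∀ x, ‖Real.log (posClamp n x)‖ ≤ Real.log (n + 1) := by
      intro x
      rw [Real.norm_eq_abs, abs_le]
      constructor
      · rw [← Real.log_inv]
        exact Real.log_le_log (by positivity) (inv_le_posClamp n x)
      · exact Real.log_le_log (posClamp_pos n x) (posClamp_le n x)
    have hiX : Integrable (fun ω => Real.log (posClamp n (X ω))) P :=
      Integrable.of_bound (hlog.comp hX).aestronglyMeasurable _
        (Eventually.of_forall fun ω => hlogb _)
    have hiY : Integrable (fun ω => Real.log (posClamp n (Y ω))) P :=
      Integrable.of_bound (hlog.comp hY).aestronglyMeasurable _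
        (Eventually.of_forall fun ω => hlogb _)
    have heq : ∫ ω, Real.log (posClamp n (X ω)) ∂P = ∫ ω, Real.log (posClamp n (Y ω)) ∂P :=
      (hid.comp hlog).integral_eq
    have hm : Measurable (fun ω => posClamp n (X ω) / posClamp n (Y ω)) :=
      ((measurable_posClamp n).comp hX).div ((measurable_posClamp n).comp hY)
    have hi : Integrable (fun ω => posClamp n (X ω) / posClamp n (Y ω)) P := by
      refine Integrable.of_bound hm.aestronglyMeasurable ((n + 1) / ((n : ℝ) + 1)⁻¹)
        (Eventually.of_forall fun ω => ?_)
      rw [Real.norm_of_nonneg (div_pos (posClamp_pos _ _) (posClamp_pos _ _)).le]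
      exact div_le_div₀ (by positivity) (posClamp_le _ _) (by positivity) (inv_le_posClamp _ _)
    rw [← ofReal_integral_eq_lintegral_ofReal hi
      (Eventually.of_forall fun ω => (div_pos (posClamp_pos _ _) (posClamp_pos _ _)).le)]
    rw [ENNReal.one_le_ofReal]
    have hiXY : Integrable (fun ω => Real.log (posClamp n (X ω)) - Real.log (posClamp n (Y ω))) P :=
      hiX.sub hiY
    calc (1 : ℝ) = ∫ ω, (1 + (Real.log (posClamp n (X ω)) - Real.log (posClamp n (Y ω)))) ∂P := by
          rw [integral_add (integrable_const _) hiXY, integral_sub hiX hiY, heq]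
          simp
      _ ≤ _ := by
          refine integral_mono ((integrable_const _).add hiXY) hi fun ω => ?_
          have h0 := div_pos (posClamp_pos n (X ω)) (posClamp_pos n (Y ω))
          have := Real.log_le_sub_one_of_pos h0
          rw [Real.log_div (posClamp_pos n _).ne' (posClamp_pos n _).ne'] at this
          simp only
          linarith
  refine ge_of_tendsto' (f := fun n : ℕ =>
    ∫⁻ ω, ENNReal.ofReal (posClamp n (X ω) / posClamp n (Y ω)) ∂P) (x := atTop) ?_ key
  refine tendsto_lintegral_of_dominated_convergence
    (fun ω => ENNReal.ofReal (X ω / Y ω) + 1) (fun n => ?_) (fun n => ?_) ?_ ?_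
  · exact (((measurable_posClamp n).comp hX).div ((measurable_posClamp n).comp hY)).ennreal_ofReal
  · filter_upwards [hX0, hY0] with ω h1 h2
    rw [← ENNReal.ofReal_one, ← ENNReal.ofReal_add (div_pos h1 h2).le zero_le_one]
    exact ENNReal.ofReal_le_ofReal (posClamp_div_le n h1 h2)
  · rw [lintegral_add_right _ measurable_const]
    simp [hfin]
  · filter_upwards [hX0, hY0] with ω h1 h2
    exact ENNReal.tendsto_ofReal ((tendsto_posClamp h1).div (tendsto_posClamp h2) h2.ne')

section Stationary

variable {θ : Measure ℝ} {μ : Measure Circle1}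

/-- For a continuous circle map `T`, a stationary measure of the additive perturbations of `T` is
the law of `T x + t` under `μ ⊗ θ`. -/
lemma map_add_eq_of_isStationaryC [IsProbabilityMeasure θ] [IsProbabilityMeasure μ]
    {T : Circle1 → Circle1} (hT : Continuous T)
    (h : IsStationaryC (fun t x => T x + (t : Circle1)) θ μ) :
    (μ.prod θ).map (fun p => T p.1 + (p.2 : Circle1)) = μ := by
  have hc : Continuous (fun p : Circle1 × ℝ => T p.1 + (p.2 : Circle1)) := by
    have : Continuous (fun t : ℝ => (t : Circle1)) := AddCircle.continuous_mk' 1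
    fun_prop
  have : IsProbabilityMeasure ((μ.prod θ).map (fun p => T p.1 + (p.2 : Circle1))) :=
    Measure.isProbabilityMeasure_map hc.measurable.aemeasurable
  refine ext_of_forall_integral_eq_of_IsFiniteMeasure fun f => ?_
  rw [integral_map hc.measurable.aemeasurable f.continuous.aestronglyMeasurable, integral_prod]
  · exact h f.toContinuousMap
  · exact Integrable.of_bound (f.continuous.comp hc).aestronglyMeasurable ‖f‖
      (Eventually.of_forall fun p => f.norm_coe_le_norm _)

lemma volume_preimage_coe_eq_zero {A : Set Circle1} (hA : MeasurableSet A)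
    (h0 : volume A = 0) : volume ((fun t : ℝ => (t : Circle1)) ⁻¹' A) = 0 := by
  have hcov : ((fun t : ℝ => (t : Circle1)) ⁻¹' A) =
      ⋃ n : ℤ, ((fun t : ℝ => (t : Circle1)) ⁻¹' A) ∩ Ioc (n : ℝ) (n + 1) := by
    rw [← inter_iUnion, iUnion_Ioc_intCast, inter_univ]
  rw [hcov, measure_iUnion_null_iff]
  intro n
  have := AddCircle.add_projection_respects_measure (1 : ℝ) (n : ℝ) hA
  rw [h0] at this
  exact this.symm

/-- Stationary measures for absolutely continuous noise are absolutely continuous. -/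
lemma absolutelyContinuous_of_isStationaryC [IsProbabilityMeasure θ] [IsProbabilityMeasure μ]
    (hθ : θ ≪ volume) {T : Circle1 → Circle1} (hT : Continuous T)
    (h : IsStationaryC (fun t x => T x + (t : Circle1)) θ μ) : μ ≪ volume := by
  have hc : Continuous (fun p : Circle1 × ℝ => T p.1 + (p.2 : Circle1)) := by
    have : Continuous (fun t : ℝ => (t : Circle1)) := AddCircle.continuous_mk' 1
    fun_prop
  refine Measure.AbsolutelyContinuous.mk fun A hA h0 => ?_
  rw [← map_add_eq_of_isStationaryC hT h, Measure.map_apply hc.measurable hA,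
    Measure.prod_apply (hc.measurable hA), lintegral_eq_zero_iff'
      (measurable_measure_prodMk_left (hc.measurable hA)).aemeasurable]
  refine Eventually.of_forall fun x => ?_
  change θ ((fun t : ℝ => (t : Circle1)) ⁻¹' ((fun y => T x + y) ⁻¹' A)) = 0
  refine hθ (s := (fun t : ℝ => (t : Circle1)) ⁻¹' ((fun y => T x + y) ⁻¹' A)) ?_
  refine volume_preimage_coe_eq_zero ((measurable_const_add (T x)) hA) ?_
  rw [measure_preimage_add]
  exact h0

/-- If `v` is the transfer operator of `T` applied to the density `u` and the noise average of `v`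
is at most `r * u`, then `∫ r dμ ≥ 1` for every stationary measure `μ`. -/
lemma one_le_lintegral_of_isStationaryC [IsProbabilityMeasure θ] [IsProbabilityMeasure μ]
    (hθ : θ ≪ volume) {T : Circle1 → Circle1} (hT : Continuous T)
    (h : IsStationaryC (fun t x => T x + (t : Circle1)) θ μ)
    {u v r : Circle1 → ℝ} (hu : Measurable u) (hr : Measurable r)
    (hu0 : ∀ x, 0 < u x)
    (hdual : ∀ g : Circle1 → ℝ≥0∞, Measurable g →
      ∫⁻ x, ENNReal.ofReal (u x) * g (T x) = ∫⁻ x, ENNReal.ofReal (v x) * g x)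
    (hvr : ∀ᵐ t : ℝ ∂θ, ∀ y, v (y - (t : Circle1)) ≤ r y * u y) :
    1 ≤ ∫⁻ y, ENNReal.ofReal (r y) ∂μ := by
  have hcoe : Measurable (fun t : ℝ => (t : Circle1)) := (AddCircle.continuous_mk' 1).measurable
  have hc : Measurable (fun p : Circle1 × ℝ => T p.1 + (p.2 : Circle1)) :=
    (hT.measurable.comp measurable_fst).add (hcoe.comp measurable_snd)
  have hmap := map_add_eq_of_isStationaryC hT h
  have hac : μ ≪ volume := absolutelyContinuous_of_isStationaryC hθ hT h
  set ρ : Circle1 → ℝ≥0∞ := μ.rnDeriv volume with hρ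
  have hρm : Measurable ρ := Measure.measurable_rnDeriv _ _
  have hμρ : (volume : Measure Circle1).withDensity ρ = μ := Measure.withDensity_rnDeriv_eq _ _ hac
  set w : Circle1 → ℝ := fun x => u x / (ρ x).toReal with hw
  have hwm : Measurable w := hu.div hρm.ennreal_toReal
  have hw0 : ∀ᵐ x ∂μ, 0 < w x := by
    filter_upwards [Measure.rnDeriv_pos hac, hac.ae_le (Measure.rnDeriv_lt_top μ volume)]
      with x h1 h2
    exact div_pos (hu0 x) (ENNReal.toReal_pos h1.ne' h2.ne)
  have hY0 : ∀ᵐ p ∂(μ.prod θ), 0 < w (T p.1 + (p.2 : Circle1)) := by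
    rw [← hmap] at hw0
    exact ae_of_ae_map hc.aemeasurable hw0
  have hX0 : ∀ᵐ p ∂(μ.prod θ), 0 < w p.1 := Measure.quasiMeasurePreserving_fst.ae hw0
  have hlaw : (μ.prod θ).map (fun p => w p.1) =
      (μ.prod θ).map (fun p => w (T p.1 + (p.2 : Circle1))) := by
    have h1 : (μ.prod θ).map (fun p => w p.1) = ((μ.prod θ).map Prod.fst).map w :=
      (Measure.map_map hwm measurable_fst).symm
    have h2 : (μ.prod θ).map (fun p => w (T p.1 + (p.2 : Circle1))) =
        ((μ.prod θ).map (fun p => T p.1 + (p.2 : Circle1))).map w :=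
      (Measure.map_map hwm hc).symm
    rw [h1, h2, hmap, Measure.map_fst_prod]
    simp
  refine (one_le_lintegral_div_of_map_eq (μ.prod θ) (hwm.comp measurable_fst) (hwm.comp hc)
    hX0 hY0 hlaw).trans ?_
  have hmeas : Measurable (fun p : Circle1 × ℝ =>
      ENNReal.ofReal (w p.1 / w (T p.1 + (p.2 : Circle1)))) :=
    ((hwm.comp measurable_fst).div (hwm.comp hc)).ennreal_ofReal
  simp only [Function.comp_def]
  rw [lintegral_prod_symm _ hmeas.aemeasurable]
  calc ∫⁻ t : ℝ, ∫⁻ x, ENNReal.ofReal (w x / w (T x + (t : Circle1))) ∂μ ∂θ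
      ≤ ∫⁻ _t : ℝ, (∫⁻ y, ENNReal.ofReal (r y) ∂μ) ∂θ := by
        refine lintegral_mono_ae ?_
        filter_upwards [hvr] with t ht
        have hg : Measurable (fun z : Circle1 => ENNReal.ofReal (1 / w (z + (t : Circle1)))) :=
          ((hwm.comp (measurable_add_const _)).const_div 1).ennreal_ofReal
        calc ∫⁻ x, ENNReal.ofReal (w x / w (T x + (t : Circle1))) ∂μ
            = ∫⁻ x, ρ x * ENNReal.ofReal (w x / w (T x + (t : Circle1))) := by
              conv_lhs => rw [← hμρ]
              rw [lintegral_withDensity_eq_lintegral_mul _ hρm]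
              · rfl
              · exact (hwm.div (hwm.comp (hT.measurable.add_const _))).ennreal_ofReal
          _ ≤ ∫⁻ x, ENNReal.ofReal (u x) * ENNReal.ofReal (1 / w (T x + (t : Circle1))) := by
              refine lintegral_mono fun x => ?_
              have hwn : 0 ≤ w x := div_nonneg (hu0 x).le ENNReal.toReal_nonneg
              rw [div_eq_mul_one_div, ENNReal.ofReal_mul hwn, ← mul_assoc]
              gcongr
              simp only [hw]
              rcases eq_or_ne (ρ x) 0 with h0 | h0
              · simp [h0]
              rcases eq_or_ne (ρ x) ∞ with h1 | h1
              · simp [h1]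
              have h2 := ENNReal.toReal_pos h0 h1
              conv_lhs => rw [← ENNReal.ofReal_toReal h1]
              rw [← ENNReal.ofReal_mul h2.le]
              simp [h1, mul_div_cancel₀ _ h2.ne']
          _ = ∫⁻ z, ENNReal.ofReal (v z) * ENNReal.ofReal (1 / w (z + (t : Circle1))) :=
              hdual _ hg
          _ = ∫⁻ y, ENNReal.ofReal (v (y - (t : Circle1))) * ENNReal.ofReal (1 / w y) := by
              rw [← lintegral_add_right_eq_self (fun y => ENNReal.ofReal (v (y - (t : Circle1))) *
                ENNReal.ofReal (1 / w y)) (t : Circle1)]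
              simp
          _ ≤ ∫⁻ y, ρ y * ENNReal.ofReal (r y) := by
              refine lintegral_mono fun y => ?_
              have h1 : ENNReal.ofReal (1 / w y) ≤ ρ y * ENNReal.ofReal (u y)⁻¹ := by
                simp only [hw, one_div, inv_div]
                rw [div_eq_mul_inv, ENNReal.ofReal_mul ENNReal.toReal_nonneg]
                gcongr
                exact ENNReal.ofReal_toReal_le
              calc _ ≤ ENNReal.ofReal (r y * u y) * (ρ y * ENNReal.ofReal (u y)⁻¹) :=
                    mul_le_mul' (ENNReal.ofReal_le_ofReal (ht y)) h1
                _ = ρ y * ENNReal.ofReal (r y) := by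
                    rw [mul_left_comm, ← ENNReal.ofReal_mul' (inv_nonneg.2 (hu0 y).le),
                      mul_assoc, mul_inv_cancel₀ (hu0 y).ne', mul_one]
          _ = ∫⁻ y, ENNReal.ofReal (r y) ∂μ := by
              conv_rhs => rw [← hμρ]
              rw [lintegral_withDensity_eq_lintegral_mul _ hρm hr.ennreal_ofReal]
              rfl
    _ = _ := by simp

end Stationary

section Branch

/-- The extension to `ℝ`, as an odd function, of the branch of `Tlift α` on `[0, 1/2]`. -/
def branch (α s : ℝ) : ℝ := s * (1 + (2 * |s|) ^ α)

/-- The derivative of `branch α`. -/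
def branchDeriv (α s : ℝ) : ℝ := 1 + (1 + α) * (2 * |s|) ^ α

/-- The inverse of `branch α`. -/
def branchInv (α : ℝ) : ℝ → ℝ := Function.invFun (branch α)

variable {α : ℝ}

lemma continuous_branch (hα : 1 ≤ α) : Continuous (branch α) := by
  have : Continuous fun s : ℝ => (2 * |s|) ^ α :=
    (by fun_prop : Continuous fun s : ℝ => 2 * |s|).rpow_const fun _ => Or.inr (by linarith)
  unfold branch; fun_prop

lemma continuous_branchDeriv (hα : 1 ≤ α) : Continuous (branchDeriv α) := by
  have : Continuous fun s : ℝ => (2 * |s|) ^ α :=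
    (by fun_prop : Continuous fun s : ℝ => 2 * |s|).rpow_const fun _ => Or.inr (by linarith)
  unfold branchDeriv; fun_prop

lemma branch_zero : branch α 0 = 0 := by simp [branch]

lemma branch_half : branch α (1 / 2) = 1 := by norm_num [branch]

lemma one_le_branchDeriv (hα : 1 ≤ α) (s : ℝ) : 1 ≤ branchDeriv α s := by
  have : 0 ≤ (2 * |s|) ^ α := by positivity
  unfold branchDeriv; nlinarith

lemma strictMono_branch (hα : 1 ≤ α) : StrictMono (branch α) := by
  refine strictMono_of_odd_strictMonoOn_nonneg (fun x => by simp [branch]) ?_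
  intro x hx y hy hxy
  simp only [mem_Ici] at hx hy
  have h1 : (2 * |x|) ^ α ≤ (2 * |y|) ^ α := by
    rw [abs_of_nonneg hx, abs_of_nonneg hy]; gcongr
  have h2 : 0 ≤ (2 * |x|) ^ α := by positivity
  unfold branch
  nlinarith

lemma surjective_branch (hα : 1 ≤ α) : Function.Surjective (branch α) := by
  refine (continuous_branch hα).surjective ?_ ?_
  · refine tendsto_atTop_mono' _ ?_ tendsto_id
    filter_upwards [eventually_ge_atTop 0] with s hs
    have : 0 ≤ (2 * |s|) ^ α := by positivity
    simp only [branch, id]; nlinarith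
  · refine tendsto_atBot_mono' _ ?_ tendsto_id
    filter_upwards [eventually_le_atBot 0] with s hs
    have : 0 ≤ (2 * |s|) ^ α := by positivity
    simp only [branch, id]; nlinarith

lemma branchInv_branch (hα : 1 ≤ α) (s : ℝ) : branchInv α (branch α s) = s :=
  Function.leftInverse_invFun (strictMono_branch hα).injective s

lemma branch_branchInv (hα : 1 ≤ α) (x : ℝ) : branch α (branchInv α x) = x :=
  Function.rightInverse_invFun (surjective_branch hα) x

lemma strictMono_branchInv (hα : 1 ≤ α) : StrictMono (branchInv α) := fun x y hxy => by
  rw [← (strictMono_branch hα).lt_iff_lt, branch_branchInv hα, branch_branchInv hα]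
  exact hxy

lemma continuous_branchInv (hα : 1 ≤ α) : Continuous (branchInv α) :=
  (strictMono_branchInv hα).monotone.continuous_of_surjective fun s =>
    ⟨branch α s, branchInv_branch hα s⟩

lemma branchInv_zero (hα : 1 ≤ α) : branchInv α 0 = 0 := by
  conv_lhs => rw [← branch_zero (α := α)]
  exact branchInv_branch hα 0

lemma branchInv_one (hα : 1 ≤ α) : branchInv α 1 = 1 / 2 := by
  conv_lhs => rw [← branch_half (α := α)]
  exact branchInv_branch hα _

lemma branchInv_mem_Ioc (hα : 1 ≤ α) {x : ℝ} (hx : x ∈ Ioc (0 : ℝ) 1) :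
    branchInv α x ∈ Ioc (0 : ℝ) (1 / 2) := by
  have h0 := strictMono_branchInv hα hx.1
  have h1 := (strictMono_branchInv hα).monotone hx.2
  rw [branchInv_zero hα] at h0
  rw [branchInv_one hα] at h1
  exact ⟨h0, h1⟩

lemma branchInv_mem_Icc (hα : 1 ≤ α) {x : ℝ} (hx : x ∈ Icc (0 : ℝ) 1) :
    branchInv α x ∈ Icc (0 : ℝ) (1 / 2) := by
  have h0 := (strictMono_branchInv hα).monotone hx.1
  have h1 := (strictMono_branchInv hα).monotone hx.2
  rw [branchInv_zero hα] at h0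
  rw [branchInv_one hα] at h1
  exact ⟨h0, h1⟩

lemma branch_of_nonneg {s : ℝ} (hs : 0 ≤ s) (hα : 1 ≤ α) :
    branch α s = s + 2 ^ α * s ^ (1 + α) := by
  rw [branch, abs_of_nonneg hs, Real.mul_rpow zero_le_two hs,
    Real.rpow_add_of_nonneg hs zero_le_one (by linarith), Real.rpow_one]
  ring

lemma hasDerivAt_branch (hα : 1 ≤ α) {s : ℝ} (hs : 0 < s) :
    HasDerivAt (branch α) (branchDeriv α s) s := by
  have h1 : HasDerivAt (fun s : ℝ => s + 2 ^ α * s ^ (1 + α))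
      (1 + 2 ^ α * ((1 + α) * s ^ (1 + α - 1))) s :=
    (hasDerivAt_id s).add ((Real.hasDerivAt_rpow_const (Or.inl hs.ne')).const_mul _)
  have h2 : branchDeriv α s = 1 + 2 ^ α * ((1 + α) * s ^ (1 + α - 1)) := by
    rw [branchDeriv, abs_of_pos hs, Real.mul_rpow zero_le_two hs.le]
    ring_nf
  rw [h2]
  refine h1.congr_of_eventuallyEq ?_
  filter_upwards [lt_mem_nhds hs] with x hx
  exact branch_of_nonneg hx.le hα

/-- The orbit of `1/2` under the inverse branch decays no faster than harmonically. -/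
lemma iterate_branchInv_bounds (hα : 1 ≤ α) (i : ℕ) :
    (branchInv α)^[i] (1 / 2) ∈ Ioc (0 : ℝ) (1 / 2) ∧
      1 / (2 * (i + 1)) ≤ (branchInv α)^[i] (1 / 2) := by
  induction i with
  | zero => norm_num
  | succ i ih =>
    rw [Function.iterate_succ_apply']
    obtain ⟨hy, hle⟩ := ih
    set y := (branchInv α)^[i] (1 / 2) with hydef
    have hz := branchInv_mem_Ioc hα ⟨hy.1, hy.2.trans (by norm_num)⟩
    have hyz := branch_branchInv hα y
    set z := branchInv α y with hzdef
    refine ⟨hz, ?_⟩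
    have h1 : (2 * |z|) ^ α ≤ 2 * z := by
      rw [abs_of_pos hz.1]
      calc (2 * z) ^ α ≤ (2 * z) ^ (1 : ℝ) :=
            Real.rpow_le_rpow_of_exponent_ge (by linarith [hz.1]) (by linarith [hz.2]) hα
        _ = 2 * z := Real.rpow_one _
    have h2 : y ≤ z * (1 + 2 * z) := by
      rw [← hyz, branch]
      exact mul_le_mul_of_nonneg_left (by linarith) hz.1.le
    have hzy : z ≤ y := by
      rw [← hyz, branch]
      nlinarith [hz.1, (by positivity : 0 ≤ (2 * |z|) ^ α)]
    rw [div_le_iff₀ (by positivity)] at hle ⊢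
    push_cast
    have h3 : (1 : ℝ) * y ≤ z * (2 * (i + 1 + 1)) * y := by
      nlinarith [mul_le_mul_of_nonneg_left hle hz.1.le, mul_nonneg hz.1.le hz.1.le,
        mul_le_mul_of_nonneg_left hzy hz.1.le]
    exact le_of_mul_le_mul_right h3 hy.1

lemma branchDeriv_mono (hα : 1 ≤ α) {s t : ℝ} (hs : 0 ≤ s) (hst : s ≤ t) :
    branchDeriv α s ≤ branchDeriv α t := by
  unfold branchDeriv
  rw [abs_of_nonneg hs, abs_of_nonneg (hs.trans hst)]
  have : 0 ≤ 1 + α := by linarith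
  gcongr

lemma branchDeriv_half : branchDeriv α (1 / 2) = 2 + α := by
  norm_num [branchDeriv]; ring

/-- The distortion estimate for the branch. -/
lemma branchDeriv_mul_rpow_le (hα : 1 ≤ α) {s t : ℝ} (hs : 0 ≤ s) (hst : s ≤ t) :
    branchDeriv α t * (1 + (2 * |s|) ^ α) ^ (1 + α) ≤
      branchDeriv α s * (1 + (2 * |t|) ^ α) ^ (1 + α) := by
  have hp : 0 ≤ (2 * |s|) ^ α := by positivity
  have hpq : (2 * |s|) ^ α ≤ (2 * |t|) ^ α := by
    rw [abs_of_nonneg hs, abs_of_nonneg (hs.trans hst)]; gcongr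
  unfold branchDeriv
  generalize (2 * |s|) ^ α = p at *
  generalize (2 * |t|) ^ α = q at *
  have hb := one_add_mul_self_le_rpow_one_add (s := (q - p) / (1 + p)) (p := 1 + α)
    (by have : 0 ≤ (q - p) / (1 + p) := div_nonneg (by linarith) (by linarith)
        linarith) (by linarith)
  have h1 : 1 + (q - p) / (1 + p) = (1 + q) / (1 + p) := by
    have : 1 + p ≠ 0 := by positivity
    field_simp; ring
  rw [h1, Real.div_rpow (by linarith) (by linarith), le_div_iff₀ (by positivity)] at hb
  have h2 : 0 < (1 + p) ^ (1 + α) := by positivity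
  have h3 : 1 + (1 + α) * q ≤ (1 + (1 + α) * p) * (1 + (1 + α) * ((q - p) / (1 + p))) := by
    have h4 : (1 + (1 + α) * p) * ((1 + α) * ((q - p) / (1 + p))) =
        (1 + α) * (q - p) * ((1 + (1 + α) * p) / (1 + p)) := by ring
    have h5 : 1 ≤ (1 + (1 + α) * p) / (1 + p) := by
      rw [le_div_iff₀ (by linarith)]; nlinarith
    have h6 : 0 ≤ (1 + α) * (q - p) := mul_nonneg (by linarith) (by linarith)
    nlinarith
  calc _ ≤ (1 + (1 + α) * p) * (1 + (1 + α) * ((q - p) / (1 + p))) * (1 + p) ^ (1 + α) := by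
        gcongr
    _ ≤ _ := by
        rw [mul_assoc]
        gcongr

end Branch

section TransferOperator

/-- The contribution of the branch on `[0, 1/2]` to the transfer operator. -/
def branchTransfer (α : ℝ) (u : ℝ → ℝ) (x : ℝ) : ℝ :=
  u (branchInv α x) / branchDeriv α (branchInv α x)

/-- The transfer operator of `Tmap α` on densities which are symmetric under `x ↦ 1 - x`. -/
def transferOp (α : ℝ) (u : ℝ → ℝ) (x : ℝ) : ℝ :=
  branchTransfer α u x + branchTransfer α u (1 - x)

/-- Symmetric positive densities with logarithmic derivative bounded by `(1 + α) / x` on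
`(0, 1/2]`, in integrated form. -/
structure InCone (α : ℝ) (u : ℝ → ℝ) : Prop where
  cont : Continuous u
  symm : ∀ x, u (1 - x) = u x
  pos : ∀ x ∈ Icc (0 : ℝ) 1, 0 < u x
  incr : ∀ x y, 0 < x → x ≤ y → y ≤ 1 / 2 → u x * x ^ (1 + α) ≤ u y * y ^ (1 + α)
  decr : ∀ x y, 0 < x → x ≤ y → y ≤ 1 / 2 → u y * x ^ (1 + α) ≤ u x * y ^ (1 + α)

variable {α : ℝ} {u : ℝ → ℝ}

lemma inCone_one (hα : 1 ≤ α) : InCone α (fun _ => 1) where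
  cont := continuous_const
  symm _ := rfl
  pos _ _ := one_pos
  incr _ _ hx hxy _ := by
    have : 0 ≤ 1 + α := by linarith
    gcongr
  decr _ _ hx hxy _ := by
    have : 0 ≤ 1 + α := by linarith
    gcongr

lemma continuous_branchTransfer (hα : 1 ≤ α) (hu : Continuous u) :
    Continuous (branchTransfer α u) :=
  (hu.comp (continuous_branchInv hα)).div
    ((continuous_branchDeriv hα).comp (continuous_branchInv hα))
    fun _ => (zero_lt_one.trans_le (one_le_branchDeriv hα _)).ne'

lemma continuous_transferOp (hα : 1 ≤ α) (hu : Continuous u) : Continuous (transferOp α u) :=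
  (continuous_branchTransfer hα hu).add
    ((continuous_branchTransfer hα hu).comp (continuous_const.sub continuous_id))

lemma transferOp_symm (x : ℝ) : transferOp α u (1 - x) = transferOp α u x := by
  simp [transferOp, add_comm]

namespace InCone

lemma branchTransfer_pos (hα : 1 ≤ α) (hu : InCone α u) {x : ℝ} (hx : x ∈ Icc (0 : ℝ) 1) :
    0 < branchTransfer α u x := by
  have h := branchInv_mem_Icc hα hx
  exact div_pos (hu.pos _ ⟨h.1, h.2.trans (by norm_num)⟩)
    (zero_lt_one.trans_le (one_le_branchDeriv hα _))

lemma rpow_eq_branchInv (hα : 1 ≤ α) {x : ℝ} (hx : x ∈ Ioc (0 : ℝ) 1) :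
    x ^ (1 + α) = branchInv α x ^ (1 + α) * (1 + (2 * |branchInv α x|) ^ α) ^ (1 + α) := by
  rw [← Real.mul_rpow (branchInv_mem_Ioc hα hx).1.le (by positivity)]
  conv_lhs => rw [← branch_branchInv hα x, branch]

lemma branchTransfer_incr (hα : 1 ≤ α) (hu : InCone α u) {x y : ℝ} (hx : 0 < x) (hxy : x ≤ y)
    (hy : y ≤ 1) :
    branchTransfer α u x * x ^ (1 + α) ≤ branchTransfer α u y * y ^ (1 + α) := by
  have hx' : x ∈ Ioc (0 : ℝ) 1 := ⟨hx, hxy.trans hy⟩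
  have hy' : y ∈ Ioc (0 : ℝ) 1 := ⟨hx.trans_le hxy, hy⟩
  rw [rpow_eq_branchInv hα hx', rpow_eq_branchInv hα hy']
  have hs := branchInv_mem_Ioc hα hx'
  have ht := branchInv_mem_Ioc hα hy'
  have hst : branchInv α x ≤ branchInv α y := (strictMono_branchInv hα).monotone hxy
  unfold branchTransfer
  set s := branchInv α x
  set t := branchInv α y
  have h1 := hu.incr s t hs.1 hst ht.2
  have h2 := branchDeriv_mul_rpow_le hα hs.1.le hst
  have hDs : 0 < branchDeriv α s := zero_lt_one.trans_le (one_le_branchDeriv hα _)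
  have hDt : 0 < branchDeriv α t := zero_lt_one.trans_le (one_le_branchDeriv hα _)
  have h3 : (1 + (2 * |s|) ^ α) ^ (1 + α) / branchDeriv α s ≤
      (1 + (2 * |t|) ^ α) ^ (1 + α) / branchDeriv α t := by
    rw [div_le_div_iff₀ hDs hDt]; linarith
  have hut := hu.pos t ⟨ht.1.le, ht.2.trans (by norm_num)⟩
  have ht0 := ht.1
  calc _ = (u s * s ^ (1 + α)) * ((1 + (2 * |s|) ^ α) ^ (1 + α) / branchDeriv α s) := by ring
    _ ≤ (u t * t ^ (1 + α)) * ((1 + (2 * |t|) ^ α) ^ (1 + α) / branchDeriv α t) :=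
        mul_le_mul h1 h3 (by positivity) (by positivity)
    _ = _ := by ring

lemma branchTransfer_decr (hα : 1 ≤ α) (hu : InCone α u) {x y : ℝ} (hx : 0 < x) (hxy : x ≤ y)
    (hy : y ≤ 1) :
    branchTransfer α u y * x ^ (1 + α) ≤ branchTransfer α u x * y ^ (1 + α) := by
  have hx' : x ∈ Ioc (0 : ℝ) 1 := ⟨hx, hxy.trans hy⟩
  have hy' : y ∈ Ioc (0 : ℝ) 1 := ⟨hx.trans_le hxy, hy⟩
  rw [rpow_eq_branchInv hα hx', rpow_eq_branchInv hα hy']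
  have hs := branchInv_mem_Ioc hα hx'
  have ht := branchInv_mem_Ioc hα hy'
  have hst : branchInv α x ≤ branchInv α y := (strictMono_branchInv hα).monotone hxy
  unfold branchTransfer
  set s := branchInv α x
  set t := branchInv α y
  have h1 := hu.decr s t hs.1 hst ht.2
  have h2 := branchDeriv_mono hα hs.1.le hst
  have hDs : 0 < branchDeriv α s := zero_lt_one.trans_le (one_le_branchDeriv hα _)
  have hst' : (2 * |s|) ^ α ≤ (2 * |t|) ^ α := by
    rw [abs_of_pos hs.1, abs_of_pos ht.1]
    have := hs.1
    gcongr
  have h3 : (1 + (2 * |s|) ^ α) ^ (1 + α) / branchDeriv α t ≤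
      (1 + (2 * |t|) ^ α) ^ (1 + α) / branchDeriv α s := by
    have : 0 ≤ 1 + α := by linarith
    gcongr
  have hDt : 0 < branchDeriv α t := zero_lt_one.trans_le (one_le_branchDeriv hα _)
  have hus := hu.pos s ⟨hs.1.le, hs.2.trans (by norm_num)⟩
  have ht0 := ht.1
  calc _ = (u t * s ^ (1 + α)) * ((1 + (2 * |s|) ^ α) ^ (1 + α) / branchDeriv α t) := by ring
    _ ≤ (u s * t ^ (1 + α)) * ((1 + (2 * |t|) ^ α) ^ (1 + α) / branchDeriv α s) :=
        mul_le_mul h1 h3 (by positivity) (by positivity)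
    _ = _ := by ring

lemma mul_one_sub_rpow_le (hα : 1 ≤ α) {x y : ℝ} (hx : 0 < x) (hxy : x ≤ y) (hy : y ≤ 1 / 2) :
    (1 - x) ^ (1 + α) * x ^ (1 + α) ≤ y ^ (1 + α) * (1 - y) ^ (1 + α) := by
  rw [← Real.mul_rpow (by linarith) hx.le, ← Real.mul_rpow (by linarith) (by linarith)]
  exact Real.rpow_le_rpow (mul_nonneg (by linarith) hx.le) (by nlinarith) (by linarith)

lemma transferOp (hα : 1 ≤ α) (hu : InCone α u) : InCone α (transferOp α u) where
  cont := continuous_transferOp hα hu.cont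
  symm := transferOp_symm
  pos x hx := add_pos (hu.branchTransfer_pos hα hx)
    (hu.branchTransfer_pos hα ⟨by linarith [hx.2], by linarith [hx.1]⟩)
  incr x y hx hxy hy := by
    have h1 := hu.branchTransfer_incr hα hx hxy (by linarith)
    have h2 := hu.branchTransfer_decr hα (x := 1 - y) (y := 1 - x) (by linarith) (by linarith)
      (by linarith)
    have h3 := mul_one_sub_rpow_le hα hx hxy hy
    have h4 : 0 < (1 - y) ^ (1 + α) := Real.rpow_pos_of_pos (by linarith) _
    have h5 : 0 < branchTransfer α u (1 - y) :=
      hu.branchTransfer_pos hα ⟨by linarith, by linarith⟩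
    have h6 : 0 < x ^ (1 + α) := by positivity
    have h7 : branchTransfer α u (1 - x) * x ^ (1 + α) ≤
        branchTransfer α u (1 - y) * y ^ (1 + α) := by
      refine le_of_mul_le_mul_right ?_ h4
      nlinarith [mul_le_mul_of_nonneg_right h2 h6.le, mul_le_mul_of_nonneg_left h3 h5.le]
    unfold _root_.transferOp
    linarith
  decr x y hx hxy hy := by
    have h1 := hu.branchTransfer_decr hα hx hxy (by linarith)
    have h2 := hu.branchTransfer_incr hα (x := 1 - y) (y := 1 - x) (by linarith) (by linarith)
      (by linarith)
    have h3 := mul_one_sub_rpow_le hα hx hxy hy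
    have h4 : 0 < (1 - y) ^ (1 + α) := Real.rpow_pos_of_pos (by linarith) _
    have h5 : 0 < branchTransfer α u (1 - x) :=
      hu.branchTransfer_pos hα ⟨by linarith, by linarith⟩
    have h6 : 0 < x ^ (1 + α) := by positivity
    have h7 : branchTransfer α u (1 - y) * x ^ (1 + α) ≤
        branchTransfer α u (1 - x) * y ^ (1 + α) := by
      refine le_of_mul_le_mul_right ?_ h4
      nlinarith [mul_le_mul_of_nonneg_right h2 h6.le, mul_le_mul_of_nonneg_left h3 h5.le]
    unfold _root_.transferOp
    linarith

lemma sum {N : ℕ} (hN : 0 < N) {c : ℕ → ℝ} (hc : ∀ j, 0 < c j) {f : ℕ → ℝ → ℝ}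
    (hf : ∀ j, InCone α (f j)) :
    InCone α (fun x => ∑ j ∈ Finset.range N, c j * f j x) where
  cont := continuous_finsetSum _ fun j _ => continuous_const.mul (hf j).cont
  symm x := by simp only [(hf _).symm]
  pos x hx := Finset.sum_pos (fun j _ => mul_pos (hc j) ((hf j).pos x hx)) (by simpa using hN.ne')
  incr x y hx hxy hy := by
    rw [Finset.sum_mul, Finset.sum_mul]
    refine Finset.sum_le_sum fun j _ => ?_
    rw [mul_assoc, mul_assoc]
    exact mul_le_mul_of_nonneg_left ((hf j).incr x y hx hxy hy) (hc j).le
  decr x y hx hxy hy := by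
    rw [Finset.sum_mul, Finset.sum_mul]
    refine Finset.sum_le_sum fun j _ => ?_
    rw [mul_assoc, mul_assoc]
    exact mul_le_mul_of_nonneg_left ((hf j).decr x y hx hxy hy) (hc j).le

lemma le_half (hα : 1 ≤ α) (hu : InCone α u) {b x : ℝ} (hb : 0 < b) (hbx : b ≤ x)
    (hx : x ≤ 1 / 2) : u x ≤ (1 / 2 / b) ^ (1 + α) * u (1 / 2) := by
  have h1 := hu.incr x (1 / 2) (hb.trans_le hbx) hx le_rfl
  have h2 : b ^ (1 + α) ≤ x ^ (1 + α) := Real.rpow_le_rpow hb.le hbx (by linarith)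
  have h3 : 0 < b ^ (1 + α) := by positivity
  have h4 := hu.pos x ⟨by linarith, by linarith⟩
  rw [Real.div_rpow (by norm_num) hb.le, div_mul_eq_mul_div, le_div_iff₀ h3]
  nlinarith

lemma half_le (hα : 1 ≤ α) (hu : InCone α u) {b x : ℝ} (hb : 0 < b) (hbx : b ≤ x)
    (hx : x ≤ 1 / 2) : u (1 / 2) ≤ (1 / 2 / b) ^ (1 + α) * u x := by
  have h1 := hu.decr x (1 / 2) (hb.trans_le hbx) hx le_rfl
  have h2 : b ^ (1 + α) ≤ x ^ (1 + α) := Real.rpow_le_rpow hb.le hbx (by linarith)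
  have h3 : 0 < b ^ (1 + α) := by positivity
  have h4 := hu.pos (1 / 2) ⟨by norm_num, by norm_num⟩
  rw [Real.div_rpow (by norm_num) hb.le, div_mul_eq_mul_div, le_div_iff₀ h3]
  nlinarith

end InCone

end TransferOperator

section Construction

variable {α : ℝ} {u : ℝ → ℝ}

lemma integral_branchTransfer (hα : 1 ≤ α) (hu : Continuous u) {y : ℝ} (hy : 0 ≤ y) :
    ∫ x in 0..y, branchTransfer α u x = ∫ s in 0..(branchInv α y), u s := by
  have hay : 0 ≤ branchInv α y := by
    have := (strictMono_branchInv hα).monotone hy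
    rwa [branchInv_zero hα] at this
  have h := intervalIntegral.integral_comp_mul_deriv'' (a := 0) (b := branchInv α y)
    (f := branch α) (f' := branchDeriv α) (g := branchTransfer α u)
    (continuous_branch hα).continuousOn
    (fun x hx => by
      rw [min_eq_left hay] at hx
      exact (hasDerivAt_branch hα hx.1).hasDerivWithinAt)
    (continuous_branchDeriv hα).continuousOn (continuous_branchTransfer hα hu).continuousOn
  rw [branch_zero, branch_branchInv hα] at h
  rw [← h]
  refine intervalIntegral.integral_congr fun s _ => ?_
  have := (zero_lt_one.trans_le (one_le_branchDeriv hα s)).ne'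
  simp only [Function.comp, branchTransfer, branchInv_branch hα]
  field_simp

/-- The transfer operator preserves mass. -/
lemma integral_transferOp (hα : 1 ≤ α) (hu : Continuous u) :
    ∫ x in 0..(1 / 2), transferOp α u x = ∫ x in 0..(1 / 2), u x := by
  have hc := continuous_branchTransfer hα hu
  have hc' : Continuous fun x => branchTransfer α u (1 - x) :=
    hc.comp (continuous_const.sub continuous_id)
  unfold transferOp
  rw [intervalIntegral.integral_add (hc.intervalIntegrable _ _) (hc'.intervalIntegrable _ _),
    intervalIntegral.integral_comp_sub_left (fun x => branchTransfer α u x)]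
  norm_num only
  rw [intervalIntegral.integral_add_adjacent_intervals (hc.intervalIntegrable _ _)
    (hc.intervalIntegrable _ _), integral_branchTransfer hα hu zero_le_one, branchInv_one hα]

lemma branchInv_half_lt (hα : 1 ≤ α) : branchInv α (1 / 2) < 1 / 2 := by
  conv_rhs => rw [← branchInv_one hα]
  exact strictMono_branchInv hα (by norm_num)

lemma branchInv_half_pos (hα : 1 ≤ α) : 0 < branchInv α (1 / 2) :=
  (branchInv_mem_Ioc hα ⟨by norm_num, by norm_num⟩).1

/-- The Harnack constant on `[branchInv α (1/2), 1/2]` for densities in the cone. -/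
def harnackConst (α : ℝ) : ℝ := (1 / 2 / branchInv α (1 / 2)) ^ (1 + α)

lemma harnackConst_pos (hα : 1 ≤ α) : 0 < harnackConst α := by
  have := branchInv_half_pos hα
  unfold harnackConst; positivity

namespace InCone

lemma one_sub_branchInv_mem (hα : 1 ≤ α) {x : ℝ} (hx : x ∈ Icc (0 : ℝ) (1 / 2)) :
    branchInv α (1 / 2) ≤ branchInv α (1 - x) ∧ branchInv α (1 - x) ≤ 1 / 2 :=
  ⟨(strictMono_branchInv hα).monotone (by linarith [hx.2]),
    (branchInv_mem_Icc hα ⟨by linarith [hx.2], by linarith [hx.1]⟩).2⟩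

lemma le_transferOp (hα : 1 ≤ α) (hu : InCone α u) {x : ℝ} (hx : x ∈ Icc (0 : ℝ) (1 / 2)) :
    branchTransfer α u x + u (1 / 2) / (harnackConst α * (2 + α)) ≤ _root_.transferOp α u x := by
  obtain ⟨h1, h2⟩ := one_sub_branchInv_mem hα hx
  have h3 := hu.half_le hα (branchInv_half_pos hα) h1 h2
  have hb := branchInv_half_pos hα
  have h4 := branchDeriv_mono hα (hb.le.trans h1) h2
  rw [branchDeriv_half] at h4
  have h5 := harnackConst_pos hα
  have hD := one_le_branchDeriv hα (branchInv α (1 - x))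
  have hup : 0 < u (branchInv α (1 - x)) := hu.pos _ ⟨hb.le.trans h1, h2.trans (by norm_num)⟩
  unfold _root_.transferOp
  gcongr
  unfold branchTransfer
  rw [← div_div]
  refine div_le_div₀ hup.le ?_ (by linarith) h4
  rw [div_le_iff₀ h5, mul_comm]
  exact h3

lemma transferOp_le (hα : 1 ≤ α) (hu : InCone α u) {B : ℝ}
    (hB : ∀ x ∈ Icc (0 : ℝ) (1 / 2), u x ≤ B) {x : ℝ} (hx : x ∈ Icc (0 : ℝ) (1 / 2)) :
    _root_.transferOp α u x ≤ B + harnackConst α * u (1 / 2) := by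
  obtain ⟨h1, h2⟩ := one_sub_branchInv_mem hα hx
  have h3 := hu.le_half hα (branchInv_half_pos hα) h1 h2
  have hb := branchInv_half_pos hα
  have h4 := branchInv_mem_Icc hα (x := x) ⟨hx.1, hx.2.trans (by norm_num)⟩
  have key : ∀ s ∈ Icc (0 : ℝ) (1 / 2), u s / branchDeriv α s ≤ u s := fun s hs =>
    div_le_self (hu.pos s ⟨hs.1, hs.2.trans (by norm_num)⟩).le (one_le_branchDeriv hα s)
  exact add_le_add ((key _ h4).trans (hB _ h4)) ((key _ ⟨hb.le.trans h1, h2⟩).trans h3)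

lemma half_le_integral (hα : 1 ≤ α) (hu : InCone α u) :
    (1 / 2 - branchInv α (1 / 2)) * u (1 / 2) ≤ harnackConst α * ∫ x in 0..(1 / 2), u x := by
  have hb := branchInv_half_pos hα
  have hb' := branchInv_half_lt hα
  have hi := fun a b => hu.cont.intervalIntegrable (μ := volume) a b
  rw [← intervalIntegral.integral_add_adjacent_intervals (hi 0 (branchInv α (1 / 2)))
    (hi (branchInv α (1 / 2)) (1 / 2))]
  have h0 : 0 ≤ ∫ x in 0..(branchInv α (1 / 2)), u x :=
    intervalIntegral.integral_nonneg hb.le fun x hx =>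
      (hu.pos x ⟨hx.1, by linarith [hx.2]⟩).le
  have h1 : ∫ _ in (branchInv α (1 / 2))..(1 / 2), u (1 / 2) ≤
      ∫ x in (branchInv α (1 / 2))..(1 / 2), harnackConst α * u x :=
    intervalIntegral.integral_mono_on hb'.le (by simp)
      ((hi _ _).const_mul _) fun x hx => hu.half_le hα hb hx.1 hx.2
  rw [intervalIntegral.integral_const, intervalIntegral.integral_const_mul, smul_eq_mul] at h1
  nlinarith [mul_nonneg (harnackConst_pos hα).le h0]

/-- A density in the cone which is almost superinvariant and has mass at most `1 / δ` is small at
`1/2`, compared with `1 / δ`. -/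
lemma half_mul_sum_le (hα : 1 ≤ α) (hu : InCone α u) {δ : ℝ} (hδ : 0 < δ)
    (hsup : ∀ x ∈ Icc (0 : ℝ) (1 / 2), _root_.transferOp α u x ≤ (1 + δ) * u x)
    (hmass : ∫ x in 0..(1 / 2), u x ≤ 1 / δ) (n : ℕ) :
    u (1 / 2) / (harnackConst α * (2 + α)) *
      ∑ i ∈ Finset.range n, (branchInv α)^[i] (1 / 2) ≤ 1 / δ + n := by
  set c := u (1 / 2) / (harnackConst α * (2 + α)) with hc
  have hi := fun a b => hu.cont.intervalIntegrable (μ := volume) a b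
  have hnn : ∀ a b, 0 ≤ a → a ≤ b → b ≤ 1 / 2 → 0 ≤ ∫ x in a..b, u x := fun a b ha hab hb =>
    intervalIntegral.integral_nonneg hab fun x hx =>
      (hu.pos x ⟨ha.trans hx.1, by linarith [hx.2]⟩).le
  have hstep : ∀ y ∈ Ioc (0 : ℝ) (1 / 2),
      (∫ x in 0..(branchInv α y), u x) + c * y ≤ (∫ x in 0..y, u x) + 1 := by
    intro y hy
    have h1 : ∫ x in 0..y, (branchTransfer α u x + c) ≤ ∫ x in 0..y, (1 + δ) * u x := by
      refine intervalIntegral.integral_mono_on hy.1.le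
        (((continuous_branchTransfer hα hu.cont).add continuous_const).intervalIntegrable _ _)
        ((hi _ _).const_mul _) fun x hx => ?_
      have hx' : x ∈ Icc (0 : ℝ) (1 / 2) := ⟨hx.1, hx.2.trans hy.2⟩
      exact (hu.le_transferOp hα hx').trans (hsup x hx')
    rw [intervalIntegral.integral_add
      ((continuous_branchTransfer hα hu.cont).intervalIntegrable _ _) (by simp),
      integral_branchTransfer hα hu.cont hy.1.le, intervalIntegral.integral_const,
      intervalIntegral.integral_const_mul, smul_eq_mul] at h1
    have h2 : ∫ x in 0..y, u x ≤ 1 / δ := by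
      rw [← intervalIntegral.integral_add_adjacent_intervals (hi 0 y) (hi y (1 / 2))] at hmass
      linarith [hnn y (1 / 2) hy.1.le hy.2 le_rfl]
    rw [le_div_iff₀ hδ] at h2
    linarith
  have hind : c * (∑ i ∈ Finset.range n, (branchInv α)^[i] (1 / 2)) +
      (∫ x in 0..((branchInv α)^[n] (1 / 2)), u x) ≤ (∫ x in 0..(1 / 2), u x) + n := by
    induction n with
    | zero => simp
    | succ n ih =>
      have := hstep _ (iterate_branchInv_bounds hα n).1
      rw [Finset.sum_range_succ, Function.iterate_succ_apply']
      push_cast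
      linarith
  have := hnn 0 _ le_rfl (iterate_branchInv_bounds hα n).1.1.le (iterate_branchInv_bounds hα n).1.2
  linarith

end InCone

lemma inCone_iterate_transferOp (hα : 1 ≤ α) (j : ℕ) :
    InCone α ((transferOp α)^[j] fun _ => 1) := by
  induction j with
  | zero => exact inCone_one hα
  | succ j ih => rw [Function.iterate_succ_apply']; exact ih.transferOp hα

lemma integral_iterate_transferOp (hα : 1 ≤ α) (j : ℕ) :
    ∫ x in 0..(1 / 2), ((transferOp α)^[j] fun _ => 1) x = 1 / 2 := by
  induction j with
  | zero => simp
  | succ j ih =>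
    rw [Function.iterate_succ_apply',
      integral_transferOp hα (inCone_iterate_transferOp hα j).cont, ih]

/-- The iterates of the transfer operator grow at most linearly. -/
lemma exists_iterate_transferOp_le (hα : 1 ≤ α) : ∃ C : ℝ, ∀ j : ℕ, ∀ x ∈ Icc (0 : ℝ) 1,
    ((transferOp α)^[j] fun _ => 1) x ≤ 1 + j * C := by
  have hb := branchInv_half_lt hα
  have hH := harnackConst_pos hα
  set m := harnackConst α * (1 / 2) / (1 / 2 - branchInv α (1 / 2)) with hm
  refine ⟨harnackConst α * m, ?_⟩
  have hhalf : ∀ j : ℕ, ∀ x ∈ Icc (0 : ℝ) (1 / 2),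
      ((transferOp α)^[j] fun _ => 1) x ≤ 1 + j * (harnackConst α * m) := by
    intro j
    induction j with
    | zero => intro x _; simp
    | succ j ih =>
      intro x hx
      have hj := inCone_iterate_transferOp hα j
      have h1 := hj.transferOp_le hα ih hx
      have h2 := hj.half_le_integral hα
      rw [integral_iterate_transferOp hα j] at h2
      have h3 : ((transferOp α)^[j] fun _ => 1) (1 / 2) ≤ m := by
        rw [hm, le_div_iff₀ (by linarith)]; linarith
      have h4 := mul_le_mul_of_nonneg_left h3 hH.le
      rw [Function.iterate_succ_apply']
      push_cast
      linarith
  intro j x hx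
  rcases le_total x (1 / 2) with h | h
  · exact hhalf j x ⟨hx.1, h⟩
  · rw [← (inCone_iterate_transferOp hα j).symm]
    exact hhalf j _ ⟨by linarith [hx.2], by linarith⟩

/-- Truncated resolvents of the transfer operator. -/
lemma exists_resolvent (hα : 1 ≤ α) {δ : ℝ} (hδ : 0 < δ) (hδ1 : δ ≤ 1) :
    ∃ u : ℝ → ℝ, InCone α u ∧ (∀ x ∈ Icc (0 : ℝ) 1, 1 ≤ u x) ∧
      (∀ x ∈ Icc (0 : ℝ) 1, transferOp α u x ≤ (1 + δ) * (u x - 1 / 2)) ∧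
      ∫ x in 0..(1 / 2), u x ≤ 1 / δ := by
  obtain ⟨C, hC⟩ := exists_iterate_transferOp_le hα
  set l : ℝ := (1 + δ)⁻¹ with hl
  have hl0 : 0 < l := by positivity
  have hl1 : l < 1 := inv_lt_one_of_one_lt₀ (by linarith)
  have hlδ : (1 + δ) * l = 1 := mul_inv_cancel₀ (by positivity)
  have hlim : Tendsto (fun N : ℕ => l ^ N * (1 + N * C)) atTop (𝓝 0) := by
    have h1 := tendsto_pow_atTop_nhds_zero_of_lt_one hl0.le hl1
    have h2 := (tendsto_self_mul_const_pow_of_lt_one hl0.le hl1).mul_const C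
    have h3 := h1.add h2
    simp only [zero_mul, add_zero] at h3
    refine h3.congr fun N => by ring
  obtain ⟨N, hN, hN0⟩ := ((hlim.eventually (gt_mem_nhds (by norm_num : (0 : ℝ) < 1 / 2))).and
    (eventually_gt_atTop 0)).exists
  set f : ℕ → ℝ → ℝ := fun j => (transferOp α)^[j] fun _ => 1 with hf
  have hfc : ∀ j, InCone α (f j) := inCone_iterate_transferOp hα
  have hcone : InCone α (fun x => ∑ j ∈ Finset.range N, l ^ j * f j x) :=
    InCone.sum hN0 (fun j => by positivity) hfc
  refine ⟨_, hcone, fun x hx => ?_, fun x hx => ?_, ?_⟩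
  · have h0 : l ^ 0 * f 0 x = 1 := by simp [hf]
    rw [← h0]
    exact Finset.single_le_sum (f := fun j => l ^ j * f j x)
      (fun j _ => mul_nonneg (by positivity) ((hfc j).pos x hx).le) (Finset.mem_range.2 hN0)
  · have h1 : transferOp α (fun x => ∑ j ∈ Finset.range N, l ^ j * f j x) x =
        ∑ j ∈ Finset.range N, l ^ j * f (j + 1) x := by
      simp only [hf, Function.iterate_succ_apply', transferOp, branchTransfer, Finset.sum_div,
        ← Finset.sum_add_distrib]
      refine Finset.sum_congr rfl fun j _ => ?_
      ring
    have h2 : l * ∑ j ∈ Finset.range N, l ^ j * f (j + 1) x =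
        (∑ j ∈ Finset.range N, l ^ j * f j x) + l ^ N * f N x - 1 := by
      rw [← Finset.sum_range_succ, Finset.sum_range_succ', Finset.mul_sum]
      have h0 : l ^ 0 * f 0 x = 1 := by simp [hf]
      rw [h0, add_sub_cancel_right]
      refine Finset.sum_congr rfl fun j _ => ?_
      ring
    have h3 : l ^ N * f N x ≤ 1 / 2 :=
      (mul_le_mul_of_nonneg_left (hC N x hx) (by positivity)).trans hN.le
    rw [h1]
    calc _ = (1 + δ) * (l * ∑ j ∈ Finset.range N, l ^ j * f (j + 1) x) := by
          rw [← mul_assoc, hlδ, one_mul]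
      _ ≤ _ := by
          rw [h2]
          exact mul_le_mul_of_nonneg_left (by linarith) (by linarith)
  · have hint : ∫ x in (0 : ℝ)..(1 / 2), ∑ j ∈ Finset.range N, l ^ j * f j x =
        ∑ j ∈ Finset.range N, ∫ x in (0 : ℝ)..(1 / 2), l ^ j * f j x :=
      intervalIntegral.integral_finsetSum (f := fun j x => l ^ j * f j x) fun j _ =>
        (continuous_const.mul (hfc j).cont).intervalIntegrable _ _
    rw [hint]
    simp only [intervalIntegral.integral_const_mul, hf, integral_iterate_transferOp hα]
    rw [← Finset.sum_mul]
    have h1 : ∑ j ∈ Finset.range N, l ^ j ≤ 1 / (1 - l) := by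
      rw [le_div_iff₀ (by linarith), geom_sum_mul_neg]
      linarith [pow_pos hl0 N]
    have h2 : 1 / (1 - l) = (1 + δ) / δ := by
      have : (1 - l) * (1 + δ) = δ := by linarith
      rw [div_eq_div_iff (by linarith) hδ.ne']
      linarith
    rw [h2] at h1
    calc _ ≤ (1 + δ) / δ * (1 / 2) := by gcongr
      _ ≤ 1 / δ := by
        rw [div_mul_eq_mul_div]
        gcongr
        linarith

lemma exists_density (hα : 1 ≤ α) {η κ : ℝ} (hη : 0 < η) (hκ : 0 < κ) :
    ∃ δ : ℝ, 0 < δ ∧ ∃ u : ℝ → ℝ, InCone α u ∧ (∀ x ∈ Icc (0 : ℝ) 1, 1 ≤ u x) ∧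
      (∀ x ∈ Icc (0 : ℝ) 1, transferOp α u x ≤ (1 + δ) * (u x - 1 / 2)) ∧
      ∀ x ∈ Icc η (1 - η), δ * u x ≤ κ := by
  have hH := harnackConst_pos hα
  set A : ℝ := harnackConst α * (2 + α) with hA
  have hA0 : 0 < A := mul_pos hH (by linarith)
  set B : ℝ := (1 / 2 / η) ^ (1 + α) with hB
  have hB0 : 0 < B := by positivity
  have hdiv : Tendsto (fun n : ℕ => ∑ i ∈ Finset.range n, (branchInv α)^[i] (1 / 2)) atTop atTop := by
    have h1 := (Real.tendsto_sum_range_one_div_nat_succ_atTop).atTop_mul_const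
      (by norm_num : (0 : ℝ) < 1 / 2)
    refine tendsto_atTop_mono (fun n => ?_) h1
    rw [Finset.sum_mul]
    refine Finset.sum_le_sum fun i _ => ?_
    refine le_of_eq_of_le ?_ (iterate_branchInv_bounds hα i).2
    have : (i : ℝ) + 1 ≠ 0 := by positivity
    field_simp
  obtain ⟨n, hn, hn1⟩ := ((hdiv.eventually_ge_atTop (2 * A * B / κ)).and
    (eventually_ge_atTop 1)).exists
  have hn1' : (1 : ℝ) ≤ n := by exact_mod_cast hn1
  have hδ : (0 : ℝ) < 1 / n := by positivity
  obtain ⟨u, hu, hu1, hu2, hu3⟩ := exists_resolvent hα hδ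
    (by rw [div_le_one (by linarith)]; exact hn1')
  refine ⟨1 / n, hδ, u, hu, hu1, hu2, ?_⟩
  have hsum := hu.half_mul_sum_le hα hδ (fun x hx => (hu2 x ⟨hx.1, hx.2.trans (by norm_num)⟩).trans
    (mul_le_mul_of_nonneg_left (by linarith) (by linarith))) hu3 n
  rw [one_div_one_div, div_mul_eq_mul_div, div_le_iff₀ hA0] at hsum
  have hm0 : 0 < u (1 / 2) := hu.pos _ ⟨by norm_num, by norm_num⟩
  have hBm : B * u (1 / 2) ≤ κ * n := by
    rw [div_le_iff₀ hκ] at hn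
    have h1 := mul_le_mul_of_nonneg_left hn hm0.le
    have h2 := mul_le_mul_of_nonneg_right hsum hκ.le
    have h3 : (2 * A) * (B * u (1 / 2)) ≤ (2 * A) * (κ * n) := by linarith
    exact le_of_mul_le_mul_left h3 (by positivity)
  have key : ∀ x, η ≤ x → x ≤ 1 / 2 → 1 / (n : ℝ) * u x ≤ κ := fun x h1 h2 => by
    rw [one_div_mul_eq_div, div_le_iff₀ (by linarith)]
    exact (hu.le_half hα hη h1 h2).trans hBm
  intro x hx
  rcases le_total x (1 / 2) with h | h
  · exact key x hx.1 h
  · rw [← hu.symm]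
    exact key _ (by linarith [hx.2]) (by linarith)

end Construction

section Circle

lemma setLIntegral_const_sub (F : ℝ → ENNReal) (c a b : ℝ) :
    ∫⁻ x in Ioo a b, F (c - x) = ∫⁻ x in Ioo (c - b) (c - a), F x := by
  have h := (Measure.measurePreserving_sub_left volume c).setLIntegral_comp_preimage_emb
    (MeasurableEquiv.subLeft c).measurableEmbedding F (Ioo (c - b) (c - a))
  simpa using h

variable {α : ℝ} {u : ℝ → ℝ}

lemma Tmap_eq_liftIco (hα : 1 ≤ α) :
    Tmap α = AddCircle.liftIco 1 0 fun x : ℝ =>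
      if x ≤ 1 / 2 then (branch α x : Circle1) else -(branch α (1 - x) : Circle1) := by
  ext z
  obtain ⟨x, hx, rfl⟩ := AddCircle.eq_coe_Ico z
  have hx' : x ∈ Ico (0 : ℝ) (0 + 1) := by simpa using hx
  rw [Tmap, AddCircle.liftIco_coe_apply hx', AddCircle.liftIco_coe_apply hx', Tlift,
    Int.fract_eq_self.2 hx, Int.floor_eq_zero_iff.2 hx]
  have h2 : (1 + x - 2 ^ α * (1 - x) ^ (1 + α) : ℝ) = 1 + 1 + -branch α (1 - x) := by
    rw [branch_of_nonneg (by linarith [hx.2]) hα]; ring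
  rcases lt_trichotomy x (1 / 2) with h | rfl | h
  · rw [if_pos h, if_pos h.le, branch_of_nonneg hx.1 hα]
    simp
  · rw [if_neg (lt_irrefl _), if_pos le_rfl, h2]
    norm_num [branch_half, AddCircle.coe_period]
  · rw [if_neg h.not_gt, if_neg h.not_ge, h2, AddCircle.coe_add, AddCircle.coe_add,
      AddCircle.coe_add, AddCircle.coe_period]
    simp

lemma Tmap_coe (hα : 1 ≤ α) {x : ℝ} (hx : x ∈ Icc (0 : ℝ) (1 / 2)) :
    Tmap α (x : Circle1) = (branch α x : Circle1) := by
  rw [Tmap_eq_liftIco hα, AddCircle.liftIco_zero_coe_apply ⟨hx.1, by linarith [hx.2]⟩,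
    if_pos hx.2]

lemma Tmap_coe_one_sub (hα : 1 ≤ α) {x : ℝ} (hx : x ∈ Ioo (0 : ℝ) (1 / 2)) :
    Tmap α ((1 - x : ℝ) : Circle1) = ((1 - branch α x : ℝ) : Circle1) := by
  rw [Tmap_eq_liftIco hα, AddCircle.liftIco_zero_coe_apply ⟨by linarith [hx.2], by linarith [hx.1]⟩,
    if_neg (by linarith [hx.2]), sub_sub_cancel, AddCircle.coe_sub, AddCircle.coe_period, zero_sub]

lemma continuous_Tmap (hα : 1 ≤ α) : Continuous (Tmap α) := by
  rw [Tmap_eq_liftIco hα]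
  refine AddCircle.liftIco_zero_continuous ?_ (Continuous.continuousOn ?_)
  · norm_num [branch_zero]
  · have hb := continuous_branch hα
    refine Continuous.if_le ?_ ?_ continuous_id continuous_const ?_
    · exact (AddCircle.continuous_mk' _).comp hb
    · exact ((AddCircle.continuous_mk' _).comp
        (hb.comp (continuous_const.sub continuous_id))).neg
    · rintro x rfl
      norm_num [branch_half, AddCircle.coe_period]

lemma setLIntegral_branch (hα : 1 ≤ α) (h : ℝ → ENNReal) :
    ∫⁻ s in Ioo 0 (1 / 2), ENNReal.ofReal (u s) * h (branch α s) =
      ∫⁻ z in Ioo 0 1, ENNReal.ofReal (branchTransfer α u z) * h z := by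
  have himg : branch α '' Ioo 0 (1 / 2) = Ioo 0 1 := by
    ext z
    constructor
    · rintro ⟨s, hs, rfl⟩
      rw [← branch_zero (α := α), ← branch_half (α := α)]
      exact ⟨strictMono_branch hα hs.1, strictMono_branch hα hs.2⟩
    · intro hz
      refine ⟨branchInv α z, ?_, branch_branchInv hα z⟩
      rw [← branchInv_zero hα, ← branchInv_one hα]
      exact ⟨strictMono_branchInv hα hz.1, strictMono_branchInv hα hz.2⟩
  rw [← himg, lintegral_image_eq_lintegral_abs_deriv_mul measurableSet_Ioo
    (fun s hs => (hasDerivAt_branch hα hs.1).hasDerivWithinAt)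
    (strictMono_branch hα).injective.injOn]
  refine setLIntegral_congr_fun measurableSet_Ioo fun s _ => ?_
  have h1 : 0 < branchDeriv α s := zero_lt_one.trans_le (one_le_branchDeriv hα s)
  simp only [branchTransfer, branchInv_branch hα, abs_of_pos h1]
  rw [← mul_assoc, ← ENNReal.ofReal_mul h1.le, mul_div_cancel₀ _ (ne_of_gt h1)]

/-- The function on the circle induced by the restriction of `f` to `[0, 1)`. -/
def circleLift (f : ℝ → ℝ) : Circle1 → ℝ := AddCircle.liftIco 1 0 f

lemma circleLift_coe {f : ℝ → ℝ} (hf : ∀ x, f (1 - x) = f x) {x : ℝ} (hx : x ∈ Icc (0 : ℝ) 1) :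
    circleLift f (x : Circle1) = f x := by
  rcases hx.2.lt_or_eq with h | rfl
  · exact AddCircle.liftIco_zero_coe_apply ⟨hx.1, h⟩
  · rw [AddCircle.coe_period, ← AddCircle.coe_zero, circleLift,
      AddCircle.liftIco_zero_coe_apply ⟨le_rfl, one_pos⟩, ← hf 0, sub_zero]

lemma continuous_circleLift {f : ℝ → ℝ} (hf : ∀ x, f (1 - x) = f x) (hc : Continuous f) :
    Continuous (circleLift f) :=
  AddCircle.liftIco_zero_continuous (by rw [← hf 0, sub_zero]) hc.continuousOn

lemma lintegral_circle (F : Circle1 → ENNReal) :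
    ∫⁻ x, F x = ∫⁻ x in Ioo (0 : ℝ) 1, F (x : Circle1) := by
  rw [← AddCircle.lintegral_preimage 1 0 F, zero_add, restrict_Ioo_eq_restrict_Ioc]

lemma lintegral_mul_comp_Tmap (hα : 1 ≤ α) (hu : InCone α u) {g : Circle1 → ENNReal}
    (hg : Measurable g) :
    ∫⁻ x, ENNReal.ofReal (circleLift u x) * g (Tmap α x) =
      ∫⁻ x, ENNReal.ofReal (circleLift (transferOp α u) x) * g x := by
  have hT := (continuous_Tmap hα).measurable
  have hum := (continuous_circleLift hu.symm hu.cont).measurable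
  have hvm := (continuous_circleLift (transferOp_symm (α := α) (u := u))
    (continuous_transferOp hα hu.cont)).measurable
  have hbm := (continuous_branchTransfer hα hu.cont).measurable
  have hgm : Measurable fun x : ℝ => g (x : Circle1) :=
    hg.comp (AddCircle.continuous_mk' _).measurable
  rw [lintegral_circle, lintegral_circle]
  have hsplit : ∀ F : ℝ → ENNReal, ∫⁻ x in Ioo 0 1, F x =
      (∫⁻ x in Ioo 0 (1 / 2), F x) + ∫⁻ x in Ioo 0 (1 / 2), F (1 - x) := fun F => by
    rw [setLIntegral_const_sub, sub_zero, restrict_Ioo_eq_restrict_Ioc,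
      restrict_Ioo_eq_restrict_Ioc, restrict_Ioo_eq_restrict_Ioc,
      ← Ioc_union_Ioc_eq_Ioc (a := (0 : ℝ)) (b := 1 / 2) (c := 1) (by norm_num) (by norm_num),
      lintegral_union measurableSet_Ioc (Ioc_disjoint_Ioc_of_le le_rfl)]
    norm_num
  rw [hsplit]
  have h1 : ∫⁻ x in Ioo (0 : ℝ) (1 / 2),
      ENNReal.ofReal (circleLift u (x : Circle1)) * g (Tmap α (x : Circle1)) =
      ∫⁻ z in Ioo (0 : ℝ) 1, ENNReal.ofReal (branchTransfer α u z) * g (z : Circle1) := by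
    rw [← setLIntegral_branch hα]
    refine setLIntegral_congr_fun measurableSet_Ioo fun s hs => ?_
    rw [Tmap_coe hα ⟨hs.1.le, hs.2.le⟩, circleLift_coe hu.symm ⟨hs.1.le, by linarith [hs.2]⟩]
  have h2 : ∫⁻ x in Ioo (0 : ℝ) (1 / 2),
      ENNReal.ofReal (circleLift u ((1 - x : ℝ) : Circle1)) *
        g (Tmap α ((1 - x : ℝ) : Circle1)) =
      ∫⁻ z in Ioo (0 : ℝ) 1, ENNReal.ofReal (branchTransfer α u (1 - z)) * g (z : Circle1) := by
    have h3 := setLIntegral_const_sub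
      (fun z => ENNReal.ofReal (branchTransfer α u (1 - z)) * g (z : Circle1)) 1 0 1
    simp only [sub_sub_cancel, sub_self, sub_zero] at h3
    rw [← h3, ← setLIntegral_branch hα fun z => g ((1 - z : ℝ) : Circle1)]
    refine setLIntegral_congr_fun measurableSet_Ioo fun s hs => ?_
    rw [Tmap_coe_one_sub hα hs, circleLift_coe hu.symm ⟨by linarith [hs.2], by linarith [hs.1]⟩,
      hu.symm]
  rw [h1, h2, ← lintegral_add_left (by fun_prop)]
  refine setLIntegral_congr_fun measurableSet_Ioo fun z hz => ?_
  have hz' : 1 - z ∈ Icc (0 : ℝ) 1 := ⟨by linarith [hz.2], by linarith [hz.1]⟩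
  rw [circleLift_coe transferOp_symm ⟨hz.1.le, hz.2.le⟩, transferOp,
    ENNReal.ofReal_add (hu.branchTransfer_pos hα ⟨hz.1.le, hz.2.le⟩).le
      (hu.branchTransfer_pos hα hz').le, add_mul]

end Circle

section Limit

variable {α : ℝ} {u : ℝ → ℝ}

lemma ae_mem_of_mSupport_subset {θ : Measure ℝ} {s : Set ℝ} (h : mSupport θ ⊆ s) :
    ∀ᵐ t ∂θ, t ∈ s := by
  filter_upwards [Measure.support_mem_ae (μ := θ)] with t ht
  exact h fun U hU => ((Measure.mem_support_iff_forall t).1 ht U hU).ne'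

lemma integral_inv_density_le (hα : 1 ≤ α) (hu : InCone α u) {δ : ℝ} (hδ : 0 < δ)
    (hu1 : ∀ x ∈ Icc (0 : ℝ) 1, 1 ≤ u x)
    (hLu : ∀ x ∈ Icc (0 : ℝ) 1, transferOp α u x ≤ (1 + δ) * (u x - 1 / 2))
    {θ : Measure ℝ} [IsProbabilityMeasure θ] (hθ : θ ≪ volume)
    {μ : Measure Circle1} [IsProbabilityMeasure μ] (hstat : IsStationaryC (Tt α) θ μ)
    (hv : ∀ᵐ t : ℝ ∂θ, ∀ y : Circle1, circleLift (transferOp α u) (y - (t : Circle1)) ≤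
      circleLift (transferOp α u) y + 1 / 4) :
    ∫ x, (circleLift u x)⁻¹ ∂μ ≤ 4 * δ := by
  have huc := continuous_circleLift hu.symm hu.cont
  have hlift1 : ∀ x, 1 ≤ circleLift u x := fun x => by
    obtain ⟨b, hb, rfl⟩ := AddCircle.eq_coe_Ico x
    rw [circleLift_coe hu.symm ⟨hb.1, hb.2.le⟩]
    exact hu1 b ⟨hb.1, hb.2.le⟩
  have hlift2 : ∀ x, circleLift (transferOp α u) x ≤ (1 + δ) * (circleLift u x - 1 / 2) :=
    fun x => by
      obtain ⟨b, hb, rfl⟩ := AddCircle.eq_coe_Ico x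
      rw [circleLift_coe hu.symm ⟨hb.1, hb.2.le⟩, circleLift_coe transferOp_symm ⟨hb.1, hb.2.le⟩]
      exact hLu b ⟨hb.1, hb.2.le⟩
  have hinv : Continuous fun x => (circleLift u x)⁻¹ :=
    huc.inv₀ fun x => (zero_lt_one.trans_le (hlift1 x)).ne'
  set r : Circle1 → ℝ := fun x => (1 + δ) * (1 - (circleLift u x)⁻¹ / 4) with hr
  have hrc : Continuous r := by fun_prop
  have hle1 : ∀ x, (circleLift u x)⁻¹ ≤ 1 := fun x => inv_le_one_of_one_le₀ (hlift1 x)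
  have hr0 : ∀ x, 0 ≤ r x := fun x =>
    mul_nonneg (by linarith) (by linarith [hle1 x])
  have hinvi : Integrable (fun x => (circleLift u x)⁻¹) μ :=
    hinv.integrable_of_hasCompactSupport (HasCompactSupport.of_compactSpace _)
  have key := one_le_lintegral_of_isStationaryC (T := Tmap α) (u := circleLift u) (r := r) hθ
    (continuous_Tmap hα) hstat huc.measurable hrc.measurable
    (fun x => zero_lt_one.trans_le (hlift1 x))
    (fun g hg => lintegral_mul_comp_Tmap hα hu hg) ?_
  · rw [← ofReal_integral_eq_lintegral_ofReal
      (hrc.integrable_of_hasCompactSupport (HasCompactSupport.of_compactSpace _))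
      (Eventually.of_forall hr0), ENNReal.one_le_ofReal, hr, integral_const_mul,
      integral_sub (integrable_const _) (hinvi.div_const _), integral_div] at key
    simp only [integral_const, probReal_univ, smul_eq_mul, mul_one] at key
    have h0 : 0 ≤ ∫ x, (circleLift u x)⁻¹ ∂μ :=
      integral_nonneg fun x => inv_nonneg.2 (zero_le_one.trans (hlift1 x))
    nlinarith
  · filter_upwards [hv] with t ht y
    have h1 : r y * circleLift u y = (1 + δ) * (circleLift u y - 1 / 4) := by
      have := (zero_lt_one.trans_le (hlift1 y)).ne'
      simp only [hr]
      field_simp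
    rw [h1]
    linarith [ht y, hlift2 y]

lemma exists_forall_le_add_of_continuous {v : Circle1 → ℝ} (hv : Continuous v) {e : ℝ} (he : 0 < e) :
    ∃ d > 0, ∀ t : ℝ, |t| < d → ∀ y : Circle1, v (y - (t : Circle1)) ≤ v y + e := by
  obtain ⟨d, hd, h⟩ := Metric.uniformContinuous_iff.1
    (CompactSpace.uniformContinuous_of_continuous hv) e he
  refine ⟨d, hd, fun t ht y => ?_⟩
  have hdist : dist (y - (t : Circle1)) y < d := by
    rw [dist_eq_norm, sub_sub_cancel_left, norm_neg]
    exact (QuotientAddGroup.norm_mk_le_norm (S := AddSubgroup.zmultiples (1 : ℝ))).trans_lt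
      (by simpa using ht)
  have := h hdist
  rw [Real.dist_eq] at this
  linarith [le_abs_self (v (y - (t : Circle1)) - v y)]

lemma abs_sub_le_of_continuous (φ : C(Circle1, ℝ)) {e : ℝ} (he : 0 < e) :
    ∃ η > 0, ∀ x ∈ Icc (0 : ℝ) 1, x ∉ Icc η (1 - η) → |φ (x : Circle1) - φ 0| ≤ e := by
  obtain ⟨d, hd, h⟩ := Metric.continuousAt_iff.1 φ.continuous.continuousAt e he
  have hnorm : ∀ t : ℝ, |t| < d → |φ (t : Circle1) - φ 0| ≤ e := fun t ht => by
    rw [← Real.dist_eq]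
    refine (h ?_).le
    rw [dist_zero_right]
    exact (QuotientAddGroup.norm_mk_le_norm (S := AddSubgroup.zmultiples (1 : ℝ))).trans_lt
      (by simpa using ht)
  refine ⟨d, hd, fun x hx hx' => ?_⟩
  rcases lt_or_ge x d with h1 | h1
  · exact hnorm x (by rwa [abs_of_nonneg hx.1])
  · have h2 : 1 - d < x := by
      by_contra! h3
      exact hx' ⟨h1, h3⟩
    have h3 := hnorm (x - 1) (by rw [abs_sub_comm, abs_of_nonneg (by linarith [hx.2])]; linarith)
    rwa [AddCircle.coe_sub, AddCircle.coe_period, sub_zero] at h3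

end Limit

/-- for `α ≥ 1`, the stationary measures of the additive random
perturbations of the intermittent map converge to `δ₀` in the weak* topology. -/
theorem stationary_measures_tendsto_dirac
    (α : ℝ) (hα : 1 ≤ α)
    (ε : ℕ → ℝ) (hεpos : ∀ k, 0 < ε k) (hεlim : Tendsto ε atTop (𝓝 0))
    (θ : ℕ → Measure ℝ) (hθprob : ∀ k, IsProbabilityMeasure (θ k))
    (hθac : ∀ k, θ k ≪ volume)
    (hθsupp : ∀ k, mSupport (θ k) ⊆ Icc (-(ε k)) (ε k))
    (hθint : ∀ k, (interior (mSupport (θ k))).Nonempty)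
    (μ : ℕ → Measure Circle1) (hμprob : ∀ k, IsProbabilityMeasure (μ k))
    (hstat : ∀ k, IsStationaryC (Tt α) (θ k) (μ k)) :
    ∀ φ : C(Circle1, ℝ),
      Tendsto (fun k => ∫ x, φ x ∂(μ k)) atTop
        (𝓝 (∫ x, φ x ∂(Measure.dirac (0 : Circle1)))) := by
  intro φ
  rw [integral_dirac, Metric.tendsto_atTop']
  intro e he
  obtain ⟨η, hη, hφ⟩ := abs_sub_le_of_continuous φ (half_pos he)
  set M : ℝ := ‖φ‖ with hM
  have hM0 : 0 ≤ M := norm_nonneg _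
  set κ : ℝ := e / (2 * (8 * M + 1)) with hκdef
  have hκ : 0 < κ := by positivity
  have hκM : 8 * M * κ < e / 2 := by
    have : κ * (8 * M + 1) = e / 2 := by rw [hκdef]; field_simp
    linarith
  obtain ⟨δ, hδ, u, hu, hu1, hLu, huκ⟩ := exists_density hα hη hκ
  have hvc := continuous_circleLift (transferOp_symm (α := α) (u := u))
    (continuous_transferOp hα hu.cont)
  obtain ⟨d, hd, hv⟩ := exists_forall_le_add_of_continuous hvc (by norm_num : (0 : ℝ) < 1 / 4)
  obtain ⟨N, hN⟩ := eventually_atTop.1 (hεlim.eventually (gt_mem_nhds hd))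
  refine ⟨N, fun k hk => ?_⟩
  have := hθprob k
  have := hμprob k
  have hinv := integral_inv_density_le hα hu hδ hu1 hLu (hθac k) (hstat k) <| by
    filter_upwards [ae_mem_of_mSupport_subset (hθsupp k)] with t ht
    exact hv t ((abs_le.2 ht).trans_lt (hN k hk.le))
  have hpoint : ∀ x : Circle1, |φ x - φ 0| ≤ e / 2 + 2 * M * (κ / δ) * (circleLift u x)⁻¹ := by
    intro x
    obtain ⟨b, hb, rfl⟩ := AddCircle.eq_coe_Ico x
    have hb' : b ∈ Icc (0 : ℝ) 1 := ⟨hb.1, hb.2.le⟩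
    have hub : 0 < u b := hu.pos b hb'
    rw [circleLift_coe hu.symm hb']
    by_cases hbη : b ∈ Icc η (1 - η)
    · have h1 : |φ (b : Circle1) - φ 0| ≤ 2 * M := by
        have h2 := norm_sub_le (φ (b : Circle1)) (φ 0)
        rw [Real.norm_eq_abs] at h2
        linarith [φ.norm_coe_le_norm (b : Circle1), φ.norm_coe_le_norm 0]
      have h2 : 1 ≤ κ / δ * (u b)⁻¹ := by
        rw [← div_eq_mul_inv, div_div, one_le_div (by positivity)]
        exact huκ b hbη
      have h3 := mul_le_mul_of_nonneg_left h2 (by positivity : 0 ≤ 2 * M)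
      rw [← mul_assoc] at h3
      linarith
    · have : 0 ≤ 2 * M * (κ / δ) * (u b)⁻¹ := by positivity
      linarith [hφ b hb' hbη]
  have hinvc : Continuous fun x => (circleLift u x)⁻¹ :=
    (continuous_circleLift hu.symm hu.cont).inv₀ fun x => by
      obtain ⟨b, hb, rfl⟩ := AddCircle.eq_coe_Ico x
      rw [circleLift_coe hu.symm ⟨hb.1, hb.2.le⟩]
      exact (hu.pos b ⟨hb.1, hb.2.le⟩).ne'
  have hint : ∀ f : Circle1 → ℝ, Continuous f → Integrable f (μ k) := fun f hf =>
    hf.integrable_of_hasCompactSupport (HasCompactSupport.of_compactSpace _)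
  have hsub : (∫ x, φ x ∂(μ k)) - φ 0 = ∫ x, (φ x - φ 0) ∂(μ k) := by
    rw [integral_sub (hint _ φ.continuous) (integrable_const _)]
    simp
  rw [Real.dist_eq, hsub]
  calc |∫ x, (φ x - φ 0) ∂(μ k)| ≤ ∫ x, |φ x - φ 0| ∂(μ k) := abs_integral_le_integral_abs
    _ ≤ ∫ x, (e / 2 + 2 * M * (κ / δ) * (circleLift u x)⁻¹) ∂(μ k) :=
        integral_mono (hint _ (φ.continuous.sub continuous_const).abs)
          (hint _ (continuous_const.add (continuous_const.mul hinvc))) hpoint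
    _ = e / 2 + 2 * M * (κ / δ) * ∫ x, (circleLift u x)⁻¹ ∂(μ k) := by
        rw [integral_add (integrable_const _) ((hint _ hinvc).const_mul _), integral_const_mul]
        simp
    _ ≤ e / 2 + 2 * M * (κ / δ) * (4 * δ) := by gcongr
    _ = e / 2 + 8 * M * κ := by field_simp; ring
    _ < e := by linarith
end
end
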